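/- Let α > 0 be a non-integer, k ≥ 3 an integer, δ > 0, and let h ≥ 1, q ≥ 2, with ξ = l/q for some 1 ≤ l ≤ q−1, and m ≥ 1 with mq ≤ X. Set R₁ = X/(mq) and let R₂ satisfy R₁ < R₂ ≤ 2R₁. Then the exponential sum Σ_{R₁ − ξ ≤ r < R₂ − ξ} e( h (mq)^α (r + ξ)^α ) over integers r is ≪_{k,δ} h^{1/(k(k−1))} (X/(mq))^δ · ( T₁ + T₂ + T₃ ), where T₁ = X^{1 − (k−α)/(k(k−1))} / (mq)^{1 − 1/(k−1)}, T₂ = (X/(mq))^{1 − 1/(k(k−1))}, and T₃ = X^{1 − 2α/(k²(k−1))} / (mq). -/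

import Mathlib

open scoped Classical

/-- `e(x) = e^{2πix}`. -/
noncomputable def e (x : ℝ) : ℂ := Complex.exp (2 * Real.pi * Complex.I * x)

open Polynomial in
/-- The Taylor coefficients of orders `1, …, r` at `η` and of orders `1, …, l` at `ξ`. -/
noncomputable def jet {R : Type*} [CommRing R] (r l : ℕ) (η ξ : R) :
    R[X] →ₗ[R] (Fin r ⊕ Fin l → R) where
  toFun P := Sum.elim (fun i => (taylor η P).coeff (i + 1)) (fun i => (taylor ξ P).coeff (i + 1))
  map_add' P Q := by ext (i | i) <;> simp
  map_smul' c P := by ext (i | i) <;> simp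

open Polynomial in
theorem pow_X_sub_C_dvd_derivative {k : Type*} [Field k] {P : k[X]} {x : k} {r : ℕ}
    (h : ∀ i < r, (taylor x P).coeff (i + 1) = 0) : (X - C x) ^ r ∣ derivative P := by
  have h1 : (X - C x) ^ (r + 1) ∣ P - C (P.eval x) := by
    rw [X_sub_C_pow_dvd_iff, X_pow_dvd_iff]
    intro d hd
    have : (P - C (eval x P)).comp (X + C x) = taylor x P - C (eval x P) := by
      simp [taylor_apply]
    rw [this]
    rcases d with _ | d
    · simp
    · rw [coeff_sub, h d (by omega), coeff_C_succ, sub_zero]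
  have := pow_sub_one_dvd_derivative_of_pow_dvd h1
  simpa using this

open Polynomial in
theorem derivative_eq_zero_of_jet_eq_zero {k : Type*} [Field k] {r l : ℕ} {η ξ : k}
    (hne : η ≠ ξ) {P : k[X]} (hdeg : P.natDegree ≤ r + l) (h : jet r l η ξ P = 0) :
    derivative P = 0 := by
  by_contra hP
  have h1 : (X - C η) ^ r ∣ derivative P :=
    pow_X_sub_C_dvd_derivative fun i hi => congrFun h (Sum.inl ⟨i, hi⟩)
  have h2 : (X - C ξ) ^ l ∣ derivative P :=
    pow_X_sub_C_dvd_derivative fun i hi => congrFun h (Sum.inr ⟨i, hi⟩)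
  have hco : IsCoprime ((X - C η) ^ r) ((X - C ξ) ^ l) :=
    (isCoprime_X_sub_C_of_isUnit_sub (sub_ne_zero.2 hne).isUnit).pow
  have h3 := natDegree_le_of_dvd (hco.mul_dvd h1 h2) hP
  rw [((monic_X_sub_C η).pow r).natDegree_mul ((monic_X_sub_C ξ).pow l),
    natDegree_pow, natDegree_pow, natDegree_X_sub_C, natDegree_X_sub_C, mul_one, mul_one] at h3
  have h4 : P.natDegree ≠ 0 := by
    intro h0
    rw [natDegree_eq_zero] at h0
    obtain ⟨x, rfl⟩ := h0
    simp at hP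
  have := natDegree_derivative_lt h4
  omega

open Polynomial in
theorem jet_surjective_mod {p r l : ℕ} [Fact p.Prime] (hp : r + l < p) {η ξ : ZMod p}
    (hne : η ≠ ξ) (τ : Fin r ⊕ Fin l → ZMod p) :
    ∃ a : Fin (r + l) → ZMod p, jet r l η ξ (∑ j, C (a j) * X ^ (j.1 + 1)) = τ := by
  let Q : (Fin (r + l) → ZMod p) →ₗ[ZMod p] (ZMod p)[X] :=
    ∑ j : Fin (r + l), (LinearMap.toSpanSingleton (ZMod p) _ (X ^ (j.1 + 1))).comp
      (LinearMap.proj j)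
  have hQ : ∀ a, Q a = ∑ j, C (a j) * X ^ (j.1 + 1) := by
    intro a
    simp [Q, smul_eq_C_mul]
  have hinj : Function.Injective ((jet r l η ξ).comp Q) := by
    rw [← LinearMap.ker_eq_bot, LinearMap.ker_eq_bot']
    intro a ha
    rw [LinearMap.comp_apply, hQ] at ha
    have hd := derivative_eq_zero_of_jet_eq_zero hne (by
      apply natDegree_sum_le_of_forall_le
      intro j _
      exact (natDegree_C_mul_X_pow_le _ _).trans (by omega)) ha
    ext j
    have := congrArg (fun P => coeff P j.1) hd
    simp only [coeff_derivative, finsetSum_coeff, coeff_C_mul, coeff_X_pow, coeff_zero] at this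
    rw [Finset.sum_eq_single j (by
      intro b _ hb
      have : ¬ (j.1 + 1 = b.1 + 1) := by
        intro h; exact hb (Fin.ext (by omega))
      rw [if_neg this, mul_zero]) (by simp)] at this
    simp only [if_true, mul_one] at this
    refine (mul_eq_zero.1 this).resolve_right ?_
    have h2 : ((j.1 + 1 : ℕ) : ZMod p) ≠ 0 := by
      rw [Ne, ZMod.natCast_eq_zero_iff]
      intro h
      have := Nat.le_of_dvd (by omega) h
      omega
    exact_mod_cast h2
  have hsurj := (LinearMap.injective_iff_surjective_of_finrank_eq_finrank (by simp)).1 hinj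
  obtain ⟨a, ha⟩ := hsurj τ
  exact ⟨a, by rw [← hQ]; exact ha⟩

open Polynomial in
theorem jet_intCast (p r l : ℕ) (η ξ : ℤ) (P : ℤ[X]) (i : Fin r ⊕ Fin l) :
    ((jet r l η ξ P i : ℤ) : ZMod p) =
      jet r l (η : ZMod p) (ξ : ZMod p) (P.map (Int.castRingHom (ZMod p))) i := by
  rcases i with i | i
  · have h : taylor (η : ZMod p) (P.map (Int.castRingHom (ZMod p))) =
        (taylor η P).map (Int.castRingHom (ZMod p)) := by
      rw [map_taylor, eq_intCast]
    simp only [jet, LinearMap.coe_mk, AddHom.coe_mk, Sum.elim_inl, h, coeff_map, eq_intCast]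
  · have h : taylor (ξ : ZMod p) (P.map (Int.castRingHom (ZMod p))) =
        (taylor ξ P).map (Int.castRingHom (ZMod p)) := by
      rw [map_taylor, eq_intCast]
    simp only [jet, LinearMap.coe_mk, AddHom.coe_mk, Sum.elim_inr, h, coeff_map, eq_intCast]

open Polynomial in
/-- If an additive group of polynomials contains all of `X, …, X ^ (r + l)` modulo `p`, its
elements have arbitrary jets modulo any power of `p`. -/
theorem exists_jet_eq {p r l : ℕ} [Fact p.Prime] (hp : r + l < p) {η ξ : ℤ}
    (hne : ¬ (p : ℤ) ∣ ξ - η) (G : AddSubgroup ℤ[X])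
    (hG : ∀ j ∈ Finset.Icc 1 (r + l), ∃ h : ℤ[X], X ^ j + C (p : ℤ) * h ∈ G) (K : ℕ) :
    ∀ τ : Fin r ⊕ Fin l → ℤ, ∃ h ∈ G, ∀ i, (p : ℤ) ^ K ∣ jet r l η ξ h i - τ i := by
  have hne' : (η : ZMod p) ≠ ξ := by
    intro h
    rw [ZMod.intCast_eq_intCast_iff_dvd_sub] at h
    exact hne h
  have key : ∀ τ : Fin r ⊕ Fin l → ℤ, ∃ h ∈ G, ∀ i, (p : ℤ) ∣ jet r l η ξ h i - τ i := by
    intro τ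
    obtain ⟨a, ha⟩ := jet_surjective_mod hp hne' (fun i => (τ i : ZMod p))
    choose! h hh using hG
    refine ⟨∑ j : Fin (r + l), (a j).val • (X ^ (j.1 + 1) + C (p : ℤ) * h (j.1 + 1)),
      G.sum_mem fun j _ => G.nsmul_mem (hh _ (by simp)) _, fun i => ?_⟩
    have h1 := congrFun ha i
    rw [← dvd_neg, neg_sub, ← ZMod.intCast_eq_intCast_iff_dvd_sub, jet_intCast, ← h1]
    refine congrArg (fun P => jet r l (η : ZMod p) (ξ : ZMod p) P i) ?_
    rw [Polynomial.map_sum]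
    refine Finset.sum_congr rfl fun j _ => ?_
    have : ((a j).val : (ZMod p)[X]) = C (a j) := by
      rw [← C_eq_natCast, ZMod.natCast_zmod_val]
    rw [nsmul_eq_mul, Polynomial.map_mul, Polynomial.map_natCast, this]
    simp
  induction K with
  | zero => intro τ; exact ⟨0, G.zero_mem, fun i => by simp⟩
  | succ K ih =>
    intro τ
    obtain ⟨h, hh, h1⟩ := ih τ
    choose σ hσ using h1
    obtain ⟨h', hh', h2⟩ := key (fun i => - σ i)
    refine ⟨h + (p ^ K : ℕ) • h', G.add_mem hh (G.nsmul_mem hh' _), fun i => ?_⟩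
    have : jet r l η ξ (h + (p ^ K : ℕ) • h') i - τ i =
        (p : ℤ) ^ K * (jet r l η ξ h' i - - σ i) := by
      rw [map_add, map_nsmul, Pi.add_apply, Pi.smul_apply, nsmul_eq_mul]
      push_cast
      linear_combination hσ i
    rw [this, pow_succ]
    exact mul_dvd_mul_left _ (h2 i)

theorem e_add (x y : ℝ) : e (x + y) = e x * e y := by
  simp only [e, ← Complex.exp_add]
  congr 1
  push_cast
  ring

theorem e_zero : e 0 = 1 := by simp [e]

theorem e_intCast (n : ℤ) : e n = 1 := by
  rw [e, Complex.exp_eq_one_iff]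
  exact ⟨n, by push_cast; ring⟩

theorem norm_e (x : ℝ) : ‖e x‖ = 1 := by
  rw [e, Complex.norm_exp]
  simp

theorem e_ne_zero (x : ℝ) : e x ≠ 0 := Complex.exp_ne_zero _

theorem e_neg (x : ℝ) : e (-x) = (e x)⁻¹ := by
  refine eq_inv_of_mul_eq_one_left ?_
  rw [← e_add, neg_add_cancel, e_zero]

theorem e_eq_of_sub_int {x y : ℝ} (n : ℤ) (h : x - y = n) : e x = e y := by
  rw [show x = y + n by linarith, e_add, e_intCast, mul_one]

/-- Some permutation of `Ω` preserving the weight `g` multiplies `F i` by `e (θ i)`, up to a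
common unimodular constant, for all `i ∈ s`. -/
def Phase {Ω ι : Type} (s : Finset ι) (F : ι → Ω → ℂ) (g : Ω → ℝ) (θ : ι → ℝ) : Prop :=
  ∃ (T : Equiv.Perm Ω) (ζ : ℂ), ‖ζ‖ = 1 ∧
    (∀ i ∈ s, ∀ ω, F i (T ω) = ζ * (e (θ i) * F i ω)) ∧ ∀ ω, g (T ω) = g ω

section Phase

variable {Ω ι : Type} {s : Finset ι} {F : ι → Ω → ℂ} {g : Ω → ℝ}

theorem Phase.zero : Phase s F g 0 :=
  ⟨1, 1, by simp, by simp [e_zero], by simp⟩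

theorem Phase.add {θ φ : ι → ℝ} (h : Phase s F g θ) (h' : Phase s F g φ) :
    Phase s F g (θ + φ) := by
  obtain ⟨T, ζ, hζ, hF, hg⟩ := h
  obtain ⟨T', ζ', hζ', hF', hg'⟩ := h'
  refine ⟨T * T', ζ * ζ', by simp [hζ, hζ'], fun i hi ω => ?_, fun ω => ?_⟩
  · rw [Equiv.Perm.mul_apply, hF i hi, hF' i hi, Pi.add_apply, e_add]
    ring
  · rw [Equiv.Perm.mul_apply, hg, hg']

theorem Phase.neg {θ : ι → ℝ} (h : Phase s F g θ) : Phase s F g (-θ) := by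
  obtain ⟨T, ζ, hζ, hF, hg⟩ := h
  have hζ0 : ζ ≠ 0 := by rintro rfl; simp at hζ
  refine ⟨T.symm, ζ⁻¹, by simp [hζ], fun i hi ω => ?_, fun ω => ?_⟩
  · have := hF i hi (T.symm ω)
    rw [Equiv.apply_symm_apply] at this
    rw [this, Pi.neg_apply, e_neg]
    have := e_ne_zero (θ i)
    field_simp
  · have := hg (T.symm ω)
    rwa [Equiv.apply_symm_apply, eq_comm] at this

theorem Phase.congr {θ φ : ι → ℝ} (κ : ℝ) (h : Phase s F g θ)
    (hφ : ∀ i ∈ s, ∃ n : ℤ, θ i - φ i - κ = n) : Phase s F g φ := by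
  obtain ⟨T, ζ, hζ, hF, hg⟩ := h
  refine ⟨T, ζ * e κ, by simp [hζ, norm_e], fun i hi ω => ?_, hg⟩
  obtain ⟨n, hn⟩ := hφ i hi
  rw [hF i hi, e_eq_of_sub_int (y := φ i + κ) n (by linarith), e_add]
  ring

open Polynomial in
/-- The polynomials `P` for which the phase `P (u i) / Q` is available. -/
def phaseGroup (s : Finset ι) (F : ι → Ω → ℂ) (g : Ω → ℝ) (u : ι → ℤ) (Q : ℝ) :
    AddSubgroup ℤ[X] where
  carrier := {P | Phase s F g fun i => ((P.eval (u i) : ℤ) : ℝ) / Q}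
  add_mem' {P P'} h h' := by
    have := Phase.add h h'
    refine (Phase.congr 0 this fun i _ => ⟨0, ?_⟩)
    simp [add_div]
  zero_mem' := by
    refine Phase.zero.congr 0 fun i _ => ⟨0, ?_⟩
    simp
  neg_mem' {P} h := by
    refine (Phase.neg h).congr 0 fun i _ => ⟨0, ?_⟩
    simp [neg_div]

open Polynomial in
/-- The weight `g` is nonnegative and, modulo `p`, all phases `u ^ j / p ^ K` with `1 ≤ j ≤ n`
are available for the family `F`. -/
structure IsNondegenerate (p n K : ℕ) (s : Finset ι) (F : ι → Ω → ℂ) (u : ι → ℤ)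
    (g : Ω → ℝ) : Prop where
  nonneg : ∀ ω, 0 ≤ g ω
  phase : ∀ j ∈ Finset.Icc 1 n, ∃ h : ℤ[X],
    X ^ j + C (p : ℤ) * h ∈ phaseGroup s F g u ((p : ℝ) ^ K)

open Polynomial in
theorem eval_eq_sum_taylor (P : ℤ[X]) (x w : ℤ) :
    P.eval (x + w) = ∑ i ∈ Finset.range (P.natDegree + 1), (taylor x P).coeff i * w ^ i := by
  rw [add_comm, ← taylor_eval, eval_eq_sum_range, natDegree_taylor]

open Polynomial in
theorem dvd_eval_sub_eval_of_taylor {P : ℤ[X]} {x w m : ℤ} {r : ℕ}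
    (h : ∀ i < r, m ∣ (taylor x P).coeff (i + 1)) (hw : m ∣ w ^ (r + 1)) :
    m ∣ P.eval (x + w) - P.eval x := by
  rw [eval_eq_sum_taylor, Finset.sum_range_succ', taylor_coeff_zero, pow_zero, mul_one,
    add_sub_cancel_right]
  refine Finset.dvd_sum fun i _ => ?_
  rcases lt_or_ge i r with hi | hi
  · exact (h i hi).mul_right _
  · exact (hw.trans (pow_dvd_pow w (by omega))).mul_left _

open Polynomial in
theorem exists_eval_eq_of_taylor {P : ℤ[X]} {x : ℤ} {p a l c j : ℕ} (ha : 1 ≤ a)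
    (hj : j ∈ Finset.Icc 1 l)
    (h : ∀ i < l, (p : ℤ) ^ (c + l * a) ∣
      (taylor x P).coeff (i + 1) - if i + 1 = j then (p : ℤ) ^ ((l - j) * a) else 0) :
    ∃ H : ℤ[X], ∀ v : ℤ, (p : ℤ) ^ (c + l * a) ∣ P.eval (x + (p : ℤ) ^ a * v) - P.eval x -
      (p : ℤ) ^ (l * a) * (X ^ j + C (p : ℤ) * H).eval v := by
  refine ⟨∑ i ∈ Finset.range P.natDegree, if i < l then 0 else
    C ((taylor x P).coeff (i + 1) * (p : ℤ) ^ ((i + 1) * a - l * a - 1)) * X ^ (i + 1),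
    fun v => ?_⟩
  have hj' := Finset.mem_Icc.1 hj
  have hjl : (l - j) * a + j * a = l * a := by
    rw [← add_mul]; congr 1; omega
  set N := P.natDegree with hN
  have h1 : P.eval (x + (p : ℤ) ^ a * v) - P.eval x =
      ∑ i ∈ Finset.range (N + l), (taylor x P).coeff (i + 1) * ((p : ℤ) ^ a * v) ^ (i + 1) := by
    rw [eval_eq_sum_taylor, Finset.sum_range_succ', taylor_coeff_zero, pow_zero, mul_one,
      add_sub_cancel_right, ← hN]
    refine Finset.sum_subset (Finset.range_mono (by omega)) fun i _ hi => ?_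
    rw [Finset.mem_range, not_lt] at hi
    rw [coeff_eq_zero_of_natDegree_lt (by rw [natDegree_taylor]; omega), zero_mul]
  have h2 : (p : ℤ) ^ (l * a) * v ^ j =
      ∑ i ∈ Finset.range (N + l), if i + 1 = j then (p : ℤ) ^ (l * a) * v ^ (i + 1) else 0 := by
    rw [Finset.sum_eq_single (j - 1)]
    · rw [if_pos (by omega), Nat.sub_add_cancel hj'.1]
    · intro b _ hb
      rw [if_neg (by omega)]
    · intro hb
      rw [Finset.mem_range] at hb
      omega
  have h3 : (p : ℤ) ^ (l * a) * (p * eval v (∑ i ∈ Finset.range N, if i < l then 0 else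
      C ((taylor x P).coeff (i + 1) * (p : ℤ) ^ ((i + 1) * a - l * a - 1)) * X ^ (i + 1))) =
      ∑ i ∈ Finset.range (N + l), if i < l then 0 else
        (taylor x P).coeff (i + 1) * ((p : ℤ) ^ a * v) ^ (i + 1) := by
    rw [eval_finsetSum, Finset.mul_sum, Finset.mul_sum]
    rw [← Finset.sum_subset (Finset.range_mono (Nat.le_add_right N l))]
    · refine Finset.sum_congr rfl fun i _ => ?_
      split_ifs with hi
      · simp
      · have h4 : (i + 1) * a = l * a + (((i + 1) * a - l * a - 1) + 1) := by
          have : (l + 1) * a ≤ (i + 1) * a := Nat.mul_le_mul_right _ (by omega)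
          rw [add_mul, one_mul] at this
          omega
        rw [mul_pow, ← pow_mul, mul_comm a (i + 1)]
        conv_rhs => rw [h4, pow_add, pow_succ]
        simp only [eval_mul, eval_C, eval_pow, eval_X]
        ring
    · intro i _ hi
      rw [Finset.mem_range, not_lt] at hi
      rw [coeff_eq_zero_of_natDegree_lt (by rw [natDegree_taylor]; omega), zero_mul, ite_self]
  rw [eval_add, eval_pow, eval_X, eval_mul, eval_C, mul_add, h1, h2, h3, ← sub_sub,
    ← Finset.sum_sub_distrib, ← Finset.sum_sub_distrib]
  refine Finset.dvd_sum fun i _ => ?_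
  by_cases hi : i < l
  · rw [if_pos hi, sub_zero]
    have h5 := h i hi
    split_ifs with hij
    · rw [if_pos hij] at h5
      have : (taylor x P).coeff (i + 1) * ((p : ℤ) ^ a * v) ^ (i + 1) -
          (p : ℤ) ^ (l * a) * v ^ (i + 1) =
          ((taylor x P).coeff (i + 1) - (p : ℤ) ^ ((l - j) * a)) *
            ((p : ℤ) ^ a * v) ^ (i + 1) := by
        rw [sub_mul, mul_pow, ← pow_mul, mul_comm a, hij, ← hjl, pow_add]
        ring
      rw [this]
      exact h5.mul_right _
    · rw [if_neg hij, sub_zero] at h5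
      rw [sub_zero]
      exact h5.mul_right _
  · rw [if_neg (by omega), if_neg hi]
    simp

/-- Nondegeneracy in degree `n` passes to nondegeneracy in degree `l ≤ n` on a residue class
modulo `p ^ a`, with a new weight involving a sum over another residue class. -/
theorem IsNondegenerate.transfer {p n K : ℕ} [Fact p.Prime] {u : ι → ℤ}
    (hs : IsNondegenerate p n K s F u g) (hn : n < p) {r l a c : ℕ} (hrl : r + l = n)
    (ha : 1 ≤ a) (hM : c + l * a ≤ K) {ξ η : ℤ} (hne : ¬ (p : ℤ) ∣ ξ - η) {A B : Finset ι}
    (hA : A ⊆ s) (hB : B ⊆ s) (hAξ : ∀ i ∈ A, (p : ℤ) ^ a ∣ u i - ξ)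
    (hBη : ∀ i ∈ B, (p : ℤ) ^ (c + l * a) ∣ (u i - η) ^ (r + 1)) (m : ℕ) :
    IsNondegenerate p l c A F (fun i => (u i - ξ) / (p : ℤ) ^ a)
      (fun ω => g ω * ‖∑ i ∈ B, F i ω‖ ^ m) := by
  refine ⟨fun ω => mul_nonneg (hs.nonneg ω) (by positivity), fun j hj => ?_⟩
  subst hrl
  have hp0 : (p : ℝ) ≠ 0 := by exact_mod_cast (Fact.out : p.Prime).ne_zero
  obtain ⟨P, hP, hjet⟩ := exists_jet_eq hn hne _ hs.phase (c + l * a)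
    (Sum.elim (fun _ => 0)
      (fun i => if i.1 + 1 = j then (p : ℤ) ^ ((l - j) * a) else 0))
  obtain ⟨H, hH⟩ := exists_eval_eq_of_taylor (P := P) (x := ξ) (p := p) (c := c) ha hj
    (fun i hi => hjet (Sum.inr ⟨i, hi⟩))
  refine ⟨H, ?_⟩
  have hP' : Phase s F g fun i => ((P.eval (u i) : ℤ) : ℝ) / (p : ℝ) ^ (c + l * a) := by
    have := (phaseGroup s F g u ((p : ℝ) ^ K)).nsmul_mem hP (p ^ (K - (c + l * a)))
    refine Phase.congr 0 this fun i _ => ⟨0, ?_⟩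
    simp only [nsmul_eq_mul, Polynomial.eval_mul, Polynomial.eval_natCast]
    have : (p : ℝ) ^ K = (p : ℝ) ^ (K - (c + l * a)) * (p : ℝ) ^ (c + l * a) := by
      rw [← pow_add]; congr 1; omega
    rw [this]
    push_cast
    field_simp
    ring
  have hAB : Phase A F (fun ω => g ω * ‖∑ i ∈ B, F i ω‖ ^ m)
      fun i => ((P.eval (u i) : ℤ) : ℝ) / (p : ℝ) ^ (c + l * a) := by
    obtain ⟨T, ζ, hζ, hF, hg⟩ := hP'
    refine ⟨T, ζ, hζ, fun i hi => hF i (hA hi), fun ω => ?_⟩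
    simp only [hg]
    congr 2
    have : ∑ i ∈ B, F i (T ω) =
        ζ * e ((P.eval η : ℤ) / (p : ℝ) ^ (c + l * a)) * ∑ i ∈ B, F i ω := by
      rw [Finset.mul_sum]
      refine Finset.sum_congr rfl fun i hi => ?_
      rw [hF i (hB hi), mul_assoc]
      congr 2
      obtain ⟨k, hk⟩ := dvd_eval_sub_eval_of_taylor (P := P) (x := η) (w := u i - η) (r := r)
        (fun i hi => by simpa [jet] using hjet (Sum.inl ⟨i, hi⟩)) (hBη i hi)
      refine e_eq_of_sub_int k ?_
      rw [add_sub_cancel] at hk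
      rw [← sub_div, ← Int.cast_sub, hk]
      push_cast
      field_simp
    rw [this, norm_mul, norm_mul, hζ, norm_e, one_mul, one_mul]
  refine hAB.congr ((P.eval ξ : ℤ) / (p : ℝ) ^ (c + l * a)) fun i hi => ?_
  obtain ⟨v, hv⟩ := hAξ i hi
  obtain ⟨k, hk⟩ := hH v
  refine ⟨k, ?_⟩
  have hpa : (p : ℤ) ^ a ≠ 0 := pow_ne_zero _ (by exact_mod_cast (Fact.out : p.Prime).ne_zero)
  simp only [hv, Int.mul_ediv_cancel_left _ hpa]
  rw [show u i = ξ + (p : ℤ) ^ a * v by linarith]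
  have hk' : ((P.eval (ξ + (p : ℤ) ^ a * v) : ℤ) : ℝ) = (P.eval ξ : ℤ) + (p : ℝ) ^ (l * a) *
      ((Polynomial.X ^ j + Polynomial.C (p : ℤ) * H).eval v : ℤ) + (p : ℝ) ^ (c + l * a) * k := by
    have := congrArg (Int.cast : ℤ → ℝ) hk
    push_cast at this ⊢
    linarith
  rw [hk', pow_add]
  field_simp
  ring

end Phase

/-- The classes of `t` under congruence of `u` modulo `m`. -/
noncomputable def parts {ι : Type} (m : ℤ) (u : ι → ℤ) (t : Finset ι) : Finset (Finset ι) :=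
  t.image fun i => t.filter fun j => m ∣ u j - u i

section parts

variable {ι : Type} {m M : ℤ} {u : ι → ℤ} {t A B : Finset ι}

theorem mem_parts : B ∈ parts m u t ↔ ∃ i ∈ t, (t.filter fun j => m ∣ u j - u i) = B := by
  simp [parts]

theorem subset_of_mem_parts (h : B ∈ parts m u t) : B ⊆ t := by
  obtain ⟨i, -, rfl⟩ := mem_parts.1 h
  exact Finset.filter_subset _ _

theorem nonempty_of_mem_parts (h : B ∈ parts m u t) : B.Nonempty := by
  obtain ⟨i, hi, rfl⟩ := mem_parts.1 h
  exact ⟨i, by simp [hi]⟩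

theorem eq_filter_of_mem_parts (h : B ∈ parts m u t) {i : ι} (hi : i ∈ B) :
    B = t.filter fun j => m ∣ u j - u i := by
  obtain ⟨k, hk, rfl⟩ := mem_parts.1 h
  have hi' := (Finset.mem_filter.1 hi).2
  ext j
  simp only [Finset.mem_filter, and_congr_right_iff]
  intro _
  constructor
  · intro hj
    simpa using dvd_sub hj hi'
  · intro hj
    simpa using dvd_add hj hi'

theorem dvd_of_mem_parts (h : B ∈ parts m u t) {i j : ι} (hi : i ∈ B) (hj : j ∈ B) :
    m ∣ u j - u i := by
  rw [eq_filter_of_mem_parts h hi] at hj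
  exact (Finset.mem_filter.1 hj).2

theorem eq_of_mem_parts (hA : A ∈ parts m u t) (hB : B ∈ parts m u t) {i j : ι} (hi : i ∈ A)
    (hj : j ∈ B) (hij : m ∣ u j - u i) : A = B := by
  have hj' : j ∈ A := by
    rw [eq_filter_of_mem_parts hA hi, Finset.mem_filter]
    exact ⟨subset_of_mem_parts hB hj, hij⟩
  rw [eq_filter_of_mem_parts hA hj', eq_filter_of_mem_parts hB hj]

theorem parts_pairwiseDisjoint : (parts m u t : Set (Finset ι)).PairwiseDisjoint id := by
  intro A hA B hB hAB
  rw [Function.onFun, Finset.disjoint_left]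
  intro i hi hi'
  exact hAB (eq_of_mem_parts hA hB hi hi' (by simp))

theorem sum_parts {β : Type*} [AddCommMonoid β] (f : ι → β) :
    ∑ B ∈ parts m u t, ∑ i ∈ B, f i = ∑ i ∈ t, f i := by
  have : t = (parts m u t).biUnion id := by
    ext i
    simp only [Finset.mem_biUnion, id]
    constructor
    · intro hi
      exact ⟨_, mem_parts.2 ⟨i, hi, rfl⟩, by simp [hi]⟩
    · rintro ⟨B, hB, hi⟩
      exact subset_of_mem_parts hB hi
  conv_rhs => rw [this]
  rw [Finset.sum_biUnion parts_pairwiseDisjoint]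
  rfl

theorem sum_parts_parts {β : Type*} [AddCommMonoid β] (hm : m ∣ M) (f : Finset ι → β) :
    ∑ B ∈ parts m u t, ∑ A ∈ parts M u B, f A = ∑ A ∈ parts M u t, f A := by
  have key : ∀ B ∈ parts m u t, ∀ i ∈ B,
      (B.filter fun j => M ∣ u j - u i) = t.filter fun j => M ∣ u j - u i := by
    intro B hB i hi
    rw [eq_filter_of_mem_parts hB hi, Finset.filter_filter]
    refine Finset.filter_congr fun j _ => ?_
    exact ⟨fun h => h.2, fun h => ⟨hm.trans h, h⟩⟩
  have : parts M u t = (parts m u t).biUnion (parts M u) := by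
    ext A
    simp only [Finset.mem_biUnion]
    constructor
    · intro hA
      obtain ⟨i, hi, rfl⟩ := mem_parts.1 hA
      have hB : (t.filter fun j => m ∣ u j - u i) ∈ parts m u t := mem_parts.2 ⟨i, hi, rfl⟩
      have hiB : i ∈ t.filter fun j => m ∣ u j - u i := by simp [hi]
      exact ⟨_, hB, mem_parts.2 ⟨i, hiB, key _ hB i hiB⟩⟩
    · rintro ⟨B, hB, hA⟩
      obtain ⟨i, hi, rfl⟩ := mem_parts.1 hA
      exact mem_parts.2 ⟨i, subset_of_mem_parts hB hi, (key _ hB i hi).symm⟩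
  rw [this, Finset.sum_biUnion]
  intro B hB B' hB' hne
  rw [Function.onFun, Finset.disjoint_left]
  intro A hA hA'
  obtain ⟨i, hi⟩ := nonempty_of_mem_parts hA
  exact hne (eq_of_mem_parts hB hB' (subset_of_mem_parts hA hi) (subset_of_mem_parts hA' hi)
    (by simp))

theorem parts_congr {u' : ι → ℤ} (h : ∀ i ∈ t, ∀ j ∈ t, m ∣ u j - u i ↔ M ∣ u' j - u' i) :
    parts m u t = parts M u' t := by
  refine Finset.image_congr fun i hi => ?_
  exact Finset.filter_congr fun j hj => h i hi j hj

theorem card_parts_le {q : ℕ} (hq : 0 < q) : (parts (q : ℤ) u t).card ≤ q := by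
  have : parts (q : ℤ) u t ⊆
      (Finset.range q).image fun z : ℕ => t.filter fun j => (q : ℤ) ∣ u j - z := by
    intro B hB
    obtain ⟨i, hi, rfl⟩ := mem_parts.1 hB
    have h0 : (q : ℤ) ≠ 0 := by exact_mod_cast hq.ne'
    have h1 := Int.emod_nonneg (u i) h0
    have h2 := Int.emod_lt_of_pos (u i) (show (0 : ℤ) < q by exact_mod_cast hq)
    refine Finset.mem_image.2 ⟨(u i % q).toNat, by rw [Finset.mem_range]; omega, ?_⟩
    refine Finset.filter_congr fun j _ => ?_
    rw [Int.toNat_of_nonneg h1]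
    have h3 : (q : ℤ) ∣ u i - u i % q := Int.dvd_self_sub_emod
    constructor
    · intro h
      simpa using dvd_sub h h3
    · intro h
      simpa using dvd_add h h3
  simpa using (Finset.card_le_card this).trans Finset.card_image_le

end parts

/-- The triangular number `n (n + 1) / 2`. -/
def tri : ℕ → ℕ
  | 0 => 0
  | n + 1 => tri n + (n + 1)

theorem two_mul_tri (n : ℕ) : 2 * tri n = n * (n + 1) := by
  induction n with
  | zero => rfl
  | succ n ih => rw [tri, mul_add, ih]; ring

theorem tri_strictMono : StrictMono tri := strictMono_nat_of_lt_succ fun n => by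
  rw [tri]; omega

theorem tri_pos {n : ℕ} (hn : 1 ≤ n) : 1 ≤ tri n := tri_strictMono hn

section energy

variable {Ω ι : Type} [Fintype Ω]

/-- The weighted moment of order `2 * k` of `∑ i ∈ t, F i`. -/
noncomputable def energy (g : Ω → ℝ) (F : ι → Ω → ℂ) (k : ℕ) (t : Finset ι) : ℝ :=
  ∑ ω, g ω * ‖∑ i ∈ t, F i ω‖ ^ (2 * k)

/-- A weighted mixed moment of the sums of `F` over `A` and over `B`. -/
noncomputable def mixedEnergy (g : Ω → ℝ) (F : ι → Ω → ℂ) (k m : ℕ) (A B : Finset ι) : ℝ :=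
  ∑ ω, g ω * ‖∑ i ∈ A, F i ω‖ ^ (2 * k) * ‖∑ i ∈ B, F i ω‖ ^ (2 * m)

/-- The square function side of a decoupling inequality: the sum of the squares of the weighted
`L ^ (2 * k)` norms over the classes modulo `M`. -/
noncomputable def squareSum (g : Ω → ℝ) (F : ι → Ω → ℂ) (u : ι → ℤ) (k : ℕ) (M : ℤ)
    (t : Finset ι) : ℝ :=
  ∑ B ∈ parts M u t, energy g F k B ^ ((1 : ℝ) / k)

variable {g : Ω → ℝ} {F : ι → Ω → ℂ} {u : ι → ℤ}

theorem energy_nonneg (hg : ∀ ω, 0 ≤ g ω) (k : ℕ) (t : Finset ι) : 0 ≤ energy g F k t :=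
  Finset.sum_nonneg fun ω _ => mul_nonneg (hg ω) (by positivity)

theorem mixedEnergy_nonneg (hg : ∀ ω, 0 ≤ g ω) (k m : ℕ) (A B : Finset ι) :
    0 ≤ mixedEnergy g F k m A B :=
  Finset.sum_nonneg fun ω _ => mul_nonneg (mul_nonneg (hg ω) (by positivity)) (by positivity)

theorem squareSum_nonneg (hg : ∀ ω, 0 ≤ g ω) (k : ℕ) (M : ℤ) (t : Finset ι) :
    0 ≤ squareSum g F u k M t :=
  Finset.sum_nonneg fun _ _ => Real.rpow_nonneg (energy_nonneg hg _ _) _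

theorem sum_squareSum_parts {m M : ℤ} (hm : m ∣ M) (k : ℕ) (t : Finset ι) :
    ∑ B ∈ parts m u t, squareSum g F u k M B = squareSum g F u k M t :=
  sum_parts_parts hm _

theorem mixedEnergy_comm (k m : ℕ) (A B : Finset ι) :
    mixedEnergy g F k m A B = mixedEnergy g F m k B A :=
  Finset.sum_congr rfl fun ω _ => by ring

theorem energy_mul_norm_pow (k m : ℕ) (A B : Finset ι) :
    energy (fun ω => g ω * ‖∑ i ∈ B, F i ω‖ ^ (2 * m)) F k A = mixedEnergy g F k m A B :=
  Finset.sum_congr rfl fun ω _ => by ring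

end energy

/-- The decoupling inequality in degree `n` at scale `p ^ c` with constant `D`. -/
def Decoupling (p n c : ℕ) (D : ℝ) : Prop :=
  ∀ (Ω ι : Type) [Fintype Ω] (s : Finset ι) (F : ι → Ω → ℂ) (u : ι → ℤ) (g : Ω → ℝ),
    IsNondegenerate p n (n * c) s F u g →
      energy g F (tri n) s ≤ D * squareSum g F u (tri n) ((p : ℤ) ^ c) s ^ tri n

/-- The bilinear decoupling inequality in degree `n` at scale `p ^ c`, for classes modulo `p ^ a`
and `p ^ b` that are distinct modulo `p`, with constant `D`. -/
def BilinearDecoupling (p n c l a b : ℕ) (D : ℝ) : Prop :=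
  ∀ (Ω ι : Type) [Fintype Ω] (s : Finset ι) (F : ι → Ω → ℂ) (u : ι → ℤ) (g : Ω → ℝ)
    (A B : Finset ι) (ξ η : ℤ), IsNondegenerate p n (n * c) s F u g → A ⊆ s → B ⊆ s →
    (∀ i ∈ A, (p : ℤ) ^ a ∣ u i - ξ) → (∀ i ∈ B, (p : ℤ) ^ b ∣ u i - η) → ¬ (p : ℤ) ∣ ξ - η →
      mixedEnergy g F (tri l) (tri n - tri l) A B ≤
        D * squareSum g F u (tri n) ((p : ℤ) ^ c) A ^ tri l *
          squareSum g F u (tri n) ((p : ℤ) ^ c) B ^ (tri n - tri l)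

theorem e_eq_one_iff {x : ℝ} : e x = 1 ↔ ∃ n : ℤ, x = n := by
  constructor
  · intro h
    obtain ⟨n, hn⟩ := Complex.exp_eq_one_iff.1 h
    refine ⟨n, ?_⟩
    have h2 : (2 * Real.pi * Complex.I : ℂ) ≠ 0 := by
      simp [Real.pi_ne_zero]
    have : (x : ℂ) = n := mul_left_cancel₀ h2 (by rw [hn]; ring)
    exact_mod_cast this
  · rintro ⟨n, rfl⟩
    exact e_intCast n

theorem rpow_one_div_pow {x : ℝ} (hx : 0 ≤ x) {k : ℕ} (hk : 1 ≤ k) :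
    (x ^ ((1 : ℝ) / k)) ^ k = x := by
  rw [one_div, Real.rpow_inv_natCast_pow hx (by omega)]

theorem pow_rpow_one_div {x : ℝ} (hx : 0 ≤ x) {k : ℕ} (hk : 1 ≤ k) :
    (x ^ k) ^ ((1 : ℝ) / k) = x := by
  rw [one_div, Real.pow_rpow_inv_natCast hx (by omega)]

theorem sum_pow_le_pow_sum_of_nonneg {β : Type*} (t : Finset β) {f : β → ℝ}
    (hf : ∀ i ∈ t, 0 ≤ f i) {k : ℕ} (hk : 1 ≤ k) : ∑ i ∈ t, f i ^ k ≤ (∑ i ∈ t, f i) ^ k := by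
  obtain ⟨k, rfl⟩ := Nat.exists_eq_add_of_le' hk
  rw [pow_succ, Finset.mul_sum]
  refine Finset.sum_le_sum fun i hi => ?_
  rw [pow_succ]
  exact mul_le_mul_of_nonneg_right
    (pow_le_pow_left₀ (hf i hi) (Finset.single_le_sum hf hi) _) (hf i hi)

theorem pow_sum_le_of_card_le {β : Type*} (t : Finset β) {f : β → ℝ} (hf : ∀ i ∈ t, 0 ≤ f i)
    {q : ℝ} (hq : (t.card : ℝ) ≤ q) (k : ℕ) :
    (∑ i ∈ t, f i) ^ (k + 1) ≤ q ^ k * ∑ i ∈ t, f i ^ (k + 1) := by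
  rcases t.eq_empty_or_nonempty with rfl | ht
  · simp
  have hc : (0 : ℝ) < t.card := by exact_mod_cast ht.card_pos
  have := pow_sum_div_card_le_sum_pow hf k
  rw [div_le_iff₀ (by positivity), mul_comm] at this
  refine this.trans (mul_le_mul_of_nonneg_right (pow_le_pow_left₀ hc.le hq k) ?_)
  exact Finset.sum_nonneg fun i hi => pow_nonneg (hf i hi) _

section energy

variable {Ω ι : Type} [Fintype Ω] {s : Finset ι} {F : ι → Ω → ℂ} {u : ι → ℤ} {g : Ω → ℝ}

theorem sum_energy_parts_le (hg : ∀ ω, 0 ≤ g ω) {k : ℕ} (hk : 1 ≤ k) (M : ℤ) (t : Finset ι) :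
    ∑ B ∈ parts M u t, energy g F k B ≤ squareSum g F u k M t ^ k := by
  refine le_trans (le_of_eq ?_) (sum_pow_le_pow_sum_of_nonneg _
    (fun B _ => Real.rpow_nonneg (energy_nonneg hg k B) _) hk)
  exact Finset.sum_congr rfl fun B _ => (rpow_one_div_pow (energy_nonneg hg k B) hk).symm

theorem energy_le_sum_energy_parts (hg : ∀ ω, 0 ≤ g ω) {k : ℕ} (hk : 1 ≤ k) {q : ℕ}
    (hq : 0 < q) (t : Finset ι) :
    energy g F k t ≤ (q : ℝ) ^ (2 * k) * ∑ B ∈ parts (q : ℤ) u t, energy g F k B := by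
  simp only [energy]
  rw [Finset.sum_comm, Finset.mul_sum]
  refine Finset.sum_le_sum fun ω _ => ?_
  rw [← Finset.mul_sum, mul_left_comm]
  refine mul_le_mul_of_nonneg_left ?_ (hg ω)
  rw [← sum_parts (m := (q : ℤ)) (u := u)]
  refine (pow_le_pow_left₀ (norm_nonneg _) (norm_sum_le _ _) _).trans ?_
  obtain ⟨j, hj⟩ := Nat.exists_eq_add_of_le' (show 1 ≤ 2 * k by omega)
  rw [hj]
  refine (pow_sum_le_of_card_le _ (fun _ _ => norm_nonneg _)
    (Nat.cast_le.2 (card_parts_le hq)) j).trans ?_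
  refine mul_le_mul_of_nonneg_right (pow_le_pow_right₀ (by exact_mod_cast hq) (by omega)) ?_
  positivity

theorem sum_mul_conj_eq_zero {θ : ι → ℝ} (h : Phase s F g θ) {i j : ι} (hi : i ∈ s) (hj : j ∈ s)
    (hij : ∀ n : ℤ, θ i - θ j ≠ n) :
    ∑ ω, (g ω : ℂ) * (F i ω * (starRingEnd ℂ) (F j ω)) = 0 := by
  obtain ⟨T, ζ, hζ, hF, hg⟩ := h
  have h1 : ∑ ω, (g ω : ℂ) * (F i ω * (starRingEnd ℂ) (F j ω)) =
      e (θ i - θ j) * ∑ ω, (g ω : ℂ) * (F i ω * (starRingEnd ℂ) (F j ω)) := by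
    conv_lhs => rw [← Equiv.sum_comp T]
    rw [Finset.mul_sum]
    refine Finset.sum_congr rfl fun ω _ => ?_
    have h2 : (starRingEnd ℂ) (e (θ j)) = e (-θ j) := by
      rw [e_neg, Complex.inv_eq_conj (norm_e _)]
    have h3 : ζ * (starRingEnd ℂ) ζ = 1 := by
      rw [Complex.mul_conj, Complex.normSq_eq_norm_sq, hζ]; simp
    rw [hF i hi, hF j hj, hg, map_mul, map_mul, h2, sub_eq_add_neg, e_add]
    linear_combination ((g ω : ℂ) * (e (θ i) * F i ω) * (e (-θ j) * (starRingEnd ℂ) (F j ω))) * h3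
  by_contra h0
  have h4 : e (θ i - θ j) = 1 := mul_right_cancel₀ h0 (by rw [one_mul]; exact h1.symm)
  obtain ⟨n, hn⟩ := e_eq_one_iff.1 h4
  exact hij n hn

theorem energy_one_eq (t : Finset ι) : (energy g F 1 t : ℂ) =
    ∑ i ∈ t, ∑ j ∈ t, ∑ ω, (g ω : ℂ) * (F i ω * (starRingEnd ℂ) (F j ω)) := by
  rw [energy]
  simp_rw [Finset.sum_comm (t := (Finset.univ : Finset Ω)) (s := t)]
  push_cast
  refine Finset.sum_congr rfl fun ω _ => ?_
  rw [← Complex.mul_conj', map_sum, Finset.sum_mul_sum, Finset.mul_sum]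
  refine Finset.sum_congr rfl fun i _ => ?_
  rw [Finset.mul_sum]

theorem decoupling_one {p : ℕ} [Fact p.Prime] (c : ℕ) : Decoupling p 1 c 1 := by
  intro Ω ι _ s F u g hs
  have ht : tri 1 = 1 := rfl
  rw [ht, one_mul, pow_one]
  simp only [squareSum, Nat.cast_one, div_one, Real.rpow_one]
  refine le_of_eq ?_
  rw [← Complex.ofReal_inj]
  push_cast
  simp only [energy_one_eq]
  rw [← sum_parts (m := (p : ℤ) ^ c) (u := u)]
  refine Finset.sum_congr rfl fun B hB => Finset.sum_congr rfl fun i hi => ?_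
  have hBs := subset_of_mem_parts hB
  refine (Finset.sum_subset hBs fun j hj hjB => ?_).symm
  obtain ⟨H, hH⟩ := hs.phase 1 (by simp)
  refine sum_mul_conj_eq_zero hH (hBs hi) hj fun n hn => hjB ?_
  rw [eq_filter_of_mem_parts hB hi, Finset.mem_filter]
  refine ⟨hj, ?_⟩
  obtain ⟨w, hw⟩ := Polynomial.sub_dvd_eval_sub (u i) (u j) H
  have hp0 : (p : ℝ) ^ (1 * c) ≠ 0 := by
    have : (p : ℝ) ≠ 0 := by exact_mod_cast (Fact.out : p.Prime).ne_zero
    positivity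
  rw [← sub_div, div_eq_iff hp0] at hn
  rw [one_mul] at hn
  have hn' : (u i - u j) * (1 + p * w) = n * (p : ℤ) ^ c := by
    have h1 : (Polynomial.eval (u i) (Polynomial.X ^ 1 + Polynomial.C (p : ℤ) * H)) -
      (Polynomial.eval (u j) (Polynomial.X ^ 1 + Polynomial.C (p : ℤ) * H)) =
      n * (p : ℤ) ^ c := by exact_mod_cast hn
    rw [← h1]
    simp only [Polynomial.eval_add, Polynomial.eval_mul, Polynomial.eval_pow, Polynomial.eval_X,
      Polynomial.eval_C]
    linear_combination (-(p : ℤ)) * hw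
  have hco : IsCoprime ((p : ℤ) ^ c) (1 + p * w) := by
    refine IsCoprime.pow_left ⟨-w, 1, by ring⟩
  rw [← neg_sub, dvd_neg]
  exact hco.dvd_of_dvd_mul_right ⟨n, by rw [hn']; ring⟩

theorem decoupling_trivial {p : ℕ} [Fact p.Prime] {n : ℕ} (hn : 1 ≤ n) (c : ℕ) :
    Decoupling p n c (((p : ℝ) ^ c) ^ (2 * tri n)) := by
  intro Ω ι _ s F u g hs
  have hp : 0 < p ^ c := pow_pos (Fact.out : p.Prime).pos _
  have h := energy_le_sum_energy_parts (F := F) (u := u) hs.nonneg (tri_pos hn) hp s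
  push_cast at h
  refine h.trans (mul_le_mul_of_nonneg_left ?_ (by positivity))
  exact sum_energy_parts_le hs.nonneg (tri_pos hn) _ _

end energy

theorem pow_sum_le_of_pow_le {β : Type*} (t : Finset β) {φ f h : β → ℝ} {P m : ℕ}
    (hm : 1 ≤ m) (hφ : ∀ i ∈ t, 0 ≤ φ i) (hf : ∀ i ∈ t, 0 ≤ f i) (hh : ∀ i ∈ t, 0 ≤ h i)
    (hle : ∀ i ∈ t, φ i ^ (P + m) ≤ f i ^ P * h i ^ m) :
    (∑ i ∈ t, φ i) ^ (P + m) ≤ (∑ i ∈ t, f i) ^ P * (∑ i ∈ t, h i) ^ m := by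
  rcases Nat.eq_zero_or_pos P with rfl | hP
  · simp only [zero_add, pow_zero, one_mul] at hle ⊢
    refine pow_le_pow_left₀ (Finset.sum_nonneg hφ) (Finset.sum_le_sum fun i hi => ?_) _
    exact le_of_pow_le_pow_left₀ (by omega) (hh i hi) (hle i hi)
  have hP' : (0 : ℝ) < P := by exact_mod_cast hP
  have hm' : (0 : ℝ) < m := by exact_mod_cast hm
  set p : ℝ := (P + m) / P with hp
  set q : ℝ := (P + m) / m with hq
  have hpq : p.HolderConjugate q := by
    rw [Real.holderConjugate_iff]
    refine ⟨by rw [hp, lt_div_iff₀ hP']; linarith, ?_⟩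
    rw [hp, hq]
    field_simp
  have key := Real.inner_le_Lp_mul_Lq_of_nonneg t (f := fun i => f i ^ (1 / p))
    (g := fun i => h i ^ (1 / q)) hpq (fun i hi => Real.rpow_nonneg (hf i hi) _)
    (fun i hi => Real.rpow_nonneg (hh i hi) _)
  have e1 : ∑ i ∈ t, (f i ^ (1 / p)) ^ p = ∑ i ∈ t, f i := Finset.sum_congr rfl fun i hi => by
    rw [← Real.rpow_mul (hf i hi), one_div, inv_mul_cancel₀ hpq.pos.ne', Real.rpow_one]
  have e2 : ∑ i ∈ t, (h i ^ (1 / q)) ^ q = ∑ i ∈ t, h i := Finset.sum_congr rfl fun i hi => by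
    rw [← Real.rpow_mul (hh i hi), one_div, inv_mul_cancel₀ hpq.symm.pos.ne', Real.rpow_one]
  rw [e1, e2] at key
  have hroot : ∀ {x y : ℝ}, 0 ≤ x → 0 ≤ y →
      (x ^ (1 / p) * y ^ (1 / q)) ^ (P + m) = x ^ P * y ^ m := by
    intro x y hx hy
    rw [mul_pow, ← Real.rpow_natCast (x ^ (1 / p)), ← Real.rpow_natCast (y ^ (1 / q)),
      ← Real.rpow_mul hx, ← Real.rpow_mul hy, ← Real.rpow_natCast x P, ← Real.rpow_natCast y m]
    congr 2
    · rw [hp]; push_cast; field_simp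
    · rw [hq]; push_cast; field_simp
  rw [← hroot (Finset.sum_nonneg hf) (Finset.sum_nonneg hh)]
  refine pow_le_pow_left₀ (Finset.sum_nonneg hφ) (le_trans (Finset.sum_le_sum fun i hi => ?_) key) _
  refine le_of_pow_le_pow_left₀ (n := P + m) (by omega) ?_ ?_
  · exact mul_nonneg (Real.rpow_nonneg (hf i hi) _) (Real.rpow_nonneg (hh i hi) _)
  · rw [hroot (hf i hi) (hh i hi)]
    exact hle i hi

section parts

variable {ι : Type} {u : ι → ℤ} {A : Finset ι}

theorem parts_rescale {p : ℕ} (hp : p ≠ 0) {a c : ℕ} {ξ : ℤ} (hA : ∀ i ∈ A, (p : ℤ) ^ a ∣ u i - ξ) :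
    parts ((p : ℤ) ^ c) (fun i => (u i - ξ) / (p : ℤ) ^ a) A = parts ((p : ℤ) ^ (a + c)) u A := by
  refine parts_congr fun i hi j hj => ?_
  have hpa : (p : ℤ) ^ a ≠ 0 := pow_ne_zero _ (by exact_mod_cast hp)
  obtain ⟨v, hv⟩ := hA i hi
  obtain ⟨w, hw⟩ := hA j hj
  rw [hv, hw, Int.mul_ediv_cancel_left _ hpa, Int.mul_ediv_cancel_left _ hpa,
    show u j - u i = (p : ℤ) ^ a * (w - v) by linear_combination hw - hv, pow_add,
    mul_dvd_mul_iff_left hpa]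

end parts

section energy

variable {Ω ι : Type} [Fintype Ω] {s : Finset ι} {F : ι → Ω → ℂ} {u : ι → ℤ} {g : Ω → ℝ}
  {p n : ℕ}

theorem not_dvd_sub_add_one [Fact p.Prime] (ξ : ℤ) : ¬ (p : ℤ) ∣ ξ - (ξ + 1) := by
  rw [show ξ - (ξ + 1) = -1 by ring, dvd_neg, ← Int.natCast_one, Int.natCast_dvd_natCast]
  exact (Fact.out : p.Prime).not_dvd_one

/-- Decoupling for a residue class, by rescaling. -/
theorem Decoupling.energy_le [Fact p.Prime] {c a : ℕ} {D : ℝ} (hD : Decoupling p n c D) (hn : n < p)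
    (hs : IsNondegenerate p n (n * (a + c)) s F u g) (ha : 1 ≤ a) {A : Finset ι} (hA : A ⊆ s)
    {ξ : ℤ} (hAξ : ∀ i ∈ A, (p : ℤ) ^ a ∣ u i - ξ) :
    energy g F (tri n) A ≤ D * squareSum g F u (tri n) ((p : ℤ) ^ (a + c)) A ^ tri n := by
  have h := hs.transfer hn (zero_add n) ha (c := n * c) (by rw [mul_add]; omega)
    (not_dvd_sub_add_one ξ) hA (Finset.empty_subset s) hAξ (by simp) 0
  simp only [pow_zero, mul_one] at h
  have := hD _ _ A F _ g h
  rwa [squareSum, parts_rescale (Fact.out : p.Prime).ne_zero hAξ] at this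

/-- Decoupling in lower degree refines one of the two classes. -/
theorem BilinearDecoupling.refine_left [Fact p.Prime] {l r a b c c' : ℕ} {D E : ℝ} (hn : n < p)
    (hrl : r + l = n) (hl : 1 ≤ l) (hD : Decoupling p l c' D) (hD0 : 0 ≤ D) (hE0 : 0 ≤ E)
    (hE : BilinearDecoupling p n c l (a + c') b E) (ha : 1 ≤ a) (hac : a + c' ≤ c)
    (hab : l * (a + c') ≤ (r + 1) * b) : BilinearDecoupling p n c l a b (D * E) := by
  intro Ω ι _ s F u g A B ξ η hs hA hB hAξ hBη hne
  have h := hs.transfer hn hrl ha (c := l * c')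
    (by rw [← mul_add]; exact Nat.mul_le_mul (by omega) (by omega)) hne hA hB hAξ
    (fun i hi => by
      refine dvd_trans ?_ (pow_dvd_pow_of_dvd (hBη i hi) (r + 1))
      rw [← pow_mul]
      refine pow_dvd_pow _ ?_
      calc l * c' + l * a = l * (a + c') := by ring
        _ ≤ b * (r + 1) := by rw [mul_comm b]; exact hab) (2 * (tri n - tri l))
  have hg := hs.nonneg
  have h1 := hD _ _ A F _ _ h
  rw [squareSum, parts_rescale (Fact.out : p.Prime).ne_zero hAξ] at h1
  simp only [energy_mul_norm_pow] at h1
  have htl := tri_pos hl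
  set S := squareSum g F u (tri n) ((p : ℤ) ^ c) with hS
  have hS0 : ∀ t, 0 ≤ S t := squareSum_nonneg hg _ _
  refine h1.trans ?_
  rw [mul_assoc, mul_assoc]
  refine mul_le_mul_of_nonneg_left ?_ hD0
  have hEB : 0 ≤ E * S B ^ (tri n - tri l) := mul_nonneg hE0 (pow_nonneg (hS0 _) _)
  have h2 : ∀ A' ∈ parts ((p : ℤ) ^ (a + c')) u A,
      mixedEnergy g F (tri l) (tri n - tri l) A' B ^ ((1 : ℝ) / tri l) ≤
        (E * S B ^ (tri n - tri l)) ^ ((1 : ℝ) / tri l) * S A' := by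
    intro A' hA'
    obtain ⟨i, hi⟩ := nonempty_of_mem_parts hA'
    have hA'A := subset_of_mem_parts hA'
    have h3 := hE Ω ι s F u g A' B (u i) η hs (hA'A.trans hA) hB
      (fun j hj => dvd_of_mem_parts hA' hi hj) hBη (fun hd => hne (by
        have h4 : (p : ℤ) ∣ u i - ξ := (dvd_pow_self _ (by omega)).trans (hAξ i (hA'A hi))
        simpa using dvd_sub hd h4))
    rw [← hS] at h3
    calc mixedEnergy g F (tri l) (tri n - tri l) A' B ^ ((1 : ℝ) / tri l)
        ≤ (E * S B ^ (tri n - tri l) * S A' ^ tri l) ^ ((1 : ℝ) / tri l) :=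
          Real.rpow_le_rpow (mixedEnergy_nonneg hg _ _ _ _) (by linarith) (by positivity)
      _ = _ := by
          rw [Real.mul_rpow hEB (pow_nonneg (hS0 _) _), pow_rpow_one_div (hS0 _) htl]
  calc (∑ A' ∈ parts ((p : ℤ) ^ (a + c')) u A,
        mixedEnergy g F (tri l) (tri n - tri l) A' B ^ ((1 : ℝ) / tri l)) ^ tri l
      ≤ ((E * S B ^ (tri n - tri l)) ^ ((1 : ℝ) / tri l) * S A) ^ tri l := by
        refine pow_le_pow_left₀ (Finset.sum_nonneg fun A' _ =>
          Real.rpow_nonneg (mixedEnergy_nonneg hg _ _ _ _) _) ?_ _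
        refine (Finset.sum_le_sum h2).trans ?_
        rw [← Finset.mul_sum, hS, sum_squareSum_parts (pow_dvd_pow _ hac)]
    _ = E * (S A ^ tri l * S B ^ (tri n - tri l)) := by
        rw [mul_pow, rpow_one_div_pow hEB htl]
        ring

theorem tri_add (r l : ℕ) : tri (r + l) = tri r + tri l + r * l := by
  have h1 := two_mul_tri (r + l)
  have h2 := two_mul_tri r
  have h3 := two_mul_tri l
  nlinarith

/-- Interpolation between two bilinear decoupling inequalities. -/
theorem BilinearDecoupling.interpolate {r l a b c : ℕ} {B₁ B₂ D : ℝ} (hr : 1 ≤ r)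
    (hrl : r + (l + 1) = n) (h₁ : BilinearDecoupling p n c r b a B₁)
    (h₂ : BilinearDecoupling p n c l a b B₂) (hB₁ : 0 ≤ B₁) (hD : 0 ≤ D)
    (hle : B₁ * B₂ ^ r ≤ D ^ (1 + r)) : BilinearDecoupling p n c (l + 1) a b D := by
  intro Ω ι _ s F u g A B ξ η hs hA hB hAξ hBη hne
  have hg := hs.nonneg
  have h1 := h₁ Ω ι s F u g B A η ξ hs hB hA hBη hAξ (by rwa [← neg_sub, dvd_neg])
  have h2 := h₂ Ω ι s F u g A B ξ η hs hA hB hAξ hBη hne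
  set S := squareSum g F u (tri n) ((p : ℤ) ^ c) with hS
  have hS0 : ∀ t, 0 ≤ S t := squareSum_nonneg hg _ _
  have hn : tri n = tri r + (tri l + (l + 1)) + r * (l + 1) := by rw [← hrl, tri_add]; rfl
  have e1 : tri n - tri r = tri l + (l + 1) + r * (l + 1) := by omega
  have e2 : tri n - tri l = tri r + (l + 1) + r * (l + 1) := by omega
  have e3 : tri n - tri (l + 1) = tri r + r * (l + 1) := by
    rw [show tri (l + 1) = tri l + (l + 1) from rfl]; omega
  have hid : ∀ x y : ℝ, (x ^ tri (l + 1) * y ^ (tri n - tri (l + 1))) ^ (1 + r) =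
      (y ^ tri r * x ^ (tri n - tri r)) ^ 1 * (x ^ tri l * y ^ (tri n - tri l)) ^ r := by
    intro x y
    rw [e1, e2, e3, show tri (l + 1) = tri l + (l + 1) from rfl]
    have := two_mul_tri r
    ring
  have key := pow_sum_le_of_pow_le (P := 1) (m := r) Finset.univ
    (φ := fun ω => g ω * ‖∑ i ∈ A, F i ω‖ ^ (2 * tri (l + 1)) *
      ‖∑ i ∈ B, F i ω‖ ^ (2 * (tri n - tri (l + 1))))
    (f := fun ω => g ω * ‖∑ i ∈ B, F i ω‖ ^ (2 * tri r) *
      ‖∑ i ∈ A, F i ω‖ ^ (2 * (tri n - tri r)))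
    (h := fun ω => g ω * ‖∑ i ∈ A, F i ω‖ ^ (2 * tri l) *
      ‖∑ i ∈ B, F i ω‖ ^ (2 * (tri n - tri l))) hr
    (fun ω _ => mul_nonneg (mul_nonneg (hg ω) (by positivity)) (by positivity))
    (fun ω _ => mul_nonneg (mul_nonneg (hg ω) (by positivity)) (by positivity))
    (fun ω _ => mul_nonneg (mul_nonneg (hg ω) (by positivity)) (by positivity))
    (fun ω _ => by
      simp only [mul_assoc (g ω), pow_mul, mul_pow (g ω)]
      rw [mul_mul_mul_comm, ← hid, pow_add])
  refine le_of_pow_le_pow_left₀ (n := 1 + r) (by omega)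
    (mul_nonneg (mul_nonneg hD (pow_nonneg (hS0 _) _)) (pow_nonneg (hS0 _) _)) (key.trans ?_)
  refine (mul_le_mul (pow_le_pow_left₀ (mixedEnergy_nonneg hg _ _ _ _) h1 1)
    (pow_le_pow_left₀ (mixedEnergy_nonneg hg _ _ _ _) h2 r)
    (pow_nonneg (mixedEnergy_nonneg hg _ _ _ _) _)
    (pow_nonneg (mul_nonneg (mul_nonneg hB₁ (pow_nonneg (hS0 _) _))
      (pow_nonneg (hS0 _) _)) _)).trans ?_
  calc _ = (B₁ * B₂ ^ r) * (S A ^ tri (l + 1) * S B ^ (tri n - tri (l + 1))) ^ (1 + r) := by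
        rw [hid]; ring
    _ ≤ D ^ (1 + r) * (S A ^ tri (l + 1) * S B ^ (tri n - tri (l + 1))) ^ (1 + r) :=
        mul_le_mul_of_nonneg_right hle (pow_nonneg (mul_nonneg (pow_nonneg (hS0 _) _)
          (pow_nonneg (hS0 _) _)) _)
    _ = _ := by rw [← mul_pow]; congr 1; ring

theorem BilinearDecoupling.of_decoupling [Fact p.Prime] {l a b c : ℕ} {D₁ D₂ D : ℝ}
    (hn : n < p) (hl : l < n) (ha : 1 ≤ a) (hac : a ≤ c) (hb : 1 ≤ b) (hbc : b ≤ c)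
    (h₁ : Decoupling p n (c - a) D₁)
    (h₂ : Decoupling p n (c - b) D₂) (hD₁ : 0 ≤ D₁) (hD : 0 ≤ D)
    (hle : D₁ ^ tri l * D₂ ^ (tri n - tri l) ≤ D ^ tri n) : BilinearDecoupling p n c l a b D := by
  intro Ω ι _ s F u g A B ξ η hs hA hB hAξ hBη hne
  have hg := hs.nonneg
  obtain ⟨c₁, rfl⟩ := Nat.exists_eq_add_of_le hac
  rw [Nat.add_sub_cancel_left] at h₁
  have h1 := h₁.energy_le hn hs ha hA hAξ
  obtain ⟨c₂, hc₂⟩ := Nat.exists_eq_add_of_le hbc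
  rw [hc₂] at hs h₂
  rw [Nat.add_sub_cancel_left] at h₂
  have h2 := h₂.energy_le hn hs hb hB hBη
  rw [← hc₂] at h2
  set S := squareSum g F u (tri n) ((p : ℤ) ^ (a + c₁)) with hS
  have hS0 : ∀ t, 0 ≤ S t := squareSum_nonneg hg _ _
  have htl := tri_strictMono hl
  set m := tri n - tri l with hm
  have hk : tri n = tri l + m := by omega
  have key := pow_sum_le_of_pow_le (P := tri l) (m := m) Finset.univ
    (φ := fun ω => g ω * ‖∑ i ∈ A, F i ω‖ ^ (2 * tri l) * ‖∑ i ∈ B, F i ω‖ ^ (2 * m))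
    (f := fun ω => g ω * ‖∑ i ∈ A, F i ω‖ ^ (2 * tri n))
    (h := fun ω => g ω * ‖∑ i ∈ B, F i ω‖ ^ (2 * tri n)) (by omega)
    (fun ω _ => mul_nonneg (mul_nonneg (hg ω) (by positivity)) (by positivity))
    (fun ω _ => mul_nonneg (hg ω) (by positivity))
    (fun ω _ => mul_nonneg (hg ω) (by positivity))
    (fun ω _ => by
      rw [← hk]
      refine le_of_eq ?_
      simp only [mul_pow, ← pow_mul]
      conv_lhs => rw [hk, pow_add]
      rw [← hk]
      ring)
  rw [← hk] at key
  refine le_of_pow_le_pow_left₀ (n := tri n) (by omega)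
    (mul_nonneg (mul_nonneg hD (pow_nonneg (hS0 _) _)) (pow_nonneg (hS0 _) _)) (key.trans ?_)
  refine (mul_le_mul (pow_le_pow_left₀ (energy_nonneg hg _ _) h1 _)
    (pow_le_pow_left₀ (energy_nonneg hg _ _) h2 _) (pow_nonneg (energy_nonneg hg _ _) _)
    (pow_nonneg (mul_nonneg hD₁ (pow_nonneg (hS0 _) _)) _)).trans ?_
  calc _ = (D₁ ^ tri l * D₂ ^ m) * (S A ^ tri l * S B ^ m) ^ tri n := by
        ring
    _ ≤ D ^ tri n * (S A ^ tri l * S B ^ m) ^ tri n :=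
        mul_le_mul_of_nonneg_right hle (pow_nonneg (mul_nonneg (pow_nonneg (hS0 _) _)
          (pow_nonneg (hS0 _) _)) _)
    _ = _ := by rw [← mul_pow]; congr 1; ring

theorem BilinearDecoupling.coarsen_right [Fact p.Prime] {l a b c : ℕ} {D : ℝ} (hl : l < n)
    (hbc : b ≤ c) (hD0 : 0 ≤ D) (hD : BilinearDecoupling p n c l a b D) :
    BilinearDecoupling p n c l a 1 (((p : ℝ) ^ b) ^ (2 * tri n) * D) := by
  intro Ω ι _ s F u g A B ξ η hs hA hB hAξ hBη hne
  have hg := hs.nonneg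
  have htl := tri_strictMono hl
  set m := tri n - tri l with hm
  have hp : 0 < p := (Fact.out : p.Prime).pos
  set S := squareSum g F u (tri n) ((p : ℤ) ^ c) with hS
  have hS0 : ∀ t, 0 ≤ S t := squareSum_nonneg hg _ _
  rw [mixedEnergy_comm, ← energy_mul_norm_pow]
  refine (energy_le_sum_energy_parts (u := u) (fun ω => mul_nonneg (hg ω) (by positivity))
    (k := m) (by omega) (pow_pos hp b) B).trans ?_
  simp only [energy_mul_norm_pow, mixedEnergy_comm m]
  push_cast
  have h1 : (1 : ℝ) ≤ (p : ℝ) ^ b := one_le_pow₀ (by exact_mod_cast hp)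
  rw [mul_assoc, mul_assoc]
  refine mul_le_mul (pow_le_pow_right₀ h1 (by omega)) ?_
    (Finset.sum_nonneg fun _ _ => mixedEnergy_nonneg hg _ _ _ _) (by positivity)
  calc _ ≤ ∑ B' ∈ parts ((p : ℤ) ^ b) u B, D * S A ^ tri l * S B' ^ m := by
        refine Finset.sum_le_sum fun B' hB' => ?_
        obtain ⟨i, hi⟩ := nonempty_of_mem_parts hB'
        have hB'B := subset_of_mem_parts hB'
        refine hD Ω ι s F u g A B' ξ (u i) hs hA (hB'B.trans hB) hAξ
          (fun j hj => dvd_of_mem_parts hB' hi hj) fun hd => hne ?_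
        have h4 : (p : ℤ) ∣ u i - η := by simpa using hBη i (hB'B hi)
        simpa using dvd_add hd h4
    _ ≤ _ := by
        rw [← Finset.mul_sum, mul_assoc]
        refine mul_le_mul_of_nonneg_left (mul_le_mul_of_nonneg_left ?_ (pow_nonneg (hS0 _) _)) hD0
        refine (sum_pow_le_pow_sum_of_nonneg _ (fun _ _ => hS0 _) (by omega)).trans ?_
        rw [hS, sum_squareSum_parts (pow_dvd_pow _ hbc)]

end energy

theorem pow_sum_le_broad_narrow {β : Type*} [DecidableEq β] (Z : Finset β) {x : β → ℝ}
    (hx : ∀ z ∈ Z, 0 ≤ x z)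
    {q : ℝ} (hq : (Z.card : ℝ) ≤ q) {P Q : ℕ} (hP : 1 ≤ P) :
    (∑ z ∈ Z, x z) ^ (P + Q) ≤ 2 ^ (P + Q) * ∑ z ∈ Z, x z ^ (P + Q) +
      q ^ (2 * (P + Q)) * ∑ z ∈ Z, ∑ z' ∈ Z.erase z, x z ^ P * x z' ^ Q := by
  have hpos : 0 ≤ ∑ z ∈ Z, ∑ z' ∈ Z.erase z, x z ^ P * x z' ^ Q :=
    Finset.sum_nonneg fun z hz => Finset.sum_nonneg fun z' hz' =>
      mul_nonneg (pow_nonneg (hx z hz) _) (pow_nonneg (hx z' (Finset.mem_of_mem_erase hz')) _)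
  have hpos' : 0 ≤ ∑ z ∈ Z, x z ^ (P + Q) := Finset.sum_nonneg fun z hz => pow_nonneg (hx z hz) _
  rcases Z.eq_empty_or_nonempty with rfl | hZ
  · simp [show P ≠ 0 by omega]
  have hq1 : 1 ≤ q := le_trans (by exact_mod_cast hZ.card_pos) hq
  obtain ⟨z, hz, hmax⟩ := Finset.exists_max_image Z x hZ
  have hx0 := hx z hz
  have hsum0 : 0 ≤ ∑ z ∈ Z, x z := Finset.sum_nonneg hx
  rcases le_or_gt (∑ z ∈ Z, x z) (2 * x z) with h | h
  · refine le_add_of_le_of_nonneg ?_ (by positivity)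
    refine (pow_le_pow_left₀ hsum0 h _).trans ?_
    rw [mul_pow]
    exact mul_le_mul_of_nonneg_left
      (Finset.single_le_sum (f := fun z => x z ^ (P + Q)) (fun i hi => pow_nonneg (hx i hi) _) hz)
      (by positivity)
  · refine le_add_of_nonneg_of_le (by positivity) ?_
    obtain ⟨z', hz', hlt⟩ : ∃ z' ∈ Z.erase z, x z ≤ q * x z' := by
      by_contra! hcon
      have h1 : ∑ z' ∈ Z.erase z, q * x z' ≤ (Z.erase z).card • x z :=
        Finset.sum_le_card_nsmul _ _ _ fun i hi => (hcon i hi).le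
      have h2 : ((Z.erase z).card : ℝ) ≤ q :=
        le_trans (by exact_mod_cast Finset.card_erase_le) hq
      rw [← Finset.mul_sum, nsmul_eq_mul] at h1
      have h3 : q * ∑ z' ∈ Z.erase z, x z' ≤ q * x z :=
        h1.trans (mul_le_mul_of_nonneg_right h2 hx0)
      have h4 := le_of_mul_le_mul_left h3 (by linarith)
      have := Finset.add_sum_erase Z x hz
      linarith
    have hx' := hx z' (Finset.mem_of_mem_erase hz')
    have h5 : ∑ z ∈ Z, x z ≤ q * x z := by
      refine (Finset.sum_le_card_nsmul _ _ _ hmax).trans ?_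
      rw [nsmul_eq_mul]
      exact mul_le_mul_of_nonneg_right hq hx0
    calc (∑ z ∈ Z, x z) ^ (P + Q) ≤ (q * x z) ^ (P + Q) := pow_le_pow_left₀ hsum0 h5 _
      _ = q ^ (P + Q) * (x z ^ P * x z ^ Q) := by rw [mul_pow, pow_add (x z)]
      _ ≤ q ^ (P + Q) * (x z ^ P * (q * x z') ^ Q) := by gcongr
      _ = q ^ (P + Q) * q ^ Q * (x z ^ P * x z' ^ Q) := by rw [mul_pow]; ring
      _ ≤ q ^ (2 * (P + Q)) * (x z ^ P * x z' ^ Q) := by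
          refine mul_le_mul_of_nonneg_right ?_ (by positivity)
          rw [← pow_add]
          exact pow_le_pow_right₀ hq1 (by omega)
      _ ≤ _ := by
          refine mul_le_mul_of_nonneg_left ?_ (by positivity)
          refine (Finset.single_le_sum (f := fun z' => x z ^ P * x z' ^ Q) (fun i hi =>
            mul_nonneg (pow_nonneg hx0 _) (pow_nonneg (hx i (Finset.mem_of_mem_erase hi)) _))
            hz').trans ?_
          exact Finset.single_le_sum (f := fun z => ∑ z' ∈ Z.erase z, x z ^ P * x z' ^ Q)
            (fun z hz => Finset.sum_nonneg fun i hi => mul_nonneg (pow_nonneg (hx z hz) _)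
              (pow_nonneg (hx i (Finset.mem_of_mem_erase hi)) _)) hz

section energy

variable {Ω ι : Type} [Fintype Ω] {s : Finset ι} {F : ι → Ω → ℂ} {u : ι → ℤ} {g : Ω → ℝ}
  {p n : ℕ}

theorem energy_le_broad_narrow (hg : ∀ ω, 0 ≤ g ω) {q : ℕ} (hq : 0 < q) {P Q : ℕ} (hP : 1 ≤ P) :
    energy g F (P + Q) s ≤
      2 ^ (2 * (P + Q)) * ∑ A ∈ parts (q : ℤ) u s, energy g F (P + Q) A +
      (q : ℝ) ^ (4 * (P + Q)) * ∑ A ∈ parts (q : ℤ) u s, ∑ B ∈ (parts (q : ℤ) u s).erase A,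
        mixedEnergy g F P Q A B := by
  simp only [energy, mixedEnergy]
  simp_rw [Finset.sum_comm (t := (Finset.univ : Finset Ω))]
  rw [Finset.mul_sum, Finset.mul_sum, ← Finset.sum_add_distrib]
  refine Finset.sum_le_sum fun ω _ => ?_
  have h := pow_sum_le_broad_narrow (parts (q : ℤ) u s) (x := fun A => ‖∑ i ∈ A, F i ω‖)
    (fun _ _ => norm_nonneg _) (Nat.cast_le.2 (card_parts_le hq)) (P := 2 * P) (Q := 2 * Q)
    (by omega)
  have h' : ‖∑ i ∈ s, F i ω‖ ≤ ∑ A ∈ parts (q : ℤ) u s, ‖∑ i ∈ A, F i ω‖ := by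
    rw [← sum_parts (m := (q : ℤ)) (u := u)]
    exact norm_sum_le _ _
  rw [← mul_add, show 2 * (2 * (P + Q)) = 4 * (P + Q) by ring] at h
  have h2 := mul_le_mul_of_nonneg_left ((pow_le_pow_left₀ (norm_nonneg _) h' _).trans h) (hg ω)
  refine h2.trans (le_of_eq ?_)
  simp only [Finset.mul_sum, mul_add]
  congr 1
  · exact Finset.sum_congr rfl fun A _ => by ring
  · exact Finset.sum_congr rfl fun A _ => Finset.sum_congr rfl fun B _ => by ring

theorem Decoupling.succ [Fact p.Prime] {c l : ℕ} {D E : ℝ} (hn : n < p) (hl : 1 ≤ l) (hln : l < n)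
    (hD : Decoupling p n c D) (hE : BilinearDecoupling p n (1 + c) l 1 1 E) (hD0 : 0 ≤ D)
    (hE0 : 0 ≤ E) :
    Decoupling p n (1 + c) (2 ^ (2 * tri n) * D + (p : ℝ) ^ (4 * tri n + 2) * E) := by
  intro Ω ι _ s F u g hs
  have hg := hs.nonneg
  have hp : 0 < p := (Fact.out : p.Prime).pos
  have htl := tri_strictMono hln
  have htl1 := tri_pos hl
  have hk : tri l + (tri n - tri l) = tri n := by omega
  set S := squareSum g F u (tri n) ((p : ℤ) ^ (1 + c)) with hS
  have hS0 : ∀ t, 0 ≤ S t := squareSum_nonneg hg _ _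
  have hpart : ∑ A ∈ parts (p : ℤ) u s, S A = S s :=
    sum_squareSum_parts (dvd_pow_self _ (by omega)) _ _
  have hle : ∀ A ∈ parts (p : ℤ) u s, S A ≤ S s := fun A hA => by
    rw [← hpart]
    exact Finset.single_le_sum (f := S) (fun _ _ => hS0 _) hA
  have h := energy_le_broad_narrow (F := F) (s := s) (u := u) hg hp (P := tri l)
    (Q := tri n - tri l) (by omega)
  rw [hk] at h
  refine h.trans ?_
  rw [add_mul, mul_assoc, mul_assoc]
  refine add_le_add (mul_le_mul_of_nonneg_left ?_ (by positivity)) ?_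
  · calc ∑ A ∈ parts (p : ℤ) u s, energy g F (tri n) A
        ≤ ∑ A ∈ parts (p : ℤ) u s, D * S A ^ tri n := by
          refine Finset.sum_le_sum fun A hA => ?_
          obtain ⟨i, hi⟩ := nonempty_of_mem_parts hA
          exact hD.energy_le hn hs le_rfl (subset_of_mem_parts hA) (ξ := u i)
            (fun j hj => by simpa using dvd_of_mem_parts hA hi hj)
      _ ≤ D * S s ^ tri n := by
          rw [← Finset.mul_sum, ← hpart]
          exact mul_le_mul_of_nonneg_left
            (sum_pow_le_pow_sum_of_nonneg _ (fun _ _ => hS0 _) (by omega)) hD0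
  · rw [pow_add, mul_assoc]
    refine mul_le_mul_of_nonneg_left ?_ (by positivity)
    have hcard : ((parts (p : ℤ) u s).card : ℝ) ≤ p := by exact_mod_cast card_parts_le hp
    have hES : 0 ≤ E * S s ^ tri n := mul_nonneg hE0 (pow_nonneg (hS0 _) _)
    have h1 : ∀ A ∈ parts (p : ℤ) u s, ∑ B ∈ (parts (p : ℤ) u s).erase A,
        mixedEnergy g F (tri l) (tri n - tri l) A B ≤ p * (E * S s ^ tri n) := by
      intro A hA
      refine (Finset.sum_le_card_nsmul _ _ (E * S s ^ tri n) fun B hB => ?_).trans ?_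
      · obtain ⟨hne, hB⟩ := Finset.mem_erase.1 hB
        obtain ⟨i, hi⟩ := nonempty_of_mem_parts hA
        obtain ⟨j, hj⟩ := nonempty_of_mem_parts hB
        refine (hE Ω ι s F u g A B (u i) (u j) hs (subset_of_mem_parts hA)
          (subset_of_mem_parts hB) (fun k hk => by simpa using dvd_of_mem_parts hA hi hk)
          (fun k hk => by simpa using dvd_of_mem_parts hB hj hk)
          fun hd => hne (eq_of_mem_parts hB hA hj hi hd)).trans ?_
        rw [← hS, mul_assoc]
        refine mul_le_mul_of_nonneg_left ?_ hE0
        calc S A ^ tri l * S B ^ (tri n - tri l) ≤ S s ^ tri l * S s ^ (tri n - tri l) :=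
              mul_le_mul (pow_le_pow_left₀ (hS0 _) (hle A hA) _)
                (pow_le_pow_left₀ (hS0 _) (hle B hB) _) (pow_nonneg (hS0 _) _)
                (pow_nonneg (hS0 _) _)
          _ = S s ^ tri n := by rw [← pow_add, hk]
      · rw [nsmul_eq_mul]
        refine mul_le_mul_of_nonneg_right (le_trans ?_ hcard) hES
        exact_mod_cast Finset.card_erase_le
    refine (Finset.sum_le_card_nsmul _ _ _ h1).trans ?_
    rw [nsmul_eq_mul, sq, mul_assoc]
    exact mul_le_mul_of_nonneg_right hcard (by positivity)

end energy

section gainRate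

/-- The gain in the bilinear decoupling exponents after `t` rounds of refinement. -/
noncomputable def gainRate (n : ℕ) : ℕ → ℕ → ℝ
  | 0, l => if l = 0 then 1 else 0
  | _ + 1, 0 => 1
  | t + 1, l + 1 => gainRate n t (n - (l + 1)) / (l + 1) +
      ((n - (l + 1) : ℕ) : ℝ) / ((n - (l + 1) : ℕ) + 1) * gainRate n t l

theorem gainRate_zero_right (n t : ℕ) : gainRate n t 0 = 1 := by
  cases t <;> simp [gainRate]

theorem sum_gainRate_succ (N t : ℕ) : ∑ l ∈ Finset.range N, gainRate (N + 1) (t + 1) (l + 1) =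
    ∑ l ∈ Finset.range N, gainRate (N + 1) t (l + 1) + N / (N + 1) := by
  set κ := gainRate (N + 1) t with hκ
  simp only [gainRate, ← hκ]
  rw [Finset.sum_add_distrib]
  have h1 : ∑ l ∈ Finset.range N, κ (N + 1 - (l + 1)) / ((l : ℝ) + 1) =
      ∑ j ∈ Finset.range N, κ (j + 1) / ((N : ℝ) - j) := by
    rw [← Finset.sum_range_reflect]
    refine Finset.sum_congr rfl fun j hj => ?_
    rw [Finset.mem_range] at hj
    have h3 : ((N - 1 - j : ℕ) : ℝ) + 1 = N - j := by
      rw [show N - 1 - j = N - (j + 1) by omega, Nat.cast_sub (by omega)]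
      push_cast; ring
    rw [h3, show N + 1 - (N - 1 - j + 1) = j + 1 by omega]
  have h2 : ∑ l ∈ Finset.range N, ((N + 1 - (l + 1) : ℕ) : ℝ) / ((N + 1 - (l + 1) : ℕ) + 1) * κ l =
      ∑ j ∈ Finset.range N, ((N : ℝ) - j - 1) / (N - j) * κ (j + 1) + N / (N + 1) := by
    have h3 : ∀ l ∈ Finset.range N,
        ((N + 1 - (l + 1) : ℕ) : ℝ) / ((N + 1 - (l + 1) : ℕ) + 1) * κ l =
          ((N : ℝ) - l) / (N - l + 1) * κ l := fun l hl => by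
      rw [Finset.mem_range] at hl
      rw [show N + 1 - (l + 1) = N - l by omega, Nat.cast_sub hl.le]
    rw [Finset.sum_congr rfl h3]
    have h4 := Finset.sum_range_succ' (fun l : ℕ => ((N : ℝ) - l) / (N - l + 1) * κ l) N
    rw [Finset.sum_range_succ, sub_self, zero_div, zero_mul, add_zero] at h4
    rw [h4, hκ, gainRate_zero_right]
    congr 1
    · refine Finset.sum_congr rfl fun j _ => ?_
      push_cast
      congr 2 <;> ring
    · simp
  rw [h1, h2, ← add_assoc, ← Finset.sum_add_distrib]
  congr 1
  refine Finset.sum_congr rfl fun j hj => ?_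
  have : (j : ℝ) < N := by exact_mod_cast Finset.mem_range.1 hj
  have : (N : ℝ) - j ≠ 0 := by linarith
  field_simp
  ring

theorem sum_gainRate (N t : ℕ) :
    ∑ l ∈ Finset.range N, gainRate (N + 1) t (l + 1) = t * (N / (N + 1)) := by
  induction t with
  | zero => simp [gainRate]
  | succ t ih => rw [sum_gainRate_succ, ih]; push_cast; ring

theorem exists_le_gainRate {n : ℕ} (hn : 2 ≤ n) (K : ℝ) :
    ∃ t l, 1 ≤ t ∧ 1 ≤ l ∧ l < n ∧ K ≤ gainRate n t l := by
  obtain ⟨N, rfl⟩ := Nat.exists_eq_add_of_le' (show 1 ≤ n by omega)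
  have hN : 1 ≤ N := by omega
  obtain ⟨t, ht⟩ := exists_nat_ge (K * (N + 1))
  refine ⟨t + 1, ?_⟩
  by_contra! h
  have h1 : ∑ l ∈ Finset.range N, gainRate (N + 1) (t + 1) (l + 1) ≤
      (Finset.range N).card • K :=
    Finset.sum_le_card_nsmul _ _ _ fun l hl =>
      (h (l + 1) (by omega) (by omega) (by have := Finset.mem_range.1 hl; omega)).le
  have hN' : (0 : ℝ) < N := by exact_mod_cast hN
  rw [sum_gainRate, Finset.card_range, nsmul_eq_mul] at h1
  have h2 : ((t : ℝ) + 1) * (N / (N + 1)) = N * ((t + 1) / (N + 1)) := by ring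
  push_cast at h1
  rw [h2] at h1
  have h3 := le_of_mul_le_mul_left h1 hN'
  rw [div_le_iff₀ (by positivity)] at h3
  linarith

end gainRate

section iterate

variable {p n : ℕ}

theorem Decoupling.mono {c : ℕ} {D D' : ℝ} (h : Decoupling p n c D) (hD : D ≤ D') :
    Decoupling p n c D' := fun Ω ι _ s F u g hs =>
  (h Ω ι s F u g hs).trans (mul_le_mul_of_nonneg_right hD
    (pow_nonneg (squareSum_nonneg hs.nonneg _ _ _) _))

theorem BilinearDecoupling.mono {c l a b : ℕ} {D D' : ℝ} (h : BilinearDecoupling p n c l a b D)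
    (hD : D ≤ D') : BilinearDecoupling p n c l a b D' :=
  fun Ω ι _ s F u g A B ξ η hs hA hB hAξ hBη hne =>
  (h Ω ι s F u g A B ξ η hs hA hB hAξ hBη hne).trans (mul_le_mul_of_nonneg_right
    (mul_le_mul_of_nonneg_right hD (pow_nonneg (squareSum_nonneg hs.nonneg _ _ _) _))
    (pow_nonneg (squareSum_nonneg hs.nonneg _ _ _) _))

theorem bilinearDecoupling_iterate [Fact p.Prime] (hn : n < p) {η ε C₀ C₁ : ℝ} (hη : 0 ≤ η)
    (hε : 0 ≤ ε) (hC₀ : 0 ≤ C₀) (hC₁ : 0 ≤ C₁)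
    (h : ∀ c : ℕ, Decoupling p n c (C₀ * (p : ℝ) ^ (η * c)))
    (hlow : ∀ l, 1 ≤ l → l < n → ∀ c : ℕ, Decoupling p l c (C₁ * (p : ℝ) ^ (ε * c))) (t : ℕ) :
    ∃ C : ℝ, 0 ≤ C ∧ ∀ l r a b c : ℕ, 1 ≤ r → r + l = n → 1 ≤ a → a ≤ c → 1 ≤ b →
      n.factorial ^ t ∣ b → n ^ t * b ≤ c → l * a ≤ (r + 1) * b →
      BilinearDecoupling p n c l a b
        (C * (p : ℝ) ^ (η * c - η * (gainRate n t l * b) + t * (ε * c))) := by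
  have hp1 : (1 : ℝ) < p := by exact_mod_cast (Fact.out : p.Prime).one_lt
  have hp0 : (0 : ℝ) < p := by linarith
  induction t with
  | zero =>
    refine ⟨C₀, hC₀, fun l r a b c hr hrl ha hac hb _ hbc _ => ?_⟩
    rw [pow_zero, one_mul] at hbc
    rcases Nat.eq_zero_or_pos l with rfl | hl
    · refine BilinearDecoupling.of_decoupling hn (by omega) ha hac hb hbc (h _) (h _)
        (by positivity) (by positivity) ?_
      rw [show tri 0 = 0 from rfl, pow_zero, one_mul, Nat.sub_zero, Nat.cast_sub hbc]
      refine le_of_eq ?_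
      simp only [gainRate]
      congr 3
      simp
      ring
    · have hle : ∀ d ≤ c, C₀ * (p : ℝ) ^ (η * (c - d : ℕ)) ≤ C₀ * (p : ℝ) ^ (η * c) := by
        intro d hd
        refine mul_le_mul_of_nonneg_left (Real.rpow_le_rpow_of_exponent_le hp1.le ?_) hC₀
        exact mul_le_mul_of_nonneg_left (by exact_mod_cast Nat.sub_le _ _) hη
      have h1 : η * c - η * (gainRate n 0 l * b) + ((0 : ℕ) : ℝ) * (ε * c) = η * c := by
        simp [gainRate, hl.ne']
      rw [h1]
      refine BilinearDecoupling.of_decoupling hn (by omega) ha hac hb hbc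
        ((h _).mono (hle a hac)) ((h _).mono (hle b hbc)) (by positivity) (by positivity) ?_
      have := tri_strictMono (show l < n by omega)
      rw [← pow_add, show tri l + (tri n - tri l) = tri n by omega]
  | succ t ih =>
    obtain ⟨C, hC, ih⟩ := ih
    refine ⟨(1 + C₁) * C, by positivity, fun l r a b c hr hrl ha hac hb hdvd hbc hab => ?_⟩
    have hn0 : 0 < n := by omega
    have hbc' : n ^ t * b ≤ c := le_trans (Nat.mul_le_mul_right _
      (Nat.pow_le_pow_right hn0 (Nat.le_succ t))) hbc
    cases l with
    | zero =>
      have h1 := ih 0 r a b c hr hrl ha hac hb ((pow_dvd_pow _ (Nat.le_succ t)).trans hdvd) hbc'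
        (by simp)
      refine h1.mono ?_
      rw [gainRate_zero_right, gainRate_zero_right]
      refine mul_le_mul (le_mul_of_one_le_left hC (by linarith))
        (Real.rpow_le_rpow_of_exponent_le hp1.le ?_) (by positivity) (by positivity)
      have : 0 ≤ ε * c := by positivity
      push_cast
      linarith
    | succ l =>
      obtain ⟨w, hw⟩ : (l + 1) * n.factorial ^ t ∣ b := by
        refine dvd_trans ?_ hdvd
        rw [pow_succ, mul_comm]
        exact Nat.mul_dvd_mul_left _ (Nat.dvd_factorial (by omega) (by omega))
      set b₁ := n.factorial ^ t * w with hb₁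
      have hbb : b = (l + 1) * b₁ := by rw [hw, hb₁, mul_assoc]
      have hb₁0 : 1 ≤ b₁ := by
        rcases Nat.eq_zero_or_pos b₁ with h0 | h0
        · rw [h0, mul_zero] at hbb; omega
        · exact h0
      have haa : a ≤ (r + 1) * b₁ := by
        refine Nat.le_of_mul_le_mul_left (c := l + 1) (hab.trans (le_of_eq ?_)) (by omega)
        rw [hbb]; ring
      have ha'b : (r + 1) * b₁ ≤ n * b := Nat.mul_le_mul (by omega) (by rw [hbb]; nlinarith)
      have hbc'' : n ^ t * ((r + 1) * b₁) ≤ c := by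
        refine le_trans (Nat.mul_le_mul_left _ ha'b) ?_
        rw [← mul_assoc, ← pow_succ]
        exact hbc
      have hnt : 1 ≤ n ^ t := Nat.one_le_pow _ _ hn0
      have ha'c : (r + 1) * b₁ ≤ c := le_trans (Nat.le_mul_of_pos_left _ hnt) hbc''
      have hb_c : b ≤ c := le_trans (Nat.le_mul_of_pos_left _ hnt) hbc'
      obtain ⟨c', hc'⟩ := Nat.exists_eq_add_of_le haa
      have h1 := ih r (l + 1) b ((r + 1) * b₁) c (by omega) (by omega) hb hb_c
        (Nat.mul_pos (by omega) hb₁0) ((Dvd.intro _ rfl).mul_left _) hbc''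
        (by rw [hbb]; nlinarith)
      have h2 := ih l (r + 1) ((r + 1) * b₁) b c (by omega) (by omega)
        (Nat.mul_pos (by omega) hb₁0) ha'c hb ((pow_dvd_pow _ (Nat.le_succ t)).trans hdvd) hbc'
        (by rw [hbb]; nlinarith)
      have h3 := BilinearDecoupling.interpolate (D := C * (p : ℝ) ^ (η * c -
        η * (gainRate n (t + 1) (l + 1) * b) + t * (ε * c))) hr hrl h1 h2 (by positivity)
        (by positivity) (by
          refine le_of_eq ?_
          rw [mul_pow, mul_pow, ← Real.rpow_mul_natCast hp0.le, ← Real.rpow_mul_natCast hp0.le,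
            mul_mul_mul_comm, ← Real.rpow_add hp0, pow_add, pow_one]
          congr 2
          rw [gainRate, show n - (l + 1) = r by omega, hbb]
          push_cast
          field_simp
          ring)
      rw [hc'] at h3 ha'c
      have h4 := BilinearDecoupling.refine_left hn hrl (by omega) (hlow (l + 1) (by omega)
        (by omega) c') (by positivity) (by positivity) h3 ha ha'c (by
          rw [← hc', hbb]; exact le_of_eq (by ring))
      refine h4.mono ?_
      rw [mul_mul_mul_comm, ← Real.rpow_add hp0]
      refine mul_le_mul (mul_le_mul_of_nonneg_right (by linarith) hC)
        (Real.rpow_le_rpow_of_exponent_le hp1.le ?_) (by positivity) (by positivity)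
      have h5 : ε * c' ≤ ε * c := mul_le_mul_of_nonneg_left (by exact_mod_cast by omega) hε
      push_cast
      linarith

theorem Decoupling.improve [Fact p.Prime] (hn : n < p) {η ε ε' σ C₀ C₁ : ℝ} {t l : ℕ}
    (hl : 1 ≤ l) (hln : l < n) (hε : 0 < ε) (hεη : ε ≤ η)
    (hgain : (2 * tri n + 1) / ε ≤ gainRate n t l) (hε' : 0 ≤ ε')
    (htε : t * ε' * (2 * n ^ t) ≤ 1) (hpε : 2 ^ (2 * tri n + 1) ≤ (p : ℝ) ^ ε)
    (hC₀ : 0 ≤ C₀) (hC₁ : 0 ≤ C₁) (h : ∀ c : ℕ, Decoupling p n c (C₀ * (p : ℝ) ^ (η * c)))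
    (hlow : ∀ l, 1 ≤ l → l < n → ∀ c : ℕ, Decoupling p l c (C₁ * (p : ℝ) ^ (ε' * c)))
    (hεσ : ε ≤ σ) (hσ : η - 1 / (2 * n ^ t) ≤ σ) :
    ∃ C : ℝ, 0 ≤ C ∧ ∀ c : ℕ, Decoupling p n c (C * (p : ℝ) ^ (σ * c)) := by
  obtain ⟨C, hC, hbil⟩ := bilinearDecoupling_iterate hn (hε.le.trans hεη) hε' hC₀ hC₁ h hlow t
  have hp1 : (1 : ℝ) < p := by exact_mod_cast (Fact.out : p.Prime).one_lt
  have hp0 : (0 : ℝ) < p := by linarith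
  set L := n.factorial ^ t with hL
  set W := n ^ t with hW
  have hL0 : 0 < L := pow_pos (Nat.factorial_pos n) t
  have hn0 : 0 < n := by omega
  have hW0 : 0 < W := pow_pos hn0 t
  have hWr : (0 : ℝ) < (n : ℝ) ^ t := by positivity
  have hWc : (W : ℝ) = (n : ℝ) ^ t := by rw [hW]; push_cast; rfl
  have key : ∀ c : ℕ, n * (L * W) ≤ c →
      BilinearDecoupling p n c l 1 1 (C * (p : ℝ) ^ (n * L : ℕ) * (p : ℝ) ^ (σ * c)) := by
    intro c hc
    set d := c / (n * L * W) with hd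
    have hnLW : 0 < n * L * W := by positivity
    have hd1 : 1 ≤ d := (Nat.one_le_div_iff hnLW).2 (by rwa [mul_assoc])
    have hdc : n * L * W * d ≤ c := Nat.mul_div_le _ _
    have hdc' : c < n * L * W * (d + 1) := Nat.lt_mul_div_succ _ hnLW
    set b := n * L * d with hb
    have hb1 : n ≤ b := by
      rw [hb, mul_assoc]
      exact Nat.le_mul_of_pos_right _ (Nat.mul_pos hL0 hd1)
    have hWb : W * b ≤ c := le_trans (le_of_eq (by rw [hb]; ring)) hdc
    have hWb' : c ≤ W * b + W * (n * L) := hdc'.le.trans (le_of_eq (by rw [hb]; ring))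
    have hbc : b ≤ c := le_trans (Nat.le_mul_of_pos_left _ hW0) hWb
    have h1 := (hbil l (n - l) 1 b c (by omega) (by omega) le_rfl (by omega) (by omega)
      (by rw [hb]; exact Dvd.intro_left (n * d) (by ring)) hWb
      (by rw [mul_one]; nlinarith [Nat.zero_le ((n - l) * b)])).coarsen_right
        hln hbc (by positivity)
    refine h1.mono ?_
    rw [mul_left_comm, mul_assoc C]
    refine mul_le_mul_of_nonneg_left ?_ hC
    rw [← pow_mul, ← Real.rpow_natCast, ← Real.rpow_natCast, ← Real.rpow_add hp0,
      ← Real.rpow_add hp0]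
    refine Real.rpow_le_rpow_of_exponent_le hp1.le ?_
    have hbr : (0 : ℝ) ≤ b := by positivity
    have hcr : (0 : ℝ) ≤ c := by positivity
    have e1 : (c : ℝ) ≤ n ^ t * b + n ^ t * (n * L) := by rw [← hWc]; exact_mod_cast hWb'
    have e2 : (2 * tri n + 1) * (b : ℝ) ≤ η * (gainRate n t l * b) := by
      rw [← mul_assoc]
      refine mul_le_mul_of_nonneg_right ?_ hbr
      rw [div_le_iff₀ hε] at hgain
      have : 0 ≤ gainRate n t l := by
        by_contra hneg
        have : gainRate n t l * ε < 0 := mul_neg_of_neg_of_pos (by linarith) hε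
        have : (0 : ℝ) ≤ 2 * tri n + 1 := by positivity
        linarith
      nlinarith
    have e3 : t * (ε' * c) ≤ 1 / (2 * n ^ t) * c := by
      rw [← mul_assoc]
      refine mul_le_mul_of_nonneg_right ?_ hcr
      rw [le_div_iff₀ (by positivity)]
      exact htε
    have e4 : (η - 1 / (2 * n ^ t)) * c ≤ σ * c := mul_le_mul_of_nonneg_right hσ hcr
    have e5 : (c : ℝ) * (1 / n ^ t) ≤ b + n * L := by
      rw [mul_one_div, div_le_iff₀ hWr]; linarith
    have e6 : (1 : ℝ) / (2 * n ^ t) * c = c * (1 / n ^ t) / 2 := by ring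
    push_cast
    linarith
  set c₀ := n * (L * W) with hc₀
  set E := C * (p : ℝ) ^ (n * L : ℕ) with hE
  have hE0 : 0 ≤ E := by positivity
  refine ⟨((p : ℝ) ^ c₀) ^ (2 * tri n) + 2 * ((p : ℝ) ^ (4 * tri n + 2) * E), by positivity,
    fun c => ?_⟩
  set D := ((p : ℝ) ^ c₀) ^ (2 * tri n) + 2 * ((p : ℝ) ^ (4 * tri n + 2) * E) with hD
  have hσ0 : 0 ≤ σ := by linarith
  have hD0 : 0 ≤ D := by positivity
  have hsmall : ∀ c ≤ c₀, Decoupling p n c (D * (p : ℝ) ^ (σ * c)) := fun c hc =>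
    (decoupling_trivial (by omega) c).mono (by
      refine le_trans ?_ (le_mul_of_one_le_right hD0
        (Real.one_le_rpow hp1.le (by positivity)))
      refine le_add_of_le_of_nonneg ?_ (by positivity)
      exact pow_le_pow_left₀ (by positivity) (pow_le_pow_right₀ hp1.le hc) _)
  induction c with
  | zero => exact hsmall 0 (Nat.zero_le _)
  | succ c ih =>
    rcases le_or_gt (c + 1) c₀ with hc | hc
    · exact hsmall _ hc
    · have h1 := Decoupling.succ hn hl hln ih (E := E * (p : ℝ) ^ (σ * (1 + c : ℕ)))
        (key _ (by omega)) (by positivity) (by positivity)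
      rw [add_comm 1 c] at h1
      refine h1.mono ?_
      have h2 : (p : ℝ) ^ (σ * (c + 1 : ℕ)) = (p : ℝ) ^ (σ * c) * (p : ℝ) ^ σ := by
        rw [← Real.rpow_add hp0]; push_cast; ring_nf
      have h3 : (2 : ℝ) ^ (2 * tri n) * 2 ≤ (p : ℝ) ^ σ := by
        rw [← pow_succ]
        exact hpε.trans (Real.rpow_le_rpow_of_exponent_le hp1.le hεσ)
      have h4 : (0 : ℝ) < (p : ℝ) ^ (σ * c) := by positivity
      have h5 : (2 : ℝ) ^ (2 * tri n) * (D * (p : ℝ) ^ (σ * c)) ≤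
          D / 2 * (p : ℝ) ^ (σ * (c + 1 : ℕ)) := by
        rw [h2]
        nlinarith [mul_le_mul_of_nonneg_left h3 (mul_nonneg hD0 h4.le)]
      have h6 : (p : ℝ) ^ (4 * tri n + 2) * (E * (p : ℝ) ^ (σ * (c + 1 : ℕ))) ≤
          D / 2 * (p : ℝ) ^ (σ * (c + 1 : ℕ)) := by
        rw [← mul_assoc]
        refine mul_le_mul_of_nonneg_right ?_ (by positivity)
        have : (0 : ℝ) ≤ ((p : ℝ) ^ c₀) ^ (2 * tri n) := by positivity
        linarith
      linarith

/-- Decoupling with an arbitrarily small power loss, for sufficiently large primes. -/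
theorem exists_decoupling (n : ℕ) (hn : 1 ≤ n) {ε : ℝ} (hε : 0 < ε) :
    ∃ p₀ : ℕ, ∀ p : ℕ, p.Prime → p₀ ≤ p →
      ∃ C : ℝ, 0 ≤ C ∧ ∀ c : ℕ, Decoupling p n c (C * (p : ℝ) ^ (ε * c)) := by
  induction n using Nat.strong_induction_on generalizing ε with
  | _ n ih =>
  rcases hn.eq_or_lt with rfl | hn2
  · refine ⟨0, fun p hp _ => ⟨1, zero_le_one, fun c => ?_⟩⟩
    have : Fact p.Prime := ⟨hp⟩
    refine (decoupling_one c).mono ?_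
    rw [one_mul]
    exact Real.one_le_rpow (by exact_mod_cast hp.one_lt.le) (by positivity)
  obtain ⟨t, l, ht, hl, hln, hgain⟩ := exists_le_gainRate hn2 ((2 * tri n + 1) / ε)
  set τ : ℝ := 1 / (2 * n ^ t) with hτ
  have hτ0 : 0 < τ := by
    have : (0 : ℝ) < n := by exact_mod_cast (by omega : 0 < n)
    positivity
  have ht0 : (0 : ℝ) < t := by exact_mod_cast ht
  have hε' : 0 < τ / t := by positivity
  have ih' : ∀ j, ∃ p₀ : ℕ, ∀ p : ℕ, p.Prime → p₀ ≤ p → 1 ≤ j → j < n →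
      ∃ C : ℝ, 0 ≤ C ∧ ∀ c : ℕ, Decoupling p j c (C * (p : ℝ) ^ (τ / t * c)) := by
    intro j
    by_cases hj : 1 ≤ j ∧ j < n
    · obtain ⟨p₀, hp₀⟩ := ih j hj.2 hj.1 hε'
      exact ⟨p₀, fun p hp hpp _ _ => hp₀ p hp hpp⟩
    · exact ⟨0, fun p _ _ h1 h2 => absurd ⟨h1, h2⟩ hj⟩
  choose P hP using ih'
  obtain ⟨p₁, hp₁⟩ := exists_nat_ge (((2 : ℝ) ^ (2 * tri n + 1)) ^ (1 / ε))
  refine ⟨n + 1 + p₁ + ∑ j ∈ Finset.range n, P j, fun p hp hpp => ?_⟩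
  have : Fact p.Prime := ⟨hp⟩
  have hp1 : (1 : ℝ) ≤ p := by exact_mod_cast hp.one_lt.le
  have hpε : (2 : ℝ) ^ (2 * tri n + 1) ≤ (p : ℝ) ^ ε := by
    have h1 : ((2 : ℝ) ^ (2 * tri n + 1)) ^ (1 / ε) ≤ p :=
      hp₁.trans (by exact_mod_cast by omega)
    have h2 := Real.rpow_le_rpow (by positivity) h1 hε.le
    rwa [← Real.rpow_mul (by positivity), one_div_mul_cancel hε.ne', Real.rpow_one] at h2
  have hex : ∀ j, ∃ C : ℝ, 0 ≤ C ∧ (1 ≤ j → j < n →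
      ∀ c : ℕ, Decoupling p j c (C * (p : ℝ) ^ (τ / t * c))) := by
    intro j
    by_cases hj : 1 ≤ j ∧ j < n
    · have h1 : P j ≤ ∑ j ∈ Finset.range n, P j :=
        Finset.single_le_sum (fun _ _ => Nat.zero_le _) (Finset.mem_range.2 hj.2)
      obtain ⟨C, hC, h⟩ := hP j p hp (by omega) hj.1 hj.2
      exact ⟨C, hC, fun _ _ => h⟩
    · exact ⟨0, le_rfl, fun h1 h2 => absurd ⟨h1, h2⟩ hj⟩
  choose C hC hCd using hex
  have hlow : ∀ j, 1 ≤ j → j < n → ∀ c : ℕ,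
      Decoupling p j c ((∑ j ∈ Finset.range n, C j) * (p : ℝ) ^ (τ / t * c)) := fun j h1 h2 c =>
    (hCd j h1 h2 c).mono (mul_le_mul_of_nonneg_right
      (Finset.single_le_sum (f := C) (fun _ _ => hC _) (Finset.mem_range.2 h2)) (by positivity))
  have hiter : ∀ i : ℕ, ∃ C : ℝ, 0 ≤ C ∧
      ∀ c : ℕ, Decoupling p n c (C * (p : ℝ) ^ (max (2 * tri n - i * τ) ε * c)) := by
    intro i
    induction i with
    | zero =>
      refine ⟨1, zero_le_one, fun c => (decoupling_trivial hn c).mono ?_⟩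
      rw [one_mul, ← pow_mul, ← Real.rpow_natCast]
      refine Real.rpow_le_rpow_of_exponent_le hp1 ?_
      have h1 : (2 * tri n : ℝ) ≤ max (2 * tri n - (0 : ℕ) * τ) ε := by simp
      have h2 := mul_le_mul_of_nonneg_right h1 (Nat.cast_nonneg (α := ℝ) c)
      push_cast at h2 ⊢
      linarith
    | succ i ihi =>
      obtain ⟨C', hC', h⟩ := ihi
      refine Decoupling.improve (by omega) hl hln hε (le_max_right _ _) hgain hε'.le ?_ hpε hC'
        (Finset.sum_nonneg fun j _ => hC j) h hlow (le_max_right _ _) ?_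
      · rw [mul_div_cancel₀ _ ht0.ne', hτ]
        refine le_of_eq (one_div_mul_cancel ?_)
        have : (0 : ℝ) < n := by exact_mod_cast (by omega : 0 < n)
        positivity
      · rw [← hτ, sub_le_iff_le_add]
        refine max_le ?_ ((le_max_right _ _).trans (by linarith))
        refine le_trans (le_of_eq ?_) (add_le_add_left (le_max_left _ _) τ)
        push_cast
        ring
  obtain ⟨i, hi⟩ := exists_nat_ge (2 * tri n / τ)
  obtain ⟨C', hC', h⟩ := hiter i
  refine ⟨C', hC', fun c => ?_⟩
  rw [div_le_iff₀ hτ0] at hi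
  have := h c
  rwa [max_eq_right (by linarith)] at this

end iterate

theorem card_parts_le_card {ι : Type} {m : ℤ} {u : ι → ℤ} {t : Finset ι} :
    (parts m u t).card ≤ t.card :=
  Finset.card_image_le

section moment

variable {n : ℕ} {M : Fin n → ℕ} [∀ j, NeZero (M j)]

/-- The `x`-th term of a Weyl sum with frequencies `b j / M j`. -/
noncomputable def weylPhase (M : Fin n → ℕ) [∀ j, NeZero (M j)] (x : ℤ) (b : ∀ j, ZMod (M j)) : ℂ :=
  ∏ j : Fin n, ZMod.stdAddChar (b j * (x : ZMod (M j)) ^ (j + 1 : ℕ))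

theorem stdAddChar_intCast_eq_e {N : ℕ} [NeZero N] (a : ℤ) :
    ZMod.stdAddChar (a : ZMod N) = e (a / N) := by
  rw [ZMod.stdAddChar_coe, e]
  congr 1
  push_cast
  ring

theorem e_sum {β : Type*} (t : Finset β) (f : β → ℝ) : e (∑ i ∈ t, f i) = ∏ i ∈ t, e (f i) := by
  induction t using Finset.induction_on with
  | empty => simp [e_zero]
  | insert a t ha ih => rw [Finset.sum_insert ha, Finset.prod_insert ha, e_add, ih]

theorem weylPhase_intCast (x : ℤ) (b : Fin n → ℤ) :
    weylPhase M x (fun j => (b j : ZMod (M j))) =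
      e (∑ j, (b j : ℝ) / M j * (x : ℝ) ^ (j + 1 : ℕ)) := by
  rw [e_sum, weylPhase]
  refine Finset.prod_congr rfl fun j _ => ?_
  have := stdAddChar_intCast_eq_e (N := M j) (b j * x ^ (j + 1 : ℕ))
  push_cast at this
  rw [this]
  congr 1
  ring

theorem stdAddChar_sum {N : ℕ} [NeZero N] {β : Type*} (t : Finset β) (f : β → ZMod N) :
    ZMod.stdAddChar (∑ i ∈ t, f i) = ∏ i ∈ t, ZMod.stdAddChar (f i) := by
  induction t using Finset.induction_on with
  | empty => simp
  | insert a t ha ih => rw [Finset.sum_insert ha, Finset.prod_insert ha, AddChar.map_add_eq_mul, ih]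

theorem sum_prod_stdAddChar (z : Fin n → ℤ) :
    ∑ b : (∀ j, ZMod (M j)), ∏ j, ZMod.stdAddChar (b j * (z j : ZMod (M j))) =
      ∏ j, if (M j : ℤ) ∣ z j then (M j : ℂ) else 0 := by
  have h := Finset.prod_univ_sum (fun j : Fin n => (Finset.univ : Finset (ZMod (M j))))
    (fun j t => (ZMod.stdAddChar (t * (z j : ZMod (M j))) : ℂ))
  rw [Fintype.piFinset_univ] at h
  rw [← h]
  refine Finset.prod_congr rfl fun j _ => ?_
  rw [AddChar.sum_mulShift _ (ZMod.isPrimitive_stdAddChar _), ZMod.card]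
  simp only [ZMod.intCast_zmod_eq_zero_iff_dvd]
  split_ifs <;> simp

theorem sum_norm_weylPhase_pow (s : ℕ) (A : Finset ℤ) :
    ((∑ b, ‖∑ x ∈ A, weylPhase M x b‖ ^ (2 * s) : ℝ) : ℂ) =
      ∑ x ∈ Fintype.piFinset fun _ : Fin s => A, ∑ y ∈ Fintype.piFinset fun _ : Fin s => A,
        ∏ j : Fin n, if (M j : ℤ) ∣ ∑ i, x i ^ (j + 1 : ℕ) - ∑ i, y i ^ (j + 1 : ℕ)
          then (M j : ℂ) else 0 := by
  simp_rw [← sum_prod_stdAddChar]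
  rw [Complex.ofReal_sum]
  simp_rw [Finset.sum_comm (t := (Finset.univ : Finset (∀ j, ZMod (M j))))]
  refine Finset.sum_congr rfl fun b _ => ?_
  rw [Complex.ofReal_pow, pow_mul, ← Complex.mul_conj', mul_pow, ← map_pow, Finset.sum_pow',
    map_sum, Finset.sum_mul_sum]
  refine Finset.sum_congr rfl fun x _ => Finset.sum_congr rfl fun y _ => ?_
  simp only [weylPhase, map_prod]
  rw [Finset.prod_comm, Finset.prod_comm (s := (Finset.univ : Finset (Fin s))),
    ← Finset.prod_mul_distrib]
  refine Finset.prod_congr rfl fun j _ => ?_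
  simp only [← AddChar.map_neg_eq_conj]
  rw [← stdAddChar_sum, ← stdAddChar_sum, ← AddChar.map_add_eq_mul]
  congr 1
  push_cast
  rw [← Finset.mul_sum, Finset.sum_neg_distrib, ← Finset.mul_sum]
  ring

/-- Passing to other moduli which are large enough to detect equality only decreases the
normalized moments. -/
theorem moment_le_moment {M' : Fin n → ℕ} [∀ j, NeZero (M' j)] {s : ℕ} {A : Finset ℤ}
    (h : ∀ j : Fin n, ∀ x ∈ Fintype.piFinset fun _ : Fin s => A,
      ∀ y ∈ Fintype.piFinset fun _ : Fin s => A,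
      (M j : ℤ) ∣ ∑ i, x i ^ (j + 1 : ℕ) - ∑ i, y i ^ (j + 1 : ℕ) →
        ∑ i, x i ^ (j + 1 : ℕ) - ∑ i, y i ^ (j + 1 : ℕ) = 0) :
    (∏ j, (M' j : ℝ)) * ∑ b, ‖∑ x ∈ A, weylPhase M x b‖ ^ (2 * s) ≤
      (∏ j, (M j : ℝ)) * ∑ b, ‖∑ x ∈ A, weylPhase M' x b‖ ^ (2 * s) := by
  have h1 : ∑ b, ‖∑ x ∈ A, weylPhase M x b‖ ^ (2 * s) =
      ∑ x ∈ Fintype.piFinset fun _ : Fin s => A, ∑ y ∈ Fintype.piFinset fun _ : Fin s => A,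
        ∏ j : Fin n, if (M j : ℤ) ∣ ∑ i, x i ^ (j + 1 : ℕ) - ∑ i, y i ^ (j + 1 : ℕ)
          then (M j : ℝ) else 0 := by
    have := sum_norm_weylPhase_pow (M := M) s A
    rw [← Complex.ofReal_inj, this]
    simp only [Complex.ofReal_sum, Complex.ofReal_prod, apply_ite Complex.ofReal,
      Complex.ofReal_natCast, Complex.ofReal_zero]
  have h2 : ∑ b, ‖∑ x ∈ A, weylPhase M' x b‖ ^ (2 * s) =
      ∑ x ∈ Fintype.piFinset fun _ : Fin s => A, ∑ y ∈ Fintype.piFinset fun _ : Fin s => A,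
        ∏ j : Fin n, if (M' j : ℤ) ∣ ∑ i, x i ^ (j + 1 : ℕ) - ∑ i, y i ^ (j + 1 : ℕ)
          then (M' j : ℝ) else 0 := by
    have := sum_norm_weylPhase_pow (M := M') s A
    rw [← Complex.ofReal_inj, this]
    simp only [Complex.ofReal_sum, Complex.ofReal_prod, apply_ite Complex.ofReal,
      Complex.ofReal_natCast, Complex.ofReal_zero]
  rw [h1, h2]
  simp only [Finset.mul_sum, ← Finset.prod_mul_distrib]
  refine Finset.sum_le_sum fun x hx => Finset.sum_le_sum fun y hy =>
    Finset.prod_le_prod (fun j _ => by positivity) fun j _ => ?_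
  by_cases hd : (M j : ℤ) ∣ ∑ i, x i ^ (j + 1 : ℕ) - ∑ i, y i ^ (j + 1 : ℕ)
  · rw [if_pos hd, if_pos (by rw [h j x hx y hy hd]; exact dvd_zero _), mul_comm]
  · rw [if_neg hd, mul_zero]
    positivity

theorem norm_weylPhase (x : ℤ) (b : ∀ j, ZMod (M j)) : ‖weylPhase M x b‖ = 1 := by
  rw [weylPhase, norm_prod]
  exact Finset.prod_eq_one fun j _ => AddChar.norm_apply _ _

theorem isNondegenerate_weylPhase {p K : ℕ} [Fact p.Prime] (A : Finset ℤ) :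
    IsNondegenerate p n K A (weylPhase fun _ : Fin n => p ^ K) id fun _ => 1 := by
  refine ⟨fun _ => zero_le_one, fun j hj => ⟨0, ?_⟩⟩
  rw [mul_zero, add_zero]
  obtain ⟨hj1, hjn⟩ := Finset.mem_Icc.1 hj
  set j' : Fin n := ⟨j - 1, by omega⟩ with hj'
  refine ⟨Equiv.addRight (Pi.single j' 1), 1, norm_one, fun x _ b => ?_, fun _ => rfl⟩
  rw [one_mul, Equiv.coe_addRight]
  simp only [weylPhase, Pi.add_apply, add_mul, AddChar.map_add_eq_mul]
  rw [Finset.prod_mul_distrib, mul_comm]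
  congr 1
  rw [Finset.prod_eq_single j']
  · have := stdAddChar_intCast_eq_e (N := p ^ K) (x ^ j)
    simp only [Pi.single_eq_same, one_mul, Polynomial.eval_pow, Polynomial.eval_X, id]
    push_cast at this ⊢
    rw [← this, hj']
    simp only
    rw [Nat.sub_add_cancel hj1]
  · intro i _ hi
    rw [Pi.single_eq_of_ne hi, zero_mul, AddChar.map_zero_eq_one]
  · simp

theorem Decoupling.moment_le {p c : ℕ} [Fact p.Prime] {D : ℝ} (hn : 1 ≤ n) (hD0 : 0 ≤ D)
    (hD : Decoupling p n c D)
    {A : Finset ℤ} (hA : ∀ x ∈ A, ∀ y ∈ A, (p : ℤ) ^ c ∣ x - y → x = y) :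
    ∑ b, ‖∑ x ∈ A, weylPhase (fun _ : Fin n => p ^ (n * c)) x b‖ ^ (2 * tri n) ≤
      D * ((A.card : ℝ) ^ tri n * ∏ _j : Fin n, ((p : ℝ) ^ (n * c))) := by
  have h := hD _ _ A _ _ _ (isNondegenerate_weylPhase A)
  simp only [energy, one_mul] at h
  refine h.trans (mul_le_mul_of_nonneg_left ?_ hD0)
  have hk := tri_pos hn
  set E : ℝ := ∏ _j : Fin n, ((p : ℝ) ^ (n * c)) with hE
  have hE0 : 0 ≤ E := by positivity
  have h1 : ∀ B ∈ parts ((p : ℤ) ^ c) id A,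
      energy (fun _ => 1) (weylPhase fun _ : Fin n => p ^ (n * c)) (tri n) B ^ ((1 : ℝ) / tri n) =
        E ^ ((1 : ℝ) / tri n) := by
    intro B hB
    obtain ⟨x, hx, rfl⟩ := mem_parts.1 hB
    have : (A.filter fun y => (p : ℤ) ^ c ∣ id y - id x) = {x} := by
      ext y
      simp only [Finset.mem_filter, Finset.mem_singleton, id]
      exact ⟨fun hy => hA y hy.1 x hx hy.2, fun hy => by subst hy; simpa using hx⟩
    rw [this]
    congr 1
    simp only [energy, Finset.sum_singleton, norm_weylPhase, one_pow, mul_one, Finset.sum_const,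
      Finset.card_univ, Fintype.card_pi, ZMod.card, nsmul_eq_mul, hE]
    push_cast
    rfl
  rw [squareSum, Finset.sum_congr rfl h1, Finset.sum_const, nsmul_eq_mul, mul_pow,
    rpow_one_div_pow hE0 hk]
  refine mul_le_mul_of_nonneg_right (pow_le_pow_left₀ (by positivity) ?_ _) hE0
  exact_mod_cast card_parts_le_card

/-- Vinogradov's mean value theorem at the critical exponent, for frequencies in a grid. -/
theorem exists_moment_le (n : ℕ) (hn : 1 ≤ n) {ε : ℝ} (hε : 0 < ε) :
    ∃ C : ℝ, 0 < C ∧ ∀ H h : ℕ, 1 ≤ H → h ≤ H →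
      ∑ b, ‖∑ x ∈ Finset.Icc (1 : ℤ) h,
        weylPhase (fun j : Fin n => 2 * tri n * H ^ (j + 1 : ℕ) + 1) x b‖ ^ (2 * tri n) ≤
      C * ((H : ℝ) ^ (2 * tri n) * (H : ℝ) ^ ε) := by
  obtain ⟨p₀, hp₀⟩ := exists_decoupling n hn hε
  obtain ⟨p, hpp, hp⟩ := Nat.exists_infinite_primes p₀
  have : Fact p.Prime := ⟨hp⟩
  obtain ⟨C, hC, hD⟩ := hp₀ p hp hpp
  have hp1 : (1 : ℝ) < p := by exact_mod_cast hp.one_lt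
  have hk := tri_pos hn
  refine ⟨C * (p : ℝ) ^ ε * (2 * tri n + 1) ^ n + 1, by positivity, fun H h hH hhH => ?_⟩
  have hH' : (1 : ℝ) ≤ H := by exact_mod_cast hH
  obtain ⟨c, hc1, hc2⟩ : ∃ c : ℕ, H ≤ p ^ c ∧ p ^ c ≤ p * H := by
    refine ⟨Nat.clog p H, Nat.le_pow_clog hp.one_lt H, ?_⟩
    rcases hH.eq_or_lt with rfl | hH1
    · simp [hp.one_lt.le]
    · have h1 := Nat.pow_pred_clog_lt_self hp.one_lt hH1
      have h2 : 0 < Nat.clog p H := Nat.clog_pos hp.one_lt hH1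
      obtain ⟨d, hd⟩ := Nat.exists_eq_add_of_le' h2
      rw [hd] at h1 ⊢
      rw [pow_succ, mul_comm]
      exact Nat.mul_le_mul_left _ h1.le
  set A := Finset.Icc (1 : ℤ) h with hA
  set N : Fin n → ℕ := fun j => 2 * tri n * H ^ (j + 1 : ℕ) + 1 with hN
  have hcard : A.card = h := by rw [hA, Int.card_Icc]; omega
  have hle := (hD c).moment_le hn (by positivity) (A := A) (fun x hx y hy hd => by
    rw [hA, Finset.mem_Icc] at hx hy
    have h1 : x - y = 0 := Int.eq_zero_of_abs_lt_dvd hd (by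
      have : (H : ℤ) ≤ (p : ℤ) ^ c := by exact_mod_cast hc1
      rw [abs_lt]; omega)
    omega)
  have hcmp := moment_le_moment (M := N) (M' := fun _ => p ^ (n * c)) (s := tri n) (A := A) (by
    intro j x hx y hy hd
    have hb : ∀ z ∈ Fintype.piFinset (fun _ : Fin (tri n) => A),
        0 ≤ ∑ i, z i ^ (j + 1 : ℕ) ∧ ∑ i, z i ^ (j + 1 : ℕ) ≤ tri n * (H : ℤ) ^ (j + 1 : ℕ) := by
      intro z hz
      have hz' : ∀ i, 1 ≤ z i ∧ z i ≤ h := fun i => by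
        have := Fintype.mem_piFinset.1 hz i
        rwa [hA, Finset.mem_Icc] at this
      refine ⟨Finset.sum_nonneg fun i _ => pow_nonneg (by linarith [hz' i]) _, ?_⟩
      refine (Finset.sum_le_card_nsmul _ _ ((H : ℤ) ^ (j + 1 : ℕ)) fun i _ => ?_).trans ?_
      · have : (h : ℤ) ≤ H := by exact_mod_cast hhH
        exact pow_le_pow_left₀ (by linarith [hz' i]) (by linarith [hz' i]) _
      · simp
    refine Int.eq_zero_of_abs_lt_dvd hd ?_
    have h1 := hb x hx
    have h2 := hb y hy
    have h3 : (0 : ℤ) ≤ tri n * (H : ℤ) ^ (j + 1 : ℕ) := by positivity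
    rw [hN, abs_lt]
    push_cast
    constructor <;> linarith)
  have hE0 : (0 : ℝ) < ∏ _j : Fin n, ((p : ℝ) ^ (n * c)) := by positivity
  push_cast at hcmp
  set E : ℝ := ∏ _j : Fin n, ((p : ℝ) ^ (n * c)) with hE
  have hNprod : ∏ j, (N j : ℝ) ≤ (2 * tri n + 1) ^ n * (H : ℝ) ^ tri n := by
    have h1 : ∀ m : ℕ, ∏ j : Fin m, (H : ℝ) ^ (j + 1 : ℕ) = (H : ℝ) ^ tri m := by
      intro m
      induction m with
      | zero => simp [tri]
      | succ m ih => rw [Fin.prod_univ_castSucc]; simp only [Fin.val_castSucc, ih, Fin.val_last,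
          ← pow_add]; rfl
    calc ∏ j, (N j : ℝ) ≤ ∏ j : Fin n, ((2 * tri n + 1) * (H : ℝ) ^ (j + 1 : ℕ)) := by
          refine Finset.prod_le_prod (fun _ _ => by positivity) fun j _ => ?_
          rw [hN]
          push_cast
          have : (1 : ℝ) ≤ (H : ℝ) ^ (j + 1 : ℕ) := one_le_pow₀ hH'
          linarith
      _ = _ := by rw [Finset.prod_mul_distrib, h1]; simp
  have hpε : (p : ℝ) ^ (ε * c) ≤ (p : ℝ) ^ ε * (H : ℝ) ^ ε := by
    rw [← Real.mul_rpow (by positivity) (by positivity), mul_comm ε, Real.rpow_mul (by positivity),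
      Real.rpow_natCast]
    exact Real.rpow_le_rpow (by positivity) (by exact_mod_cast hc2) hε.le
  have hfin : E * ∑ b, ‖∑ x ∈ A, weylPhase N x b‖ ^ (2 * tri n) ≤
      E * ((2 * tri n + 1) ^ n * (H : ℝ) ^ tri n *
        (C * ((p : ℝ) ^ ε * (H : ℝ) ^ ε) * (H : ℝ) ^ tri n)) := by
    refine hcmp.trans ?_
    have h1 : (0 : ℝ) ≤ ∏ j, (N j : ℝ) := by positivity
    calc _ ≤ (∏ j, (N j : ℝ)) * (C * (p : ℝ) ^ (ε * c) * ((A.card : ℝ) ^ tri n * E)) :=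
          mul_le_mul_of_nonneg_left hle h1
      _ ≤ ((2 * tri n + 1) ^ n * (H : ℝ) ^ tri n) *
          (C * ((p : ℝ) ^ ε * (H : ℝ) ^ ε) * ((H : ℝ) ^ tri n * E)) := by
          rw [hcard]
          have : (h : ℝ) ≤ H := by exact_mod_cast hhH
          gcongr
      _ = _ := by ring
  refine (le_of_mul_le_mul_left hfin hE0).trans ?_
  rw [two_mul (tri n), pow_add]
  have : (0 : ℝ) ≤ (H : ℝ) ^ tri n * (H : ℝ) ^ tri n * (H : ℝ) ^ ε := by positivity
  nlinarith

end moment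

section counting

theorem card_le_of_forall_sub_le {S : Finset ℤ} {W : ℝ} (hW : 0 ≤ W)
    (h : ∀ x ∈ S, ∀ y ∈ S, (x : ℝ) - y ≤ W) : (S.card : ℝ) ≤ W + 1 := by
  rcases S.eq_empty_or_nonempty with rfl | hS
  · simpa using by linarith
  have h1 : S.card ≤ (Finset.Icc (S.min' hS) (S.max' hS)).card :=
    Finset.card_le_card fun x hx => Finset.mem_Icc.2 ⟨S.min'_le x hx, S.le_max' x hx⟩
  have h2 : ((S.card : ℤ)) ≤ S.max' hS - S.min' hS + 1 := by
    have h3 : S.min' hS ≤ S.max' hS := S.min'_le _ (S.max'_mem hS)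
    rw [Int.card_Icc] at h1
    omega
  have h3 : (S.card : ℝ) ≤ S.max' hS - S.min' hS + 1 := by exact_mod_cast h2
  linarith [h _ (S.max'_mem hS) _ (S.min'_mem hS)]

/-- A spaced sequence is rarely close to an integer. -/
theorem card_le_of_near_integers {S : Finset ℕ} {ψ : ℕ → ℝ} {μ V η : ℝ} (hμ : 0 < μ)
    (hV : 0 ≤ V) (hη : 0 ≤ η)
    (hinc : ∀ m ∈ S, ∀ m' ∈ S, m ≤ m' → μ * ((m' : ℝ) - m) ≤ ψ m' - ψ m)
    (hvar : ∀ m ∈ S, ∀ m' ∈ S, ψ m' - ψ m ≤ V) (hnear : ∀ m ∈ S, ∃ z : ℤ, |ψ m - z| ≤ η) :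
    (S.card : ℝ) ≤ (V + 2) * (2 * η / μ + 1) := by
  have hround : ∀ m ∈ S, |ψ m - round (ψ m)| ≤ η := fun m hm => by
    obtain ⟨z, hz⟩ := hnear m hm
    exact (round_le _ _).trans hz
  have h1 : S.card ≤ (⌊2 * η / μ⌋₊ + 1) * (S.image fun m => round (ψ m)).card := by
    refine Finset.card_le_mul_card_image S _ fun z _ => ?_
    have h2 : ((((S.filter fun m => round (ψ m) = z).image fun m : ℕ => (m : ℤ)).card : ℕ) : ℝ) ≤
        2 * η / μ + 1 := by
      refine card_le_of_forall_sub_le (by positivity) fun x hx y hy => ?_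
      simp only [Finset.mem_image, Finset.mem_filter] at hx hy
      obtain ⟨a, ⟨ha, ha'⟩, rfl⟩ := hx
      obtain ⟨b, ⟨hb, hb'⟩, rfl⟩ := hy
      push_cast
      rcases le_total b a with hab | hab
      · have h3 := hinc b hb a ha hab
        have h4 := hround a ha
        have h5 := hround b hb
        rw [ha'] at h4
        rw [hb'] at h5
        rw [abs_le] at h4 h5
        rw [le_div_iff₀ hμ]
        linarith
      · have : (a : ℝ) ≤ b := by exact_mod_cast hab
        have : 0 ≤ 2 * η / μ := by positivity
        linarith
    rw [Finset.card_image_of_injective _ Nat.cast_injective] at h2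
    have h3 : (0 : ℝ) ≤ 2 * η / μ := by positivity
    rw [← Nat.floor_add_one h3]
    exact Nat.le_floor h2
  have h2 : (((S.image fun m => round (ψ m)).card : ℕ) : ℝ) ≤ V + 1 + 1 := by
    refine card_le_of_forall_sub_le (by positivity) fun x hx y hy => ?_
    simp only [Finset.mem_image] at hx hy
    obtain ⟨a, ha, rfl⟩ := hx
    obtain ⟨b, hb, rfl⟩ := hy
    have h3 := abs_le.1 (abs_sub_round (ψ a))
    have h4 := abs_le.1 (abs_sub_round (ψ b))
    linarith [hvar b hb a ha]
  have h3 : ((⌊2 * η / μ⌋₊ : ℕ) : ℝ) ≤ 2 * η / μ := Nat.floor_le (by positivity)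
  have h4 : (S.card : ℝ) ≤ (⌊2 * η / μ⌋₊ + 1) * ((S.image fun m => round (ψ m)).card : ℕ) := by
    exact_mod_cast h1
  calc (S.card : ℝ) ≤ _ := h4
    _ ≤ (2 * η / μ + 1) * (V + 1 + 1) := by gcongr
    _ = _ := by ring

theorem sub_mem_of_deriv_mem {g w : ℝ → ℝ} {T lo hi x y : ℝ}
    (hg : ∀ x ∈ Set.Icc 0 T, HasDerivAt g (w x) x)
    (hw : ∀ x ∈ Set.Icc 0 T, lo ≤ w x ∧ w x ≤ hi) (hx : 0 ≤ x) (hxy : x ≤ y) (hy : y ≤ T) :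
    lo * (y - x) ≤ g y - g x ∧ g y - g x ≤ hi * (y - x) := by
  rcases hxy.eq_or_lt with rfl | hxy'
  · simp
  obtain ⟨c, hc, hc'⟩ := exists_hasDerivAt_eq_slope g w hxy'
    (fun z hz => (hg z ⟨hx.trans hz.1, hz.2.trans hy⟩).continuousAt.continuousWithinAt)
    fun z hz => hg z ⟨hx.trans hz.1.le, hz.2.le.trans hy⟩
  have h1 : w c * (y - x) = g y - g x := by
    rw [hc', div_mul_cancel₀]
    linarith
  have h2 := hw c ⟨hx.trans hc.1.le, hc.2.le.trans hy⟩
  rw [← h1]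
  have : 0 ≤ y - x := by linarith
  exact ⟨mul_le_mul_of_nonneg_right h2.1 this, mul_le_mul_of_nonneg_right h2.2 this⟩

variable {G g w : ℝ → ℝ} {N : ℕ} {lam L A A' : ℝ}

theorem card_near_integers_sub_le {η : ℝ} (hL : 1 ≤ L) (hlam : 0 < lam) (hA' : 1 ≤ A')
    (hη : 0 ≤ η)
    (hG : ∀ x ∈ Set.Icc (0 : ℝ) N, HasDerivAt G (g x) x)
    (hg : ∀ x ∈ Set.Icc (0 : ℝ) N, HasDerivAt g (w x) x)
    (hw : ∀ x ∈ Set.Icc (0 : ℝ) N, lam ≤ w x ∧ w x ≤ L * lam) {d : ℕ} (hd : 1 ≤ d) :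
    (((Finset.range N).filter fun m =>
      m + d < N ∧ ∃ z : ℤ, |(G (m + d : ℕ) - G m) / A' - z| ≤ η).card : ℝ) ≤
      (d * (L * lam) * N + 2) * (2 * η * A' / (d * lam) + 1) := by
  have hd' : (1 : ℝ) ≤ d := by exact_mod_cast hd
  have key : ∀ m m' : ℕ, m ≤ m' → m' + d < N →
      d * lam * ((m' : ℝ) - m) ≤ (G (m' + d : ℕ) - G m') - (G (m + d : ℕ) - G m) ∧
      (G (m' + d : ℕ) - G m') - (G (m + d : ℕ) - G m) ≤ d * (L * lam) * ((m' : ℝ) - m) := by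
    intro m m' hmm hm'
    have h1 : (m : ℝ) ≤ m' := by exact_mod_cast hmm
    have h2 : (m' : ℝ) + d ≤ N := by exact_mod_cast hm'.le
    have h3 : (0 : ℝ) ≤ m := by positivity
    have := sub_mem_of_deriv_mem (g := fun x => G (x + d) - G x) (w := fun x => g (x + d) - g x)
      (T := (N : ℝ) - d) (lo := d * lam) (hi := d * (L * lam)) (x := m) (y := m')
      (fun x hx => ?_) (fun x hx => ?_) (by positivity) h1 (by linarith)
    · simpa using this
    · have hx' : x + d ∈ Set.Icc (0 : ℝ) N := ⟨by linarith [hx.1], by linarith [hx.2]⟩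
      exact ((hG _ hx').comp_add_const x d).sub (hG x ⟨hx.1, by linarith [hx.2]⟩)
    · have := sub_mem_of_deriv_mem hg hw hx.1 (show x ≤ x + d by linarith) (by linarith [hx.2])
      rw [add_sub_cancel_left] at this
      constructor <;> linarith [this.1, this.2]
  have hA0 : 0 < A' := by linarith
  refine (card_le_of_near_integers (ψ := fun m => (G (m + d : ℕ) - G m) / A')
    (μ := d * lam / A') (V := d * (L * lam) * N) (η := η)
    (by positivity) (by positivity) hη (fun m hm m' hm' hmm => ?_) (fun m hm m' hm' => ?_)
    (fun m hm => ?_)).trans (le_of_eq ?_)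
  · simp only [Finset.mem_filter] at hm hm'
    rw [← sub_div, div_mul_eq_mul_div]
    exact div_le_div_of_nonneg_right (key m m' hmm hm'.2.1).1 hA0.le
  · simp only [Finset.mem_filter, Finset.mem_range] at hm hm'
    rw [← sub_div, div_le_iff₀ hA0]
    have h0 : 0 ≤ d * (L * lam) * N := by positivity
    have h0' : d * (L * lam) * N ≤ d * (L * lam) * N * A' := le_mul_of_one_le_right h0 hA'
    rcases le_total m m' with hmm | hmm
    · have h1 : (m' : ℝ) - m ≤ N := by
        have : (m' : ℝ) ≤ N := by exact_mod_cast hm'.1.le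
        have : (0 : ℝ) ≤ m := by positivity
        linarith
      have h2 := (key m m' hmm hm'.2.1).2
      have h3 : d * (L * lam) * ((m' : ℝ) - m) ≤ d * (L * lam) * N :=
        mul_le_mul_of_nonneg_left h1 (by positivity)
      linarith
    · have h1 : (0 : ℝ) ≤ (m : ℝ) - m' := by
        have : (m' : ℝ) ≤ m := by exact_mod_cast hmm
        linarith
      have h2 := (key m' m hmm hm.2.1).1
      have h3 : 0 ≤ d * lam * ((m : ℝ) - m') := mul_nonneg (by positivity) h1
      linarith
  · exact (Finset.mem_filter.1 hm).2.2
  · field_simp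

end counting

section counting

theorem card_pairs_le {r : ℕ → ℕ → Prop} (hr : ∀ m m', r m m' → r m' m) {N K : ℕ}
    (hK : ∀ m m', m < m' → m' < N → r m m' → m' - m ≤ K) :
    ((Finset.range N ×ˢ Finset.range N).filter fun x => r x.1 x.2).card ≤
      N + 2 * ∑ d ∈ Finset.Icc 1 K,
        ((Finset.range N).filter fun m => m + d < N ∧ r m (m + d)).card := by
  set Q := (Finset.range N ×ˢ Finset.range N).filter fun x => r x.1 x.2 with hQ
  have hlt : (Q.filter fun x => x.1 < x.2).card ≤ ∑ d ∈ Finset.Icc 1 K,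
      ((Finset.range N).filter fun m => m + d < N ∧ r m (m + d)).card := by
    rw [Finset.card_eq_sum_card_fiberwise (f := fun x => x.2 - x.1) (t := Finset.Icc 1 K)]
    · refine Finset.sum_le_sum fun d _ => Finset.card_le_card_of_injOn Prod.fst ?_ ?_
      · intro x hx
        simp only [hQ, Finset.coe_filter, Finset.mem_filter, Finset.mem_product, Finset.mem_range,
          Set.mem_ofPred_eq] at hx ⊢
        obtain ⟨⟨⟨⟨h1, h2⟩, h3⟩, h4⟩, h5⟩ := hx
        have h6 : x.1 + d = x.2 := by omega
        rw [h6]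
        exact ⟨h1, h2, h3⟩
      · intro x hx y hy hxy
        simp only [Finset.coe_filter, Finset.mem_filter, Set.mem_ofPred_eq] at hx hy
        exact Prod.ext hxy (by have := hx.1.2; have := hy.1.2; have := hx.2; have := hy.2; omega)
    · intro x hx
      simp only [hQ, Finset.coe_filter, Finset.mem_filter, Finset.mem_product, Finset.mem_range,
        Set.mem_ofPred_eq, Finset.coe_Icc, Set.mem_Icc] at hx ⊢
      exact ⟨by omega, hK _ _ hx.2 hx.1.1.2 hx.1.2⟩
  have hgt : (Q.filter fun x => x.2 < x.1).card ≤ (Q.filter fun x => x.1 < x.2).card := by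
    refine Finset.card_le_card_of_injOn Prod.swap ?_ Prod.swap_injective.injOn
    intro x hx
    simp only [hQ, Finset.coe_filter, Finset.mem_filter, Finset.mem_product, Finset.mem_range,
      Set.mem_ofPred_eq, Prod.fst_swap, Prod.snd_swap] at hx ⊢
    exact ⟨⟨⟨hx.1.1.2, hx.1.1.1⟩, hr _ _ hx.1.2⟩, hx.2⟩
  have heq : (Q.filter fun x => x.1 = x.2).card ≤ N := by
    rw [← Finset.card_range N]
    refine Finset.card_le_card_of_injOn Prod.fst ?_ ?_
    · intro x hx
      simp only [hQ, Finset.coe_filter, Finset.mem_filter, Finset.mem_product, Finset.mem_range,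
        Set.mem_ofPred_eq] at hx
      simpa using hx.1.1.1
    · intro x hx y hy hxy
      simp only [Finset.coe_filter, Set.mem_ofPred_eq] at hx hy
      exact Prod.ext hxy (by rw [← hx.2, ← hy.2, hxy])
  have hsub : Q ⊆ (Q.filter fun x => x.1 = x.2) ∪
      ((Q.filter fun x => x.1 < x.2) ∪ (Q.filter fun x => x.2 < x.1)) := fun x hx => by
    simp only [Finset.mem_union, Finset.mem_filter]
    rcases lt_trichotomy x.1 x.2 with h | h | h
    exacts [Or.inr (Or.inl ⟨hx, h⟩), Or.inl ⟨hx, h⟩, Or.inr (Or.inr ⟨hx, h⟩)]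
  have h1 := Finset.card_le_card hsub
  have h2 := Finset.card_union_le (Q.filter fun x => x.1 = x.2)
    ((Q.filter fun x => x.1 < x.2) ∪ (Q.filter fun x => x.2 < x.1))
  have h3 := Finset.card_union_le (Q.filter fun x => x.1 < x.2) (Q.filter fun x => x.2 < x.1)
  omega

theorem sum_inv_le_one_add_log (K : ℕ) :
    ∑ d ∈ Finset.Icc 1 K, ((d : ℝ))⁻¹ ≤ 1 + Real.log K := by
  have := harmonic_le_one_add_log K
  rw [harmonic_eq_sum_Icc] at this
  push_cast at this
  exact this

variable {G g w : ℝ → ℝ} {N : ℕ} {lam L A A' : ℝ}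

/-- Pairs whose Taylor coefficients of the two highest degrees nearly agree modulo one. -/
theorem card_pairs_near_le {η η' D : ℝ} (hL : 1 ≤ L) (hlam : 0 < lam) (hA : 1 ≤ A) (hA' : 1 ≤ A')
    (hη : η ≤ 1 / 2) (hη' : 0 ≤ η') (hD : 1 ≤ D) (hηD : A * η ≤ D * lam) (hN : L * lam * N ≤ 1 / 4)
    (hG : ∀ x ∈ Set.Icc (0 : ℝ) N, HasDerivAt G (g x) x)
    (hg : ∀ x ∈ Set.Icc (0 : ℝ) N, HasDerivAt g (w x) x)
    (hw : ∀ x ∈ Set.Icc (0 : ℝ) N, lam ≤ w x ∧ w x ≤ L * lam)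
    {r : ℕ → ℕ → Prop} (hr : ∀ m m', r m m' → r m' m)
    (hrg : ∀ m m' : ℕ, r m m' → ∃ z : ℤ, |(g m' - g m) / A - z| ≤ η)
    (hrG : ∀ m m' : ℕ, r m m' → ∃ z : ℤ, |(G m' - G m) / A' - z| ≤ η') :
    (((Finset.range N ×ˢ Finset.range N).filter fun x => r x.1 x.2).card : ℝ) ≤
      N + 2 * (D * (2 * L * N * η' * A') + D ^ 2 * L * lam * N +
        4 * η' * A' / lam * (1 + Real.log D) + 2 * D) := by
  have hA0 : 0 < A := by linarith
  have hK : ∀ m m' : ℕ, m < m' → m' < N → r m m' → m' - m ≤ ⌊D⌋₊ := by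
    intro m m' hmm hm' h
    obtain ⟨z, hz⟩ := hrg m m' h
    have h1 : (m : ℝ) < m' := by exact_mod_cast hmm
    have h2 : (m' : ℝ) ≤ N := by exact_mod_cast hm'.le
    have h0 : (0 : ℝ) ≤ m := by positivity
    have h3 := sub_mem_of_deriv_mem hg hw h0 h1.le h2
    have h4 : (g m' - g m) / A ≤ 1 / 4 := by
      rw [div_le_iff₀ hA0]
      have : L * lam * ((m' : ℝ) - m) ≤ L * lam * N :=
        mul_le_mul_of_nonneg_left (by linarith) (by positivity)
      linarith
    have h5 : 0 < (g m' - g m) / A := by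
      have : 0 < lam * ((m' : ℝ) - m) := mul_pos hlam (by linarith)
      exact div_pos (by linarith) hA0
    rw [abs_le] at hz
    have hz0 : z = 0 := by
      have h6 : (z : ℝ) < 1 := by linarith
      have h7 : (-1 : ℝ) < z := by linarith
      have h8 : z < 1 := by exact_mod_cast h6
      have h9 : -1 < z := by exact_mod_cast h7
      omega
    rw [hz0, Int.cast_zero, sub_zero] at hz
    have h6 := hz.2
    rw [div_le_iff₀ hA0] at h6
    refine Nat.le_floor ?_
    rw [Nat.cast_sub hmm.le]
    refine le_of_mul_le_mul_right ?_ hlam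
    linarith
  have h1 := card_pairs_le hr hK
  have h2 : (((Finset.range N ×ˢ Finset.range N).filter fun x => r x.1 x.2).card : ℝ) ≤
      N + 2 * ∑ d ∈ Finset.Icc 1 ⌊D⌋₊,
        (((Finset.range N).filter fun m => m + d < N ∧ r m (m + d)).card : ℝ) := by
    exact_mod_cast h1
  refine h2.trans ?_
  gcongr
  have hfl : ((⌊D⌋₊ : ℕ) : ℝ) ≤ D := Nat.floor_le (by linarith)
  have hfl1 : 1 ≤ ⌊D⌋₊ := Nat.le_floor (by exact_mod_cast hD)
  calc ∑ d ∈ Finset.Icc 1 ⌊D⌋₊,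
        (((Finset.range N).filter fun m => m + d < N ∧ r m (m + d)).card : ℝ)
      ≤ ∑ d ∈ Finset.Icc 1 ⌊D⌋₊,
        ((2 * L * N * η' * A' + D * L * lam * N + 2) + 4 * η' * A' / lam * (d : ℝ)⁻¹) := by
        refine Finset.sum_le_sum fun d hd => ?_
        obtain ⟨hd1, hd2⟩ := Finset.mem_Icc.1 hd
        have hd0 : (0 : ℝ) < d := by exact_mod_cast hd1
        have hdD : (d : ℝ) ≤ D := (by exact_mod_cast hd2 : (d : ℝ) ≤ (⌊D⌋₊ : ℕ)).trans hfl
        have h3 : ((Finset.range N).filter fun m => m + d < N ∧ r m (m + d)).card ≤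
            ((Finset.range N).filter fun m =>
              m + d < N ∧ ∃ z : ℤ, |(G (m + d : ℕ) - G m) / A' - z| ≤ η').card := by
          refine Finset.card_le_card fun m hm => ?_
          simp only [Finset.mem_filter] at hm ⊢
          exact ⟨hm.1, hm.2.1, hrG _ _ hm.2.2⟩
        have h4 : (((Finset.range N).filter fun m => m + d < N ∧ r m (m + d)).card : ℝ) ≤
            (((Finset.range N).filter fun m =>
              m + d < N ∧ ∃ z : ℤ, |(G (m + d : ℕ) - G m) / A' - z| ≤ η').card : ℝ) := by
          exact_mod_cast h3
        refine (h4.trans (card_near_integers_sub_le hL hlam hA' hη' hG hg hw hd1)).trans ?_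
        have h5 : (d * (L * lam) * N + 2) * (2 * η' * A' / (d * lam) + 1) =
            2 * L * N * η' * A' + d * (L * lam * N) + 2 + 4 * η' * A' / lam * (d : ℝ)⁻¹ := by
          field_simp
          ring
        have h6 : d * (L * lam * N) ≤ D * (L * lam * N) :=
          mul_le_mul_of_nonneg_right hdD (by positivity)
        rw [h5]
        linarith
    _ = ⌊D⌋₊ * (2 * L * N * η' * A' + D * L * lam * N + 2) +
        4 * η' * A' / lam * ∑ d ∈ Finset.Icc 1 ⌊D⌋₊, (d : ℝ)⁻¹ := by
        rw [Finset.sum_add_distrib, ← Finset.mul_sum, Finset.sum_const, Nat.card_Icc, nsmul_eq_mul,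
          Nat.add_sub_cancel]
    _ ≤ D * (2 * L * N * η' * A' + D * L * lam * N + 2) +
        4 * η' * A' / lam * (1 + Real.log D) := by
        have h3 := sum_inv_le_one_add_log ⌊D⌋₊
        have h4 : Real.log (⌊D⌋₊ : ℕ) ≤ Real.log D :=
          Real.log_le_log (by exact_mod_cast hfl1) hfl
        gcongr
        linarith
    _ = _ := by ring

end counting

section taylor

/-- The error in the Taylor expansion of `f 0` with `d` terms, where `f i` is the `i`-th
derivative. -/
noncomputable def taylorError (d : ℕ) (f : ℕ → ℝ → ℝ) (x₀ t : ℝ) : ℝ :=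
  f 0 (x₀ + t) - ∑ l ∈ Finset.range d, f l x₀ * (t ^ l / l.factorial)

theorem hasDerivAt_taylorError {d : ℕ} {f : ℕ → ℝ → ℝ} {x₀ t : ℝ}
    (hf : HasDerivAt (f 0) (f 1 (x₀ + t)) (x₀ + t)) :
    HasDerivAt (taylorError (d + 1) f x₀) (taylorError d (fun i => f (i + 1)) x₀ t) t := by
  unfold taylorError
  refine (hf.comp_const_add x₀ t).sub ?_
  simp only [Finset.sum_range_succ', pow_zero]
  refine HasDerivAt.add_const _ (HasDerivAt.fun_sum fun l _ => ?_)
  refine HasDerivAt.const_mul _ ?_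
  convert (hasDerivAt_pow (l + 1) t).div_const ((l + 1).factorial : ℝ) using 1
  rw [Nat.factorial_succ, Nat.add_sub_cancel]
  push_cast
  have h1 : (l.factorial : ℝ) ≠ 0 := by exact_mod_cast l.factorial_ne_zero
  have h2 : (l : ℝ) + 1 ≠ 0 := by positivity
  field_simp

theorem taylorError_zero (d : ℕ) (f : ℕ → ℝ → ℝ) (x₀ : ℝ) : taylorError (d + 1) f x₀ 0 = 0 := by
  simp [taylorError, Finset.sum_range_succ']

variable {d : ℕ} {f : ℕ → ℝ → ℝ} {x₀ T B : ℝ}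

theorem abs_taylorError_sub_le_of_deriv
    (hf : ∀ x ∈ Set.Icc x₀ (x₀ + T), HasDerivAt (f 0) (f 1 x) x)
    (hB : ∀ t ∈ Set.Icc 0 T, |taylorError d (fun i => f (i + 1)) x₀ t| ≤ B) {s t : ℝ}
    (hs : s ∈ Set.Icc 0 T) (ht : t ∈ Set.Icc 0 T) :
    |taylorError (d + 1) f x₀ t - taylorError (d + 1) f x₀ s| ≤ B * |t - s| := by
  have := (convex_Icc 0 T).norm_image_sub_le_of_norm_hasDerivWithin_le
    (f := taylorError (d + 1) f x₀) (f' := taylorError d (fun i => f (i + 1)) x₀)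
    (fun y hy => (hasDerivAt_taylorError
      (hf (x₀ + y) ⟨by linarith [hy.1], by linarith [hy.2]⟩)).hasDerivWithinAt) hB hs ht
  simpa only [Real.norm_eq_abs] using this

theorem abs_taylorError_le (hT : 0 ≤ T) : ∀ (d : ℕ) (f : ℕ → ℝ → ℝ),
    (∀ i < d, ∀ x ∈ Set.Icc x₀ (x₀ + T), HasDerivAt (f i) (f (i + 1) x) x) →
    (∀ x ∈ Set.Icc x₀ (x₀ + T), |f d x| ≤ B) →
    ∀ t ∈ Set.Icc 0 T, |taylorError d f x₀ t| ≤ B * T ^ d := by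
  intro d
  induction d with
  | zero =>
    intro f _ hB t ht
    simpa [taylorError] using hB (x₀ + t) ⟨by linarith [ht.1], by linarith [ht.2]⟩
  | succ d ih =>
    intro f hf hB t ht
    have h1 := abs_taylorError_sub_le_of_deriv (hf 0 (Nat.succ_pos d))
      (ih (fun i => f (i + 1)) (fun i hi => hf (i + 1) (by omega)) hB) ⟨le_rfl, hT⟩ ht
    rw [taylorError_zero, sub_zero, sub_zero, abs_of_nonneg ht.1] at h1
    have h2 := (abs_nonneg _).trans (hB x₀ ⟨le_rfl, by linarith⟩)
    refine h1.trans ?_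
    rw [pow_succ, ← mul_assoc]
    exact mul_le_mul_of_nonneg_left ht.2 (by positivity)

theorem abs_taylorError_sub_le (hT : 0 ≤ T)
    (hf : ∀ i ≤ d, ∀ x ∈ Set.Icc x₀ (x₀ + T), HasDerivAt (f i) (f (i + 1) x) x)
    (hB : ∀ x ∈ Set.Icc x₀ (x₀ + T), |f (d + 1) x| ≤ B) {s t : ℝ}
    (hs : s ∈ Set.Icc 0 T) (ht : t ∈ Set.Icc 0 T) :
    |taylorError (d + 1) f x₀ t - taylorError (d + 1) f x₀ s| ≤ B * T ^ d * |t - s| :=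
  abs_taylorError_sub_le_of_deriv (hf 0 d.zero_le)
    (abs_taylorError_le hT d (fun i => f (i + 1)) (fun i hi => hf (i + 1) (by omega)) hB) hs ht

end taylor

section partialSummation

theorem norm_e_sub_e_le (x y : ℝ) : ‖e x - e y‖ ≤ 2 * Real.pi * |x - y| := by
  have h1 : e x - e y = e y * (e (x - y) - 1) := by
    rw [mul_sub, ← e_add, mul_one, add_sub_cancel]
  have h2 : e (x - y) = Complex.exp (Complex.I * ((2 * Real.pi * (x - y) : ℝ) : ℂ)) := by
    rw [e]
    congr 1
    push_cast
    ring
  rw [h1, norm_mul, norm_e, one_mul, h2]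
  refine Real.norm_exp_I_mul_ofReal_sub_one_le.trans (le_of_eq ?_)
  rw [Real.norm_eq_abs, abs_mul, abs_of_nonneg (by positivity)]

theorem norm_sum_e_mul_le {g : ℕ → ℝ} {w : ℕ → ℂ} {H : ℕ} {κ : ℝ}
    (hg : ∀ i, i + 1 < H → |g (i + 1) - g i| ≤ κ) :
    ‖∑ i ∈ Finset.range H, e (g i) * w i‖ ≤ ‖∑ i ∈ Finset.range H, w i‖ +
      2 * Real.pi * κ * ∑ h ∈ Finset.range (H - 1), ‖∑ i ∈ Finset.range (h + 1), w i‖ := by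
  have h := Finset.sum_range_by_parts (fun i => e (g i)) w H
  simp only [smul_eq_mul] at h
  rw [h]
  refine (norm_sub_le _ _).trans (add_le_add ?_ ((norm_sum_le _ _).trans ?_))
  · rw [norm_mul, norm_e, one_mul]
  · rw [Finset.mul_sum]
    refine Finset.sum_le_sum fun i hi => ?_
    rw [norm_mul]
    refine mul_le_mul_of_nonneg_right ((norm_e_sub_e_le _ _).trans ?_) (norm_nonneg _)
    exact mul_le_mul_of_nonneg_left (hg i (by have := Finset.mem_range.1 hi; omega))
      (by positivity)

theorem sum_Icc_one_eq_sum_range (u : ℤ → ℂ) (h : ℕ) :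
    ∑ x ∈ Finset.Icc (1 : ℤ) h, u x = ∑ i ∈ Finset.range h, u ((i + 1 : ℕ) : ℤ) := by
  induction h with
  | zero => simp
  | succ h ih =>
    rw [Finset.sum_range_succ, ← ih]
    have : Finset.Icc (1 : ℤ) ((h + 1 : ℕ) : ℤ) =
        insert ((h + 1 : ℕ) : ℤ) (Finset.Icc (1 : ℤ) h) := by
      ext x
      simp only [Finset.mem_Icc, Finset.mem_insert]
      push_cast
      omega
    rw [this, Finset.sum_insert (by simp), add_comm]

end partialSummation

section shortSum

variable {n : ℕ} (M : Fin n → ℕ) [∀ j, NeZero (M j)]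

/-- The grid point closest from below to the Taylor coefficients of `f 0` at `x₀`. -/
noncomputable def gridPoint (f : ℕ → ℝ → ℝ) (x₀ : ℝ) (j : Fin n) : ZMod (M j) :=
  (⌊M j * (f (j + 1) x₀ / (j + 1 : ℕ).factorial)⌋ : ZMod (M j))

variable {M} {f : ℕ → ℝ → ℝ} {x₀ lam L : ℝ} {H : ℕ}

theorem norm_sum_e_le_sum_weylPhase (hH : 1 ≤ H) (hM : ∀ j : Fin n, H ^ (j + 1 : ℕ) ≤ M j)
    (hf : ∀ i ≤ n, ∀ x ∈ Set.Icc x₀ (x₀ + H), HasDerivAt (f i) (f (i + 1) x) x)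
    (hB : ∀ x ∈ Set.Icc x₀ (x₀ + H), |f (n + 1) x| ≤ L * lam) (hlam : lam * H ^ (n + 1) ≤ 1)
    (hL : 0 ≤ L) :
    ‖∑ i ∈ Finset.range H, e (f 0 (x₀ + (i + 1 : ℕ)))‖ ≤
      ‖∑ x ∈ Finset.Icc (1 : ℤ) H, weylPhase M x (gridPoint M f x₀)‖ +
      2 * Real.pi * ((L + n ^ 2) / H) * ∑ h ∈ Finset.range (H - 1),
        ‖∑ x ∈ Finset.Icc (1 : ℤ) (h + 1 : ℕ), weylPhase M x (gridPoint M f x₀)‖ := by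
  have hH0 : (0 : ℝ) < H := by exact_mod_cast hH
  set c : Fin n → ℝ := fun j => f (j + 1) x₀ / (j + 1 : ℕ).factorial with hc
  set b : Fin n → ℤ := fun j => ⌊M j * c j⌋ with hb
  set g : ℕ → ℝ := fun i => f 0 (x₀ + (i + 1 : ℕ)) -
    ∑ j : Fin n, (b j : ℝ) / M j * (((i + 1 : ℕ) : ℤ) : ℝ) ^ (j + 1 : ℕ) with hg
  have hM0 : ∀ j : Fin n, (0 : ℝ) < M j := fun j =>
    by exact_mod_cast Nat.pos_of_ne_zero (NeZero.ne (M j))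
  have hcb : ∀ j : Fin n, |c j - b j / M j| ≤ 1 / (H : ℝ) ^ (j + 1 : ℕ) := by
    intro j
    have h1 : (b j : ℝ) ≤ M j * c j := Int.floor_le _
    have h2 : M j * c j < b j + 1 := Int.lt_floor_add_one _
    have h3 : c j - b j / M j = (M j * c j - b j) / M j := by
      have := (hM0 j).ne'
      field_simp
    rw [h3, abs_div, abs_of_nonneg (by linarith), abs_of_pos (hM0 j)]
    have h4 : (H : ℝ) ^ (j + 1 : ℕ) ≤ M j := by exact_mod_cast hM j
    exact div_le_div₀ zero_le_one (by linarith) (by positivity) h4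
  have hgT : ∀ i : ℕ, g i = taylorError (n + 1) f x₀ (i + 1 : ℕ) + f 0 x₀ +
      ∑ j : Fin n, (c j - b j / M j) * (((i + 1 : ℕ) : ℝ)) ^ (j + 1 : ℕ) := by
    intro i
    simp only [hg, taylorError, Finset.sum_range_succ', sub_mul, Finset.sum_sub_distrib,
      Int.cast_natCast]
    rw [Finset.sum_range fun l => f (l + 1) x₀ * (((i + 1 : ℕ) : ℝ) ^ (l + 1) / (l + 1).factorial)]
    simp only [hc]
    have : ∀ j : Fin n, f (j + 1) x₀ * (((i + 1 : ℕ) : ℝ) ^ (j + 1 : ℕ) / (j + 1 : ℕ).factorial) =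
        f (j + 1) x₀ / (j + 1 : ℕ).factorial * ((i + 1 : ℕ) : ℝ) ^ (j + 1 : ℕ) := fun j => by ring
    simp only [this, pow_zero, Nat.factorial_zero, Nat.cast_one, div_one, mul_one]
    ring
  have hκ : ∀ i, i + 1 < H → |g (i + 1) - g i| ≤ (L + n ^ 2) / H := by
    intro i hi
    have hi1 : ((i + 1 : ℕ) : ℝ) ≤ H := by exact_mod_cast hi.le
    have hi2 : ((i + 1 + 1 : ℕ) : ℝ) ≤ H := by exact_mod_cast hi
    have hdiff : ((i + 1 + 1 : ℕ) : ℝ) - (i + 1 : ℕ) = 1 := by push_cast; ring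
    have h1 := abs_taylorError_sub_le hH0.le hf hB (s := (i + 1 : ℕ)) (t := (i + 1 + 1 : ℕ))
      ⟨by positivity, hi1⟩ ⟨by positivity, hi2⟩
    rw [hdiff, abs_one, mul_one] at h1
    have h2 : L * lam * (H : ℝ) ^ n ≤ L / H := by
      rw [le_div_iff₀ hH0]
      calc L * lam * (H : ℝ) ^ n * H = L * (lam * H ^ (n + 1)) := by ring
        _ ≤ L * 1 := by gcongr
        _ = L := mul_one L
    have h3 : |∑ j : Fin n, (c j - b j / M j) *
        (((i + 1 + 1 : ℕ) : ℝ) ^ (j + 1 : ℕ) - ((i + 1 : ℕ) : ℝ) ^ (j + 1 : ℕ))| ≤ n ^ 2 / H := by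
      refine (Finset.abs_sum_le_sum_abs _ _).trans ?_
      calc _ ≤ ∑ _j : Fin n, (n : ℝ) / H := by
            refine Finset.sum_le_sum fun j _ => ?_
            rw [abs_mul]
            have h4 := abs_pow_sub_pow_le ((i + 1 + 1 : ℕ) : ℝ) ((i + 1 : ℕ) : ℝ) (j + 1)
            rw [hdiff, abs_one, one_mul, Nat.add_sub_cancel, Nat.abs_cast, Nat.abs_cast] at h4
            have h5 : ((j + 1 : ℕ) : ℝ) ≤ n := by exact_mod_cast j.2
            have h6 : (max ((i + 1 + 1 : ℕ) : ℝ) ((i + 1 : ℕ) : ℝ)) ^ (j : ℕ) ≤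
                (H : ℝ) ^ (j : ℕ) :=
              pow_le_pow_left₀ (le_max_of_le_left (by positivity)) (max_le hi2 hi1) _
            calc _ ≤ 1 / (H : ℝ) ^ (j + 1 : ℕ) * (n * (H : ℝ) ^ (j : ℕ)) :=
                  mul_le_mul (hcb j) (h4.trans (mul_le_mul h5 h6 (pow_nonneg
                    (le_max_of_le_left (by positivity)) _) (by positivity)))
                    (abs_nonneg _) (by positivity)
              _ = n / H := by
                  rw [pow_succ]
                  field_simp
        _ = _ := by
            rw [Finset.sum_const, Finset.card_univ, Fintype.card_fin, nsmul_eq_mul]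
            ring
    have h4 : g (i + 1) - g i =
        (taylorError (n + 1) f x₀ (i + 1 + 1 : ℕ) - taylorError (n + 1) f x₀ (i + 1 : ℕ)) +
        ∑ j : Fin n, (c j - b j / M j) *
        (((i + 1 + 1 : ℕ) : ℝ) ^ (j + 1 : ℕ) - ((i + 1 : ℕ) : ℝ) ^ (j + 1 : ℕ)) := by
      rw [hgT, hgT]
      simp only [mul_sub, Finset.sum_sub_distrib]
      ring
    rw [h4, add_div]
    exact (abs_add_le _ _).trans (add_le_add (h1.trans h2) h3)
  have hfin := norm_sum_e_mul_le (w := fun i => weylPhase M ((i + 1 : ℕ) : ℤ) (gridPoint M f x₀)) hκ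
  simp only [sum_Icc_one_eq_sum_range]
  convert hfin using 3 with i
  have : gridPoint M f x₀ = fun j => ((b j : ℤ) : ZMod (M j)) := rfl
  rw [this, weylPhase_intCast, ← e_add, hg]
  simp only [sub_add_cancel]

end shortSum

section grouping

theorem sum_comp_eq_sum_card_mul {β : Type*} [Fintype β] (N : ℕ) (b : ℕ → β) (φ : β → ℝ) :
    ∑ m ∈ Finset.range N, φ (b m) =
      ∑ x, (((Finset.range N).filter fun m => b m = x).card : ℝ) * φ x := by
  rw [← Finset.sum_fiberwise (Finset.range N) b]
  refine Finset.sum_congr rfl fun x _ => ?_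
  rw [← nsmul_eq_mul, ← Finset.sum_const]
  exact Finset.sum_congr rfl fun m hm => by rw [(Finset.mem_filter.1 hm).2]

theorem sum_sq_card_fiber {β : Type*} [Fintype β] (N : ℕ) (b : ℕ → β) :
    ∑ x, (((Finset.range N).filter fun m => b m = x).card : ℝ) ^ 2 =
      (((Finset.range N ×ˢ Finset.range N).filter fun y => b y.1 = b y.2).card : ℝ) := by
  rw [Finset.card_filter, Finset.sum_product]
  push_cast
  have h : ∀ m, (∑ m' ∈ Finset.range N, if b m = b m' then (1 : ℝ) else 0) =
      (((Finset.range N).filter fun m' => b m' = b m).card : ℝ) := fun m => by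
    rw [Finset.card_filter]
    push_cast
    simp only [eq_comm]
  simp only [h, pow_two]
  exact (sum_comp_eq_sum_card_mul N b
    fun x => (((Finset.range N).filter fun m => b m = x).card : ℝ)).symm

theorem pow_sum_comp_le {β : Type*} [Fintype β] (N s : ℕ) (b : ℕ → β) {φ : β → ℝ}
    (hφ : ∀ x, 0 ≤ φ x) :
    (∑ m ∈ Finset.range N, φ (b m)) ^ (2 * (s + 1)) ≤
      (N : ℝ) ^ (2 * s) *
        (((Finset.range N ×ˢ Finset.range N).filter fun y => b y.1 = b y.2).card *
          ∑ x, φ x ^ (2 * (s + 1))) := by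
  have h1 := pow_sum_le_of_card_le (Finset.range N) (f := fun m => φ (b m)) (fun m _ => hφ _)
    (q := N) (by simp) s
  have h2 := Finset.sum_mul_sq_le_sq_mul_sq Finset.univ
    (fun x => (((Finset.range N).filter fun m => b m = x).card : ℝ)) fun x => φ x ^ (s + 1)
  rw [sum_sq_card_fiber, ← sum_comp_eq_sum_card_mul N b fun x => φ x ^ (s + 1)] at h2
  rw [mul_comm 2 (s + 1), pow_mul, mul_comm 2 s, pow_mul]
  calc _ ≤ ((N : ℝ) ^ s * ∑ m ∈ Finset.range N, φ (b m) ^ (s + 1)) ^ 2 :=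
        pow_le_pow_left₀ (pow_nonneg (Finset.sum_nonneg fun m _ => hφ _) _) h1 2
    _ ≤ _ := by
        rw [mul_pow]
        refine mul_le_mul_of_nonneg_left ?_ (by positivity)
        simpa only [← pow_mul] using h2

theorem norm_sum_sub_sum_add_le {g : ℕ → ℂ} (hg : ∀ m, ‖g m‖ ≤ 1) (N j : ℕ) :
    ‖∑ m ∈ Finset.range N, g m - ∑ m ∈ Finset.range N, g (m + j)‖ ≤ 2 * j := by
  induction j with
  | zero => simp
  | succ j ih =>
    have h1 : ∑ m ∈ Finset.range N, g (m + j) - ∑ m ∈ Finset.range N, g (m + (j + 1)) =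
        g (0 + j) - g (N + j) := by
      rw [← Finset.sum_range_sub' fun m => g (m + j)]
      simp only [← Finset.sum_sub_distrib, add_assoc, add_comm 1 j]
    rw [← sub_add_sub_cancel _ (∑ m ∈ Finset.range N, g (m + j)), h1]
    refine (norm_add_le _ _).trans ?_
    have h2 := norm_sub_le (g (0 + j)) (g (N + j))
    have h3 := hg (0 + j)
    have h4 := hg (N + j)
    push_cast
    linarith

theorem mul_norm_sum_le {g : ℕ → ℂ} (hg : ∀ m, ‖g m‖ ≤ 1) (N H : ℕ) :
    H * ‖∑ m ∈ Finset.range N, g m‖ ≤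
      ∑ m ∈ Finset.range N, ‖∑ i ∈ Finset.range H, g (m + (i + 1))‖ + 2 * (H : ℝ) ^ 2 := by
  have h1 : (H : ℂ) * ∑ m ∈ Finset.range N, g m =
      ∑ m ∈ Finset.range N, ∑ i ∈ Finset.range H, g (m + (i + 1)) +
      ∑ i ∈ Finset.range H,
        (∑ m ∈ Finset.range N, g m - ∑ m ∈ Finset.range N, g (m + (i + 1))) := by
    rw [Finset.sum_comm, ← Finset.sum_add_distrib]
    simp
  have h2 : (H : ℝ) * ‖∑ m ∈ Finset.range N, g m‖ = ‖(H : ℂ) * ∑ m ∈ Finset.range N, g m‖ := by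
    rw [norm_mul, Complex.norm_natCast]
  rw [h2, h1]
  refine (norm_add_le _ _).trans (add_le_add (norm_sum_le _ _) ((norm_sum_le _ _).trans ?_))
  calc _ ≤ ∑ _i ∈ Finset.range H, 2 * (H : ℝ) := by
        refine Finset.sum_le_sum fun i hi => (norm_sum_sub_sum_add_le hg N (i + 1)).trans ?_
        have : ((i + 1 : ℕ) : ℝ) ≤ H := by exact_mod_cast Finset.mem_range.1 hi
        linarith
    _ = _ := by
        rw [Finset.sum_const, Finset.card_range, nsmul_eq_mul]
        ring

end grouping

section gridPoint

variable {n : ℕ} {M : Fin n → ℕ} [∀ j, NeZero (M j)] {f : ℕ → ℝ → ℝ}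

theorem exists_abs_sub_le_of_gridPoint_eq {x y : ℝ} (h : gridPoint M f x = gridPoint M f y)
    (j : Fin n) {i : ℕ} (hi : i = j + 1) :
    ∃ z : ℤ, |(f i y - f i x) / i.factorial - z| ≤ 1 / M j := by
  have h1 := congrFun h j
  simp only [gridPoint, ← hi] at h1
  rw [ZMod.intCast_eq_intCast_iff_dvd_sub] at h1
  obtain ⟨z, hz⟩ := h1
  refine ⟨z, ?_⟩
  have hM0 : (0 : ℝ) < M j := by exact_mod_cast Nat.pos_of_ne_zero (NeZero.ne (M j))
  have h2 := Int.floor_le (M j * (f i x / i.factorial))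
  have h3 := Int.lt_floor_add_one (M j * (f i x / i.factorial))
  have h4 := Int.floor_le (M j * (f i y / i.factorial))
  have h5 := Int.lt_floor_add_one (M j * (f i y / i.factorial))
  have h6 : (⌊M j * (f i y / i.factorial)⌋ : ℝ) - ⌊M j * (f i x / i.factorial)⌋ = M j * z := by
    exact_mod_cast hz
  have h7 : (f i y - f i x) / i.factorial - z =
      (M j * (f i y / i.factorial) - M j * (f i x / i.factorial) - M j * z) / M j := by
    field_simp
  rw [h7, abs_div, abs_of_pos hM0]
  refine div_le_div_of_nonneg_right ?_ hM0.le
  rw [abs_le]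
  constructor <;> linarith

/-- The grid points attached to a function with small derivative of order `n + 1` rarely
coincide. -/
theorem exists_card_gridPoint_eq_le {n : ℕ} (hn : 2 ≤ n) {L c ε : ℝ} (hL : 1 ≤ L) (hc : 0 < c)
    (hc1 : c ≤ 1) (hε : 0 < ε) :
    ∃ C : ℝ, 0 < C ∧ ∀ (N H : ℕ) (lam : ℝ) (f : ℕ → ℝ → ℝ) (M : Fin n → ℕ) [∀ j, NeZero (M j)],
      1 ≤ H → (∀ j : Fin n, 2 * H ^ (j + 1 : ℕ) ≤ M j) →
      c ≤ lam * H ^ (n + 1) → lam * H ^ (n + 1) ≤ 1 → L * lam * N ≤ 1 / 4 →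
      (∀ i ≤ n, ∀ x ∈ Set.Icc (0 : ℝ) N, HasDerivAt (f i) (f (i + 1) x) x) →
      (∀ x ∈ Set.Icc (0 : ℝ) N, lam ≤ f (n + 1) x ∧ f (n + 1) x ≤ L * lam) →
      (((Finset.range N ×ˢ Finset.range N).filter fun y =>
        gridPoint M f y.1 = gridPoint M f y.2).card : ℝ) ≤
      C * ((H : ℝ) ^ ε * (N + (H : ℝ) ^ 2)) := by
  obtain ⟨r, rfl⟩ : ∃ r, n = r + 2 := ⟨n - 2, by omega⟩
  set A : ℝ := ((r + 2).factorial : ℝ) with hA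
  set A' : ℝ := ((r + 1).factorial : ℝ) with hA'
  have hA1 : 1 ≤ A := Nat.one_le_cast.2 (Nat.factorial_pos _)
  have hA1' : 1 ≤ A' := Nat.one_le_cast.2 (Nat.factorial_pos _)
  set K : ℝ := A / c with hK
  have hK1 : 1 ≤ K := (one_le_div hc).2 (hc1.trans hA1)
  refine ⟨1 + 2 * (K * L * A' + K ^ 2 * L + 2 * A' / c * (1 + K ^ ε / ε) + 2 * K), by positivity,
    fun N H lam f M _ hH hM hcH hH1 hN hf hw => ?_⟩
  have hH' : (1 : ℝ) ≤ H := by exact_mod_cast hH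
  have hH0 : (0 : ℝ) < H := by linarith
  have hlam : 0 < lam := by
    by_contra h
    have : lam * (H : ℝ) ^ (r + 2 + 1) ≤ 0 := mul_nonpos_of_nonpos_of_nonneg (not_lt.1 h)
      (by positivity)
    linarith
  have hMj : ∀ j : Fin (r + 2), 1 / (M j : ℝ) ≤ 1 / (2 * (H : ℝ) ^ (j + 1 : ℕ)) := fun j => by
    have : 2 * (H : ℝ) ^ (j + 1 : ℕ) ≤ M j := by exact_mod_cast hM j
    exact one_div_le_one_div_of_le (by positivity) this
  have hpow : ∀ i : ℕ, (1 : ℝ) ≤ (H : ℝ) ^ i := fun i => one_le_pow₀ hH'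
  have main := card_pairs_near_le (r := fun m m' : ℕ => gridPoint M f m = gridPoint M f m')
    (η := 1 / (2 * (H : ℝ) ^ (r + 2))) (η' := 1 / (2 * (H : ℝ) ^ (r + 1))) (D := K * H)
    hL hlam hA1 hA1'
    (one_div_le_one_div_of_le two_pos (by linarith [hpow (r + 2)]))
    (by positivity) (one_le_mul_of_one_le_of_one_le hK1 hH') (by
      rw [hK, mul_one_div, div_le_iff₀ (by positivity)]
      have : A / c * H * lam * (2 * (H : ℝ) ^ (r + 2)) = A * (2 * (lam * H ^ (r + 2 + 1) / c)) := by
        field_simp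
        ring
      rw [this]
      have : 1 ≤ lam * H ^ (r + 2 + 1) / c := (one_le_div hc).2 hcH
      nlinarith)
    hN (hf (r + 1) (by omega)) (hf (r + 2) le_rfl) hw (fun m m' h => h.symm)
    (fun m m' h => by
      obtain ⟨z, hz⟩ := exists_abs_sub_le_of_gridPoint_eq h (Fin.last (r + 1)) (i := r + 2) rfl
      exact ⟨z, hz.trans (hMj _)⟩)
    (fun m m' h => by
      obtain ⟨z, hz⟩ := exists_abs_sub_le_of_gridPoint_eq h (Fin.last r).castSucc (i := r + 1) rfl
      exact ⟨z, hz.trans (hMj _)⟩)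
  refine (le_of_eq ?_).trans (main.trans ?_)
  · congr!
  set E : ℝ := (H : ℝ) ^ ε with hE
  have hE1 : 1 ≤ E := Real.one_le_rpow hH' hε.le
  have h1 : K * H * (2 * L * N * (1 / (2 * (H : ℝ) ^ (r + 1))) * A') ≤ K * L * A' * N := by
    have : K * H * (2 * L * N * (1 / (2 * (H : ℝ) ^ (r + 1))) * A') =
        K * L * A' * N / (H : ℝ) ^ r := by
      rw [pow_succ]
      field_simp
    rw [this]
    exact div_le_self (by positivity) (hpow r)
  have h2 : (K * H) ^ 2 * L * lam * N ≤ K ^ 2 * L * N := by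
    have h3 : lam * (H : ℝ) ^ 2 ≤ 1 := by
      refine le_trans ?_ hH1
      exact mul_le_mul_of_nonneg_left (pow_le_pow_right₀ hH' (by omega)) hlam.le
    calc (K * H) ^ 2 * L * lam * N = K ^ 2 * L * N * (lam * H ^ 2) := by ring
      _ ≤ K ^ 2 * L * N * 1 := by gcongr
      _ = _ := mul_one _
  have h3 : 4 * (1 / (2 * (H : ℝ) ^ (r + 1))) * A' / lam ≤ 2 * A' / c * (H : ℝ) ^ 2 := by
    rw [div_le_iff₀ hlam]
    have : 2 * A' / c * (H : ℝ) ^ 2 * lam =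
        4 * (1 / (2 * (H : ℝ) ^ (r + 1))) * A' * (lam * H ^ (r + 2 + 1) / c) := by
      have : (H : ℝ) ^ (r + 2 + 1) = (H : ℝ) ^ (r + 1) * (H : ℝ) ^ 2 := by rw [← pow_add]
      rw [this]
      field_simp
      ring
    rw [this]
    exact le_mul_of_one_le_right (by positivity) ((one_le_div hc).2 hcH)
  have h4 : 1 + Real.log (K * H) ≤ (1 + K ^ ε / ε) * E := by
    have := Real.log_le_rpow_div (x := K * H) (by positivity) hε
    rw [Real.mul_rpow (by positivity) (by positivity), ← hE] at this
    have h5 : (1 + K ^ ε / ε) * E = E + K ^ ε * E / ε := by ring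
    rw [h5]
    linarith
  have h5 : 0 ≤ 1 + Real.log (K * H) := by
    have := Real.log_nonneg (one_le_mul_of_one_le_of_one_le hK1 hH')
    linarith
  have h6 : 4 * (1 / (2 * (H : ℝ) ^ (r + 1))) * A' / lam * (1 + Real.log (K * H)) ≤
      2 * A' / c * (H : ℝ) ^ 2 * ((1 + K ^ ε / ε) * E) :=
    mul_le_mul h3 h4 h5 (by positivity)
  have h7 : (H : ℝ) ≤ (H : ℝ) ^ 2 := by
    rw [pow_two]
    exact le_mul_of_one_le_left hH0.le hH'
  have h8 : K * H ≤ K * (H : ℝ) ^ 2 := by gcongr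
  have hN0 : (0 : ℝ) ≤ N := Nat.cast_nonneg N
  have hQ : (N : ℝ) + (H : ℝ) ^ 2 ≤ E * (N + (H : ℝ) ^ 2) :=
    le_mul_of_one_le_left (by positivity) hE1
  have hNE : (N : ℝ) ≤ E * (N + (H : ℝ) ^ 2) := by linarith [hpow 2]
  have hHE : (H : ℝ) ^ 2 ≤ E * (N + (H : ℝ) ^ 2) := by linarith
  have hHE' : (H : ℝ) ^ 2 * E ≤ E * (N + (H : ℝ) ^ 2) := by
    rw [mul_comm]
    exact mul_le_mul_of_nonneg_left (by linarith) (by linarith)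
  set Q := E * (N + (H : ℝ) ^ 2)
  have k1 : K * L * A' * N ≤ K * L * A' * Q := by gcongr
  have k2 : K ^ 2 * L * N ≤ K ^ 2 * L * Q := by gcongr
  have k3 : 2 * A' / c * (1 + K ^ ε / ε) * ((H : ℝ) ^ 2 * E) ≤
      2 * A' / c * (1 + K ^ ε / ε) * Q := by
    gcongr
  have k4 : K * (H : ℝ) ^ 2 ≤ K * Q := by gcongr
  linarith

end gridPoint

theorem le_of_pow_two_mul_le {T N H K E : ℝ} {s : ℕ} (hN : 0 ≤ N) (hH : 0 ≤ H)
    (hK : 1 ≤ K) (hE : 1 ≤ E)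
    (h : T ^ (2 * (s + 1)) ≤ N ^ (2 * s) * (K * (E ^ 2 * (N + H ^ 2) * H ^ (2 * (s + 1))))) :
    T ≤ K * (E * H * (N ^ (1 - 1 / ((s : ℝ) + 1)) *
      (N ^ (1 / (2 * ((s : ℝ) + 1))) + H ^ (1 / ((s : ℝ) + 1))))) := by
  have hs : (0 : ℝ) < (s : ℝ) + 1 := by positivity
  have hs0 : s + 1 ≠ 0 := by omega
  refine le_of_pow_le_pow_left₀ (n := 2 * (s + 1)) (by omega) (by positivity) (h.trans ?_)
  have h1 : (N ^ (1 - 1 / ((s : ℝ) + 1))) ^ (2 * (s + 1)) = N ^ (2 * s) := by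
    rw [← Real.rpow_natCast, ← Real.rpow_mul hN, ← Real.rpow_natCast]
    congr 1
    push_cast
    field_simp
    ring
  have h2 : (N ^ (1 / (2 * ((s : ℝ) + 1)))) ^ (2 * (s + 1)) = N := by
    rw [← Real.rpow_natCast, ← Real.rpow_mul hN]
    convert Real.rpow_one N using 2
    push_cast
    field_simp
  have h3 : (H ^ (1 / ((s : ℝ) + 1))) ^ (2 * (s + 1)) = H ^ 2 := by
    rw [← Real.rpow_natCast, ← Real.rpow_mul hH, ← Real.rpow_natCast]
    congr 1
    push_cast
    field_simp
  have h4 : N + H ^ 2 ≤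
      (N ^ (1 / (2 * ((s : ℝ) + 1))) + H ^ (1 / ((s : ℝ) + 1))) ^ (2 * (s + 1)) := by
    have := pow_add_pow_le (x := N ^ (1 / (2 * ((s : ℝ) + 1)))) (y := H ^ (1 / ((s : ℝ) + 1)))
      (by positivity) (by positivity) (n := 2 * (s + 1)) (by omega)
    rwa [h2, h3] at this
  have h5 : K ≤ K ^ (2 * (s + 1)) := le_self_pow₀ hK (by omega)
  have h6 : E ^ 2 ≤ E ^ (2 * (s + 1)) := pow_le_pow_right₀ hE (by omega)
  simp only [mul_pow]
  rw [h1]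
  calc N ^ (2 * s) * (K * (E ^ 2 * (N + H ^ 2) * H ^ (2 * (s + 1))))
      = K * (E ^ 2 * H ^ (2 * (s + 1)) * (N ^ (2 * s) * (N + H ^ 2))) := by ring
    _ ≤ _ := by gcongr

/-- Estimate for a Weyl sum over a block on which the derivative of order `n` varies little. -/
theorem exists_norm_sum_block_le {n : ℕ} (hn : 2 ≤ n) {L c ε : ℝ} (hL : 1 ≤ L) (hc : 0 < c)
    (hc1 : c ≤ 1) (hε : 0 < ε) :
    ∃ C : ℝ, 0 < C ∧ ∀ (N H : ℕ) (lam : ℝ) (f : ℕ → ℝ → ℝ), 1 ≤ H → H ≤ N →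
      c ≤ lam * H ^ (n + 1) → lam * H ^ (n + 1) ≤ 1 → L * lam * N ≤ 1 / 4 →
      (∀ i ≤ n, ∀ x ∈ Set.Icc (0 : ℝ) (2 * N), HasDerivAt (f i) (f (i + 1) x) x) →
      (∀ x ∈ Set.Icc (0 : ℝ) (2 * N), lam ≤ f (n + 1) x ∧ f (n + 1) x ≤ L * lam) →
      ‖∑ m ∈ Finset.range N, e (f 0 m)‖ ≤ C * ((H : ℝ) ^ ε * ((N : ℝ) ^ (1 - 1 / (tri n : ℝ)) *
        ((N : ℝ) ^ (1 / (2 * (tri n : ℝ))) + (H : ℝ) ^ (1 / (tri n : ℝ))))) := by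
  obtain ⟨C₁, hC₁, hcount⟩ := exists_card_gridPoint_eq_le hn hL hc hc1 hε
  obtain ⟨C₂, hC₂, hmom⟩ := exists_moment_le n (by omega) hε
  obtain ⟨s, hs⟩ := Nat.exists_eq_add_of_le' (tri_pos (n := n) (by omega))
  set K : ℝ := max 1 (C₁ * C₂) with hK
  set P : ℝ := 2 * Real.pi * (L + n ^ 2) with hP
  have hP0 : 0 ≤ P := by positivity
  refine ⟨K * (1 + P) + 2, by positivity, fun N H lam f hH hHN hcH hH1 hN hf hw => ?_⟩
  have hH' : (1 : ℝ) ≤ H := by exact_mod_cast hH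
  have hHN' : (H : ℝ) ≤ N := by exact_mod_cast hHN
  have hH0 : (0 : ℝ) < H := by linarith
  have hN0 : (0 : ℝ) < N := by linarith
  set E : ℝ := (H : ℝ) ^ ε with hE
  have hE1 : 1 ≤ E := Real.one_le_rpow hH' hε.le
  set Q : ℝ := (N : ℝ) ^ (1 - 1 / (tri n : ℝ)) *
        ((N : ℝ) ^ (1 / (2 * (tri n : ℝ))) + (H : ℝ) ^ (1 / (tri n : ℝ))) with hQ
  set M : Fin n → ℕ := fun j => 2 * tri n * H ^ (j + 1 : ℕ) + 1 with hM
  have hM2 : ∀ j : Fin n, 2 * H ^ (j + 1 : ℕ) ≤ M j := fun j => by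
    have : 2 * H ^ (j + 1 : ℕ) ≤ 2 * tri n * H ^ (j + 1 : ℕ) :=
      Nat.mul_le_mul_right _ (by omega)
    simp only [hM]
    omega
  set φ : ℕ → (∀ j, ZMod (M j)) → ℝ := fun h b => ‖∑ x ∈ Finset.Icc (1 : ℤ) h, weylPhase M x b‖
  have hsub : Set.Icc (0 : ℝ) N ⊆ Set.Icc (0 : ℝ) (2 * N) :=
    Set.Icc_subset_Icc_right (by linarith)
  have hcard := hcount N H lam f M hH hM2 hcH hH1 hN (fun i hi x hx => hf i hi x (hsub hx))
    fun x hx => hw x (hsub hx)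
  have hT : ∀ h ≤ H, ∑ m ∈ Finset.range N, φ h (gridPoint M f m) ≤ K * (E * H * Q) := by
    intro h hh
    have h1 := pow_sum_comp_le N s (fun m : ℕ => gridPoint M f m) (φ := φ h)
      (fun b => norm_nonneg _)
    have h2 := hmom H h hH hh
    have h3 : (((Finset.range N ×ˢ Finset.range N).filter fun y =>
        gridPoint M f y.1 = gridPoint M f y.2).card : ℝ) * ∑ b, φ h b ^ (2 * (s + 1)) ≤
        C₁ * (E * (N + (H : ℝ) ^ 2)) * (C₂ * ((H : ℝ) ^ (2 * (s + 1)) * E)) := by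
      rw [← hs]
      exact mul_le_mul hcard h2 (by positivity) (by positivity)
    have h4 := le_of_pow_two_mul_le (N := N) (H := H) (K := K) (E := E) (s := s)
      (T := ∑ m ∈ Finset.range N, φ h (gridPoint M f m)) hN0.le hH0.le (le_max_left _ _) hE1 (by
        refine h1.trans (mul_le_mul_of_nonneg_left ?_ (by positivity))
        refine le_trans (le_trans (le_of_eq ?_) h3) ?_
        · congr!
        · calc _ = C₁ * C₂ * (E ^ 2 * (N + (H : ℝ) ^ 2) * (H : ℝ) ^ (2 * (s + 1))) := by ring
            _ ≤ _ := mul_le_mul_of_nonneg_right (le_max_right _ _) (by positivity))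
    rw [hQ, hs]
    push_cast
    exact h4
  have hU : ∑ m ∈ Finset.range N, ‖∑ i ∈ Finset.range H, e (f 0 (m + (i + 1) : ℕ))‖ ≤
      (1 + P) * (K * (E * H * Q)) := by
    calc _ ≤ ∑ m ∈ Finset.range N, (φ H (gridPoint M f m) + P / H *
          ∑ h ∈ Finset.range (H - 1), φ (h + 1) (gridPoint M f m)) := by
          refine Finset.sum_le_sum fun m hm => ?_
          have hm' : (m : ℝ) ≤ N := by exact_mod_cast (Finset.mem_range.1 hm).le
          have hm0 : (0 : ℝ) ≤ m := by positivity
          have hs' : Set.Icc (m : ℝ) (m + H) ⊆ Set.Icc (0 : ℝ) (2 * N) :=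
            Set.Icc_subset_Icc hm0 (by linarith)
          have hlam : 0 ≤ lam := (mul_nonneg_iff_of_pos_right (by positivity)).1 (hc.le.trans hcH)
          have := norm_sum_e_le_sum_weylPhase (M := M) (f := f) (x₀ := m) (lam := lam) (L := L) hH
            (fun j => (Nat.le_mul_of_pos_left _ two_pos).trans (hM2 j))
            (fun i hi x hx => hf i hi x (hs' hx)) (fun x hx => by
              have := hw x (hs' hx)
              rw [abs_of_nonneg (hlam.trans this.1)]
              exact this.2) hH1 (by linarith)
          rw [← mul_div_assoc] at this
          have hcast : ∀ i : ℕ, ((m + (i + 1) : ℕ) : ℝ) = m + (i + 1 : ℕ) := fun i =>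
            Nat.cast_add _ _
          simp only [hcast]
          exact this
      _ = ∑ m ∈ Finset.range N, φ H (gridPoint M f m) + P / H *
          ∑ h ∈ Finset.range (H - 1), ∑ m ∈ Finset.range N, φ (h + 1) (gridPoint M f m) := by
          rw [Finset.sum_add_distrib, ← Finset.mul_sum, Finset.sum_comm]
      _ ≤ K * (E * H * Q) + P / H * (H * (K * (E * H * Q))) := by
          refine add_le_add (hT H le_rfl) (mul_le_mul_of_nonneg_left ?_ (by positivity))
          calc _ ≤ ∑ _h ∈ Finset.range (H - 1), K * (E * H * Q) :=
                Finset.sum_le_sum fun h hh => hT (h + 1) (by have := Finset.mem_range.1 hh; omega)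
            _ ≤ _ := by
                rw [Finset.sum_const, Finset.card_range, nsmul_eq_mul]
                refine mul_le_mul_of_nonneg_right ?_ (by positivity)
                exact_mod_cast Nat.sub_le H 1
      _ = _ := by
          field_simp
  have hHQ : (H : ℝ) ≤ E * Q := by
    have hs1 : (1 : ℝ) ≤ tri n := by exact_mod_cast tri_pos (n := n) (by omega)
    have h1 : (H : ℝ) = (H : ℝ) ^ (1 - 1 / (tri n : ℝ)) * (H : ℝ) ^ (1 / (tri n : ℝ)) := by
      rw [← Real.rpow_add hH0, sub_add_cancel, Real.rpow_one]
    have h2 : (H : ℝ) ^ (1 - 1 / (tri n : ℝ)) ≤ (N : ℝ) ^ (1 - 1 / (tri n : ℝ)) :=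
      Real.rpow_le_rpow hH0.le hHN' (by
        rw [sub_nonneg, div_le_one (by linarith)]
        exact hs1)
    calc (H : ℝ) = _ := h1
      _ ≤ (N : ℝ) ^ (1 - 1 / (tri n : ℝ)) *
          ((N : ℝ) ^ (1 / (2 * (tri n : ℝ))) + (H : ℝ) ^ (1 / (tri n : ℝ))) := by
          refine mul_le_mul h2 ?_ (by positivity) (by positivity)
          have : 0 ≤ (N : ℝ) ^ (1 / (2 * (tri n : ℝ))) := by positivity
          linarith
      _ ≤ _ := le_mul_of_one_le_left (by positivity) hE1
  have hfin := mul_norm_sum_le (g := fun m : ℕ => e (f 0 m)) (fun m => (norm_e _).le) N H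
  refine le_of_mul_le_mul_left ?_ hH0
  calc _ ≤ _ := hfin
    _ ≤ (1 + P) * (K * (E * H * Q)) + 2 * (H * (E * Q)) := by
        refine add_le_add hU ?_
        rw [pow_two]
        gcongr
    _ = _ := by ring

theorem norm_sum_range_le_of_blocks {g : ℕ → ℂ} {M : ℕ} {B : ℝ} (q : ℕ) :
    ∀ N : ℕ, N ≤ q * M →
      (∀ a b : ℕ, a + b ≤ N → b ≤ M → ‖∑ i ∈ Finset.range b, g (a + i)‖ ≤ B) →
      ‖∑ i ∈ Finset.range N, g i‖ ≤ q * B := by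
  induction q with
  | zero =>
    intro N hN _
    have : N = 0 := by omega
    simp [this]
  | succ q ih =>
    intro N hN h
    have hB : 0 ≤ B := by simpa using h 0 0 (by omega) (by omega)
    push_cast
    rcases le_total N (q * M) with h1 | h1
    · linarith [ih N h1 h]
    · obtain ⟨b, rfl⟩ := Nat.exists_eq_add_of_le h1
      rw [add_mul, one_mul] at hN
      rw [Finset.sum_range_add]
      have h2 := ih (q * M) le_rfl fun a b' hab => h a b' (by omega)
      have h3 := h (q * M) b le_rfl (by omega)
      refine (norm_add_le _ _).trans ?_
      linarith

/-- The block estimate with the optimal length of the short sums. -/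
theorem exists_norm_sum_short_le {n : ℕ} (hn : 2 ≤ n) {L ε : ℝ} (hL : 1 ≤ L) (hε : 0 < ε) :
    ∃ C : ℝ, 0 < C ∧ ∀ (N : ℕ) (lam : ℝ) (f : ℕ → ℝ → ℝ), 0 < lam → lam ≤ 1 →
      L * lam * N ≤ 1 / 4 →
      (∀ i ≤ n, ∀ x ∈ Set.Icc (0 : ℝ) (2 * N), HasDerivAt (f i) (f (i + 1) x) x) →
      (∀ x ∈ Set.Icc (0 : ℝ) (2 * N), lam ≤ f (n + 1) x ∧ f (n + 1) x ≤ L * lam) →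
      ‖∑ m ∈ Finset.range N, e (f 0 m)‖ ≤ C * (lam ^ (-ε) *
        ((N : ℝ) ^ (1 - 1 / (2 * (tri n : ℝ))) +
          (N : ℝ) ^ (1 - 1 / (tri n : ℝ)) * lam ^ (-(1 / (((n : ℝ) + 1) * tri n))))) := by
  obtain ⟨C, hC, h⟩ := exists_norm_sum_block_le hn hL (c := (1 / 2) ^ (n + 1)) (by positivity)
    (pow_le_one₀ (by norm_num) (by norm_num)) hε
  refine ⟨C + 1, by positivity, fun N lam f hlam hlam1 hN hf hw => ?_⟩
  rcases N.eq_zero_or_pos with rfl | hNpos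
  · simp only [Finset.range_zero, Finset.sum_empty, norm_zero]
    positivity
  have hN1 : (1 : ℝ) ≤ N := by exact_mod_cast hNpos
  have hN0 : (0 : ℝ) < N := by linarith
  have hs1 : (1 : ℝ) ≤ tri n := by exact_mod_cast tri_pos (n := n) (by omega)
  set s : ℝ := (tri n : ℝ) with hs
  have hs0 : 0 < s := by linarith
  set x : ℝ := lam ^ (-(1 / ((n : ℝ) + 1))) with hx
  have hx1 : 1 ≤ x := Real.one_le_rpow_of_pos_of_le_one_of_nonpos hlam hlam1 (by
    rw [neg_nonpos]
    positivity)
  have hxpow : x ^ (n + 1) = lam⁻¹ := by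
    rw [hx, ← Real.rpow_natCast, ← Real.rpow_mul hlam.le, ← Real.rpow_neg_one]
    congr 1
    push_cast
    field_simp
  set H : ℕ := ⌊x⌋₊ with hH
  have hH1 : 1 ≤ H := Nat.le_floor (by exact_mod_cast hx1)
  have hH1' : (1 : ℝ) ≤ H := by exact_mod_cast hH1
  have hHx : (H : ℝ) ≤ x := Nat.floor_le (by linarith)
  have hxH : x ≤ 2 * H := by
    have := Nat.lt_floor_add_one x
    linarith
  have hE : (H : ℝ) ^ ε ≤ lam ^ (-ε) := by
    refine (Real.rpow_le_rpow (by positivity) hHx hε.le).trans ?_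
    rw [hx, ← Real.rpow_mul hlam.le]
    refine Real.rpow_le_rpow_of_exponent_ge hlam hlam1 ?_
    have : 1 / ((n : ℝ) + 1) ≤ 1 := by
      rw [div_le_one (by positivity)]
      have : (0 : ℝ) ≤ n := by positivity
      linarith
    nlinarith
  have hHs : (H : ℝ) ^ (1 / s) ≤ lam ^ (-(1 / (((n : ℝ) + 1) * s))) := by
    refine (Real.rpow_le_rpow (by positivity) hHx (by positivity)).trans (le_of_eq ?_)
    rw [hx, ← Real.rpow_mul hlam.le]
    congr 1
    field_simp
  have hE1 : 1 ≤ lam ^ (-ε) :=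
    Real.one_le_rpow_of_pos_of_le_one_of_nonpos hlam hlam1 (by linarith)
  set Y : ℝ := lam ^ (-(1 / (((n : ℝ) + 1) * s))) with hY
  have hY0 : 0 ≤ Y := by positivity
  rcases le_or_gt H N with hHN | hHN
  · have h1 := h N H lam f hH1 hHN (by
      have h2 : lam⁻¹ ≤ (2 * H : ℝ) ^ (n + 1) := by
        rw [← hxpow]
        exact pow_le_pow_left₀ (by linarith) hxH _
      rw [mul_pow, inv_le_iff_one_le_mul₀ hlam] at h2
      rw [div_pow, one_pow, div_le_iff₀ (by positivity)]
      linarith) (by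
      have h2 : (H : ℝ) ^ (n + 1) ≤ lam⁻¹ := by
        rw [← hxpow]
        exact pow_le_pow_left₀ (by positivity) hHx _
      rw [mul_comm]
      exact (le_inv_mul_iff₀ hlam).1 (by simpa using h2) |>.trans_eq' (mul_comm _ _)) hN hf hw
    refine h1.trans ?_
    have h3 : (N : ℝ) ^ (1 - 1 / s) * ((N : ℝ) ^ (1 / (2 * s)) + (H : ℝ) ^ (1 / s)) ≤
        (N : ℝ) ^ (1 - 1 / (2 * s)) + (N : ℝ) ^ (1 - 1 / s) * Y := by
      rw [mul_add, ← Real.rpow_add hN0]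
      refine add_le_add (le_of_eq ?_) (mul_le_mul_of_nonneg_left hHs (by positivity))
      congr 1
      field_simp
      ring
    have h4 : (H : ℝ) ^ ε *
        ((N : ℝ) ^ (1 - 1 / s) * ((N : ℝ) ^ (1 / (2 * s)) + (H : ℝ) ^ (1 / s))) ≤
        lam ^ (-ε) * ((N : ℝ) ^ (1 - 1 / (2 * s)) + (N : ℝ) ^ (1 - 1 / s) * Y) := by
      gcongr
    exact mul_le_mul (by linarith) h4 (by positivity) (by positivity)
  · have hNH : (N : ℝ) ≤ H := by exact_mod_cast hHN.le
    have h1 : ‖∑ m ∈ Finset.range N, e (f 0 m)‖ ≤ N :=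
      (norm_sum_le _ _).trans (by simp [norm_e])
    have h2 : (N : ℝ) ≤ (N : ℝ) ^ (1 - 1 / s) * Y := by
      calc (N : ℝ) = (N : ℝ) ^ (1 - 1 / s) * (N : ℝ) ^ (1 / s) := by
            rw [← Real.rpow_add hN0, sub_add_cancel, Real.rpow_one]
        _ ≤ (N : ℝ) ^ (1 - 1 / s) * Y := by
            refine mul_le_mul_of_nonneg_left (le_trans ?_ hHs) (by positivity)
            exact Real.rpow_le_rpow hN0.le hNH (by positivity)
    have h3 : (0 : ℝ) ≤ (N : ℝ) ^ (1 - 1 / (2 * s)) := by positivity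
    refine h1.trans ((show (N : ℝ) ≤ (N : ℝ) ^ (1 - 1 / (2 * s)) + (N : ℝ) ^ (1 - 1 / s) * Y by
      linarith).trans ?_)
    refine (le_mul_of_one_le_left (by positivity) hE1).trans ?_
    exact le_mul_of_one_le_left (by positivity) (by linarith)

/-- Heath-Brown's derivative test of order `n + 1`. -/
theorem exists_norm_sum_le {n : ℕ} (hn : 2 ≤ n) {L ε : ℝ} (hL : 1 ≤ L) (hε : 0 < ε) :
    ∃ C : ℝ, 0 < C ∧ ∀ (N : ℕ) (lam : ℝ) (f : ℕ → ℝ → ℝ), 0 < lam →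
      (∀ i ≤ n, ∀ x ∈ Set.Icc (0 : ℝ) (2 * N), HasDerivAt (f i) (f (i + 1) x) x) →
      (∀ x ∈ Set.Icc (0 : ℝ) (2 * N), lam ≤ f (n + 1) x ∧ f (n + 1) x ≤ L * lam) →
      ‖∑ m ∈ Finset.range N, e (f 0 m)‖ ≤ C * ((1 + lam ^ (-ε)) *
        (N * lam ^ (1 / (2 * (tri n : ℝ))) + (N : ℝ) ^ (1 - 1 / (2 * (tri n : ℝ))) +
          (N : ℝ) ^ (1 - 1 / (tri n : ℝ)) * lam ^ (-(1 / (((n : ℝ) + 1) * tri n))))) := by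
  obtain ⟨C, hC, h⟩ := exists_norm_sum_short_le hn hL hε
  refine ⟨32 * L * C + 4 * L, by positivity, fun N lam f hlam hf hw => ?_⟩
  have hs1 : (1 : ℝ) ≤ tri n := by exact_mod_cast tri_pos (n := n) (by omega)
  set s : ℝ := (tri n : ℝ) with hs
  have hs0 : 0 < s := by linarith
  have hN0 : (0 : ℝ) ≤ N := by positivity
  set Y : ℝ := lam ^ (-(1 / (((n : ℝ) + 1) * s))) with hY
  have hY0 : 0 ≤ Y := by positivity
  set E : ℝ := lam ^ (-ε) with hE
  have hE0 : 0 ≤ E := by positivity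
  have t1 : 0 ≤ N * lam ^ (1 / (2 * s)) := by positivity
  have t2 : 0 ≤ (N : ℝ) ^ (1 - 1 / (2 * s)) := by positivity
  have t3 : 0 ≤ (N : ℝ) ^ (1 - 1 / s) * Y := by positivity
  set Q := N * lam ^ (1 / (2 * s)) + (N : ℝ) ^ (1 - 1 / (2 * s)) + (N : ℝ) ^ (1 - 1 / s) * Y with hQ
  have hQ0 : 0 ≤ Q := by positivity
  have hLC : 0 ≤ L * C := by positivity
  have hCL : C ≤ L * C := le_mul_of_one_le_left hC.le hL
  rcases lt_or_ge 1 (4 * L * lam) with h1 | h1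
  · have h2 : ‖∑ m ∈ Finset.range N, e (f 0 m)‖ ≤ N :=
      (norm_sum_le _ _).trans (by simp [norm_e])
    have h3 : 1 ≤ 4 * L * lam ^ (1 / (2 * s)) := by
      calc (1 : ℝ) ≤ (4 * L * lam) ^ (1 / (2 * s)) := Real.one_le_rpow h1.le (by positivity)
        _ = (4 * L) ^ (1 / (2 * s)) * lam ^ (1 / (2 * s)) :=
            Real.mul_rpow (by positivity) hlam.le
        _ ≤ 4 * L * lam ^ (1 / (2 * s)) := by
            refine mul_le_mul_of_nonneg_right ?_ (by positivity)
            refine Real.rpow_le_self_of_one_le (by linarith) ?_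
            rw [div_le_one (by positivity)]
            linarith
    calc ‖∑ m ∈ Finset.range N, e (f 0 m)‖ ≤ N := h2
      _ ≤ N * (4 * L * lam ^ (1 / (2 * s))) := le_mul_of_one_le_right hN0 h3
      _ = 4 * L * (1 * (N * lam ^ (1 / (2 * s)))) := by ring
      _ ≤ (32 * L * C + 4 * L) * ((1 + E) * Q) := by
          gcongr
          · linarith
          · linarith
          · linarith
  · have hlam1 : lam ≤ 1 := by nlinarith
    set M : ℕ := ⌊1 / (4 * L * lam)⌋₊ with hM
    have hx1 : 1 ≤ 1 / (4 * L * lam) := (one_le_div (by positivity)).2 h1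
    have hM1 : 1 ≤ M := Nat.le_floor (by exact_mod_cast hx1)
    have hM1' : (1 : ℝ) ≤ M := by exact_mod_cast hM1
    have hM0 : (0 : ℝ) < M := by linarith
    have hMx : (M : ℝ) ≤ 1 / (4 * L * lam) := Nat.floor_le (by linarith)
    have hxM : 1 / (4 * L * lam) ≤ 2 * M := by
      have := Nat.lt_floor_add_one (1 / (4 * L * lam))
      linarith
    rw [le_div_iff₀ (by positivity)] at hMx
    rw [div_le_iff₀ (by positivity)] at hxM
    set F : ℕ → ℝ := fun b => C * (E * ((b : ℝ) ^ (1 - 1 / (2 * s)) + (b : ℝ) ^ (1 - 1 / s) * Y))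
      with hF
    have hblock : ∀ a b : ℕ, a + b ≤ N → b ≤ M →
        ‖∑ i ∈ Finset.range b, e (f 0 (a + i : ℕ))‖ ≤ F b := by
      intro a b hab hb
      have hab' : (a : ℝ) + b ≤ N := by exact_mod_cast hab
      have hb' : (b : ℝ) ≤ M := by exact_mod_cast hb
      have ha0 : (0 : ℝ) ≤ a := by positivity
      have hmem : ∀ x ∈ Set.Icc (0 : ℝ) (2 * b), (a : ℝ) + x ∈ Set.Icc (0 : ℝ) (2 * N) :=
        fun x hx => ⟨by linarith [hx.1], by linarith [hx.2]⟩
      have := h b lam (fun i x => f i (a + x)) hlam hlam1 (by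
        have : L * lam * b ≤ L * lam * M := by gcongr
        linarith) (fun i hi x hx => (hf i hi _ (hmem x hx)).comp_const_add (a : ℝ) x)
        fun x hx => hw _ (hmem x hx)
      simpa only [Nat.cast_add] using this
    have hexp1 : 0 ≤ 1 - 1 / (2 * s) := by
      rw [sub_nonneg, div_le_one (by positivity)]
      linarith
    have hexp2 : 0 ≤ 1 - 1 / s := by
      rw [sub_nonneg, div_le_one (by positivity)]
      linarith
    rcases le_or_gt N M with hNM | hNM
    · have h2 := hblock 0 N (by omega) hNM
      simp only [zero_add] at h2
      refine h2.trans ?_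
      rw [hF]
      simp only
      gcongr
      · nlinarith
      · linarith
      · linarith
    · have hmono : ∀ b ≤ M, F b ≤ F M := fun b hb => by
        have hb' : (b : ℝ) ≤ M := by exact_mod_cast hb
        simp only [hF]
        gcongr
      have h2 := norm_sum_range_le_of_blocks (g := fun m : ℕ => e (f 0 m)) (M := M) (B := F M)
        (N / M + 1) N (by
          rw [add_mul, one_mul]
          have := Nat.div_add_mod N M
          have := Nat.mod_lt N (show M > 0 from hM1)
          have : M * (N / M) = N / M * M := mul_comm _ _
          omega) fun a b hab hb => (hblock a b hab hb).trans (hmono b hb)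
      have hcount : ((N / M + 1 : ℕ) : ℝ) ≤ 16 * L * lam * N := by
        have h3 : ((N / M : ℕ) : ℝ) ≤ N / M := Nat.cast_div_le
        have h4 : (M : ℝ) ≤ N := by exact_mod_cast hNM.le
        have h5 : 1 ≤ (N : ℝ) / M := (one_le_div hM0).2 h4
        have h6 : (N : ℝ) / M ≤ 8 * L * lam * N := by
          rw [div_le_iff₀ hM0]
          nlinarith
        push_cast
        linarith
      have hMlam : (M : ℝ) ≤ lam⁻¹ := by
        rw [← one_div, le_div_iff₀ hlam]
        nlinarith
      have hFM : F M ≤ 2 * C * (E * (lam ^ (1 / (2 * s)) * lam⁻¹)) := by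
        have h3 : (M : ℝ) ^ (1 - 1 / (2 * s)) ≤ lam ^ (1 / (2 * s)) * lam⁻¹ := by
          refine (Real.rpow_le_rpow hM0.le hMlam hexp1).trans (le_of_eq ?_)
          rw [← Real.rpow_neg_one, ← Real.rpow_mul hlam.le, ← Real.rpow_add hlam]
          congr 1
          ring
        have h4 : (M : ℝ) ^ (1 - 1 / s) * Y ≤ lam ^ (1 / (2 * s)) * lam⁻¹ := by
          calc (M : ℝ) ^ (1 - 1 / s) * Y ≤ (lam⁻¹) ^ (1 - 1 / s) * Y := by gcongr
            _ = lam ^ ((-1) * (1 - 1 / s) + -(1 / (((n : ℝ) + 1) * s))) := by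
                rw [← Real.rpow_neg_one, ← Real.rpow_mul hlam.le, ← Real.rpow_add hlam]
            _ ≤ lam ^ (1 / (2 * s) + (-1)) := by
                refine Real.rpow_le_rpow_of_exponent_ge hlam hlam1 ?_
                have h5 : 1 / (((n : ℝ) + 1) * s) ≤ 1 / (2 * s) := by
                  refine one_div_le_one_div_of_le (by positivity)
                    (mul_le_mul_of_nonneg_right ?_ hs0.le)
                  have : (2 : ℝ) ≤ n := by exact_mod_cast hn
                  linarith
                have h6 : 1 / s = 1 / (2 * s) + 1 / (2 * s) := by
                  field_simp
                  norm_num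
                linarith
            _ = _ := by rw [Real.rpow_add hlam, Real.rpow_neg_one]
        calc F M ≤ C * (E * (lam ^ (1 / (2 * s)) * lam⁻¹ + lam ^ (1 / (2 * s)) * lam⁻¹)) := by
              simp only [hF]
              gcongr
          _ = _ := by ring
      have hFM0 : 0 ≤ F M := by
        simp only [hF]
        positivity
      calc _ ≤ ((N / M + 1 : ℕ) : ℝ) * F M := h2
        _ ≤ 16 * L * lam * N * (2 * C * (E * (lam ^ (1 / (2 * s)) * lam⁻¹))) := by gcongr
        _ = 32 * L * C * (E * (N * lam ^ (1 / (2 * s)))) := by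
            field_simp
            ring
        _ ≤ (32 * L * C + 4 * L) * ((1 + E) * Q) := by
            gcongr
            · linarith
            · linarith
            · linarith

theorem norm_sum_e_neg {ι : Type*} (S : Finset ι) (g : ι → ℝ) :
    ‖∑ i ∈ S, e (-g i)‖ = ‖∑ i ∈ S, e (g i)‖ := by
  have hconj : ∀ x, e (-x) = (starRingEnd ℂ) (e x) := fun x => by
    rw [e_neg, Complex.inv_eq_conj (norm_e x)]
  simp_rw [hconj, ← map_sum, Complex.norm_conj]

theorem min_le_rpow_of_mem_Icc {t c : ℝ} (ht : t ∈ Set.Icc 1 c) (b : ℝ) :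
    min 1 (c ^ b) ≤ t ^ b ∧ t ^ b ≤ max 1 (c ^ b) := by
  have ht0 : 0 < t := one_pos.trans_le ht.1
  rcases le_total 0 b with hb | hb
  · exact ⟨min_le_of_left_le (Real.one_le_rpow ht.1 hb),
      le_max_of_le_right (Real.rpow_le_rpow ht0.le ht.2 hb)⟩
  · exact ⟨min_le_of_right_le (Real.rpow_le_rpow_of_nonpos ht0 ht.2 hb),
      le_max_of_le_left (Real.rpow_le_one_of_one_le_of_nonpos ht.1 hb)⟩

/-- The coefficient of the `i`-th derivative of `x ↦ x ^ α`. -/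
def rpowDerivCoeff (α : ℝ) (i : ℕ) : ℝ := ∏ j ∈ Finset.range i, (α - j)

theorem rpowDerivCoeff_ne_zero {α : ℝ} (hα : ∀ n : ℤ, α ≠ n) (i : ℕ) :
    rpowDerivCoeff α i ≠ 0 :=
  Finset.prod_ne_zero_iff.2 fun j _ => sub_ne_zero.2 (by exact_mod_cast hα j)

theorem hasDerivAt_rpowDerivCoeff_mul {α y x : ℝ} (hx : 0 < y + x) (b : ℝ) (i : ℕ) :
    HasDerivAt (fun x => b * (rpowDerivCoeff α i * (y + x) ^ (α - i)))
      (b * (rpowDerivCoeff α (i + 1) * (y + x) ^ (α - (i + 1 : ℕ)))) x := by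
  have h := ((((hasDerivAt_id x).const_add y).rpow_const (p := α - i)
    (Or.inl hx.ne')).const_mul (rpowDerivCoeff α i)).const_mul b
  refine h.congr_deriv ?_
  simp only [rpowDerivCoeff, Finset.prod_range_succ, Nat.cast_add, Nat.cast_one, id, sub_sub]
  ring

theorem exists_norm_sum_rpow_le {α : ℝ} (hα : ∀ n : ℤ, α ≠ n) {n : ℕ} (hn : 2 ≤ n)
    {ε : ℝ} (hε : 0 < ε) :
    ∃ C a : ℝ, 0 < C ∧ 0 < a ∧ ∀ (B R y : ℝ) (N : ℕ), 0 < B → 0 < R → R ≤ y →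
      y + 2 * N ≤ 5 * R → ∀ lam, lam = a * (B * R ^ (α - (n + 1 : ℕ))) →
      ‖∑ m ∈ Finset.range N, e (B * (y + m) ^ α)‖ ≤ C * ((1 + lam ^ (-ε)) *
        (N * lam ^ (1 / (2 * (tri n : ℝ))) + (N : ℝ) ^ (1 - 1 / (2 * (tri n : ℝ))) +
          (N : ℝ) ^ (1 - 1 / (tri n : ℝ)) * lam ^ (-(1 / (((n : ℝ) + 1) * tri n))))) := by
  set c := rpowDerivCoeff α (n + 1) with hc
  set b := α - (n + 1 : ℕ) with hb
  set w := min 1 ((5 : ℝ) ^ b)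
  set W := max 1 ((5 : ℝ) ^ b)
  have hw : 0 < w := lt_min one_pos (by positivity)
  have hwW : w ≤ W := (min_le_left _ _).trans (le_max_left _ _)
  have hc0 : 0 < |c| := abs_pos.2 (rpowDerivCoeff_ne_zero hα _)
  obtain ⟨C, hC, hmain⟩ := exists_norm_sum_le hn ((one_le_div hw).2 hwW) hε
  refine ⟨C, |c| * w, hC, by positivity, fun B R y N hB hR hy hyN lam hlam => ?_⟩
  obtain ⟨σ, hσ, hσc⟩ : ∃ σ : ℝ, (σ = 1 ∨ σ = -1) ∧ σ * c = |c| := by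
    rcases abs_choice c with h | h
    · exact ⟨1, Or.inl rfl, by rw [h, one_mul]⟩
    · exact ⟨-1, Or.inr rfl, by rw [h, neg_one_mul]⟩
  have hsum : ‖∑ m ∈ Finset.range N, e (B * (y + m) ^ α)‖ =
      ‖∑ m ∈ Finset.range N, e (σ * B * (rpowDerivCoeff α 0 * (y + m) ^ (α - (0 : ℕ))))‖ := by
    rcases hσ with rfl | rfl
    · simp [rpowDerivCoeff]
    · rw [← norm_sum_e_neg]
      simp [rpowDerivCoeff]
  rw [hsum]
  refine hmain N lam (fun i x => σ * B * (rpowDerivCoeff α i * (y + x) ^ (α - i)))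
    (by rw [hlam]; positivity)
    (fun i _ x hx => hasDerivAt_rpowDerivCoeff_mul (by linarith [hx.1]) _ _) fun x hx => ?_
  obtain ⟨h1, h2⟩ := min_le_rpow_of_mem_Icc (t := (y + x) / R) (c := 5)
    ⟨(one_le_div hR).2 (by linarith [hx.1]), (div_le_iff₀ hR).2 (by linarith [hx.2])⟩ b
  have hval : σ * B * (c * (y + x) ^ b) = |c| * (B * R ^ b) * ((y + x) / R) ^ b := by
    rw [← hσc, Real.div_rpow (by linarith [hx.1]) hR.le]
    field_simp
  have hpos : 0 < |c| * (B * R ^ b) := by positivity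
  change lam ≤ σ * B * (c * (y + x) ^ b) ∧ σ * B * (c * (y + x) ^ b) ≤ _
  rw [hval, hlam]
  constructor
  · calc _ = |c| * (B * R ^ b) * w := by ring
      _ ≤ _ := by gcongr
  · calc _ ≤ |c| * (B * R ^ b) * W := by gcongr
      _ = _ := by field_simp

theorem exists_norm_sum_rpow_le_of_one_le {α : ℝ} (hα : ∀ n : ℤ, α ≠ n) {k : ℕ} (hk : 3 ≤ k)
    {δ : ℝ} (hδ : 0 < δ) :
    ∃ C : ℝ, 0 < C ∧ ∀ (B R y : ℝ) (N : ℕ), 0 < B → 1 ≤ R → 1 ≤ B * R ^ α → R ≤ y →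
      (N : ℝ) ≤ 2 * R → y + 2 * N ≤ 5 * R →
      ‖∑ m ∈ Finset.range N, e (B * (y + m) ^ α)‖ ≤ C * R ^ δ *
        (R * (B * R ^ (α - k)) ^ (1 / ((k : ℝ) * (k - 1))) + R ^ (1 - 1 / ((k : ℝ) * (k - 1))) +
          R * (B * R ^ α) ^ (-(2 / ((k : ℝ) ^ 2 * (k - 1))))) := by
  obtain ⟨n, rfl⟩ : ∃ n, k = n + 1 := ⟨k - 1, by omega⟩
  have hn : 2 ≤ n := by omega
  have hn' : (2 : ℝ) ≤ n := by exact_mod_cast hn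
  have hk0 : (0 : ℝ) < (n + 1 : ℕ) := by positivity
  obtain ⟨C, a, hC, ha, hmain⟩ := exists_norm_sum_rpow_le hα hn (div_pos hδ hk0)
  set p : ℝ := 1 / (((n + 1 : ℕ) : ℝ) * ((n + 1 : ℕ) - 1)) with hp
  set u : ℝ := 2 / (((n + 1 : ℕ) : ℝ) ^ 2 * ((n + 1 : ℕ) - 1)) with hu
  have htri : 2 * (tri n : ℝ) = n * (n + 1) := by exact_mod_cast two_mul_tri n
  have htri0 : (0 : ℝ) < tri n := by exact_mod_cast tri_pos (by omega : 1 ≤ n)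
  have e1 : 1 / (2 * (tri n : ℝ)) = p := by
    rw [htri, hp]; push_cast; ring
  have e2 : 1 / (tri n : ℝ) = 2 * p := by
    rw [← e1]; field_simp
  have e3 : 1 / (((n : ℝ) + 1) * tri n) = u := by
    rw [show (tri n : ℝ) = n * (n + 1) / 2 by linarith, hu]
    push_cast
    rw [add_sub_cancel_right]
    field_simp
  have hp0 : 0 < p := by rw [← e1]; positivity
  have hp2 : 2 * p ≤ 1 := by
    rw [← e2, div_le_one htri0]; nlinarith
  have hku : ((n + 1 : ℕ) : ℝ) * u = 2 * p := by
    rw [← e2, ← e3]; push_cast; field_simp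
  have hu0 : 0 < u := by rw [← e3]; positivity
  refine ⟨C * ((1 + a ^ (-(δ / (n + 1 : ℕ)))) *
    (2 * a ^ p + 2 ^ (1 - p) + 2 ^ (1 - 2 * p) * a ^ (-u))), by positivity,
    fun B R y N hB hR hZ hy hN hyN => ?_⟩
  have hR0 : 0 < R := one_pos.trans_le hR
  refine (hmain B R y N hB hR0 hy hyN _ rfl).trans ?_
  rw [e1, e2, e3]
  set Z := B * R ^ α with hZdef
  have hZ0 : 0 < Z := one_pos.trans_le hZ
  have hlam : B * R ^ (α - (n + 1 : ℕ)) = Z * R ^ (-((n + 1 : ℕ) : ℝ)) := by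
    rw [hZdef, mul_assoc, ← Real.rpow_add hR0, sub_eq_add_neg]
  have hneg : ∀ v : ℝ, (a * (B * R ^ (α - (n + 1 : ℕ)))) ^ (-v) =
      a ^ (-v) * (Z ^ (-v) * R ^ ((n + 1 : ℕ) * v)) := fun v => by
    rw [hlam, Real.mul_rpow ha.le (by positivity), Real.mul_rpow hZ0.le (by positivity),
      ← Real.rpow_mul hR0.le, neg_mul_neg]
  have hδR : 1 ≤ R ^ δ := Real.one_le_rpow hR hδ.le
  have hfac : 1 + (a * (B * R ^ (α - (n + 1 : ℕ)))) ^ (-(δ / (n + 1 : ℕ))) ≤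
      (1 + a ^ (-(δ / (n + 1 : ℕ)))) * R ^ δ := by
    have h1 : Z ^ (-(δ / (n + 1 : ℕ))) ≤ 1 :=
      Real.rpow_le_one_of_one_le_of_nonpos hZ (neg_nonpos.2 (by positivity))
    rw [hneg, mul_div_cancel₀ _ hk0.ne', add_mul, one_mul]
    refine add_le_add hδR ?_
    gcongr
    exact mul_le_of_le_one_left (by positivity) h1
  have ht1 : N * (a * (B * R ^ (α - (n + 1 : ℕ)))) ^ p ≤
      2 * a ^ p * (R * (B * R ^ (α - (n + 1 : ℕ))) ^ p) := by
    rw [Real.mul_rpow ha.le (by positivity)]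
    calc _ ≤ 2 * R * (a ^ p * (B * R ^ (α - (n + 1 : ℕ))) ^ p) := by gcongr
      _ = _ := by ring
  have hNpow : ∀ v : ℝ, 0 ≤ v → (N : ℝ) ^ v ≤ 2 ^ v * R ^ v := fun v hv => by
    rw [← Real.mul_rpow two_pos.le hR0.le]
    exact Real.rpow_le_rpow (by positivity) hN hv
  have ht3 : (N : ℝ) ^ (1 - 2 * p) * (a * (B * R ^ (α - (n + 1 : ℕ)))) ^ (-u) ≤
      2 ^ (1 - 2 * p) * a ^ (-u) * (R * Z ^ (-u)) := by
    rw [hneg, hku]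
    calc _ ≤ 2 ^ (1 - 2 * p) * R ^ (1 - 2 * p) * (a ^ (-u) * (Z ^ (-u) * R ^ (2 * p))) := by
          gcongr
          exact hNpow _ (by linarith)
      _ = 2 ^ (1 - 2 * p) * a ^ (-u) * (R ^ (1 - 2 * p) * R ^ (2 * p) * Z ^ (-u)) := by ring
      _ = _ := by rw [← Real.rpow_add hR0, sub_add_cancel, Real.rpow_one]
  have ht2 := hNpow (1 - p) (by linarith)
  set T1 := R * (B * R ^ (α - (n + 1 : ℕ))) ^ p with hT1
  set T2 := R ^ (1 - p)
  set T3 := R * Z ^ (-u)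
  have hT1p : 0 ≤ T1 := by positivity
  have hT2p : 0 ≤ T2 := by positivity
  have hT3p : 0 ≤ T3 := by positivity
  have hA : 0 ≤ 2 * a ^ p := by positivity
  have hB' : (0 : ℝ) ≤ 2 ^ (1 - p) := by positivity
  have hC' : 0 ≤ 2 ^ (1 - 2 * p) * a ^ (-u) := by positivity
  have hsum : 2 * a ^ p * T1 + 2 ^ (1 - p) * T2 + 2 ^ (1 - 2 * p) * a ^ (-u) * T3 ≤
      (2 * a ^ p + 2 ^ (1 - p) + 2 ^ (1 - 2 * p) * a ^ (-u)) * (T1 + T2 + T3) := by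
    nlinarith [mul_nonneg hA hT2p, mul_nonneg hA hT3p, mul_nonneg hB' hT1p, mul_nonneg hB' hT3p,
      mul_nonneg hC' hT1p, mul_nonneg hC' hT2p]
  calc _ ≤ C * ((1 + a ^ (-(δ / (n + 1 : ℕ)))) * R ^ δ *
        ((2 * a ^ p + 2 ^ (1 - p) + 2 ^ (1 - 2 * p) * a ^ (-u)) * (T1 + T2 + T3))) := by
        gcongr
        exact (add_le_add (add_le_add ht1 ht2) ht3).trans hsum
    _ = _ := by ring

theorem filter_range_eq_map_Ico {x y z : ℝ} (hyz : y ≤ z) :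
    Finset.filter (fun r : ℝ => x ≤ r ∧ r < y)
        (do let a ← Finset.range ⌈z⌉₊; pure (a : ℝ)) =
      (Finset.Ico ⌈x⌉₊ ⌈y⌉₊).map Nat.castEmbedding := by
  ext r
  simp only [Finset.mem_filter, Finset.bind_def, Finset.pure_def, Finset.mem_sup,
    Finset.mem_singleton, Finset.mem_range, Finset.mem_map, Finset.mem_Ico, Nat.ceil_le,
    Nat.lt_ceil, Nat.castEmbedding_apply]
  constructor
  · rintro ⟨⟨n, -, rfl⟩, h⟩
    exact ⟨n, h, rfl⟩
  · rintro ⟨n, h, rfl⟩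
    exact ⟨⟨n, h.2.trans_le hyz, rfl⟩, h⟩

/-- Let `α > 0` be a non-integer, `k ≥ 3` an integer, `δ > 0`, `h ≥ 1`,
`q ≥ 2`, `ξ = l/q` with `1 ≤ l ≤ q-1`, `m ≥ 1`, `mq ≤ X`, `R₁ = X/(mq)`, `R₁ < R₂ ≤ 2R₁`.
Then `∑_{R₁-ξ ≤ r < R₂-ξ} e(h (mq)^α (r+ξ)^α) ≪_{k,δ} h^{1/(k(k-1))} (X/(mq))^δ (T₁+T₂+T₃)`
with `T₁ = X^{1-(k-α)/(k(k-1))}/(mq)^{1-1/(k-1)}`, `T₂ = (X/(mq))^{1-1/(k(k-1))}`,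
`T₃ = X^{1-2α/(k²(k-1))}/(mq)`. -/
theorem type_I_inner_sum_derivative_test
    (α δ : ℝ) (k : ℕ) (hα : 0 < α) (hαnonint : ∀ n : ℤ, α ≠ (n : ℝ))
    (hk : 3 ≤ k) (hδ : 0 < δ) :
    ∃ C : ℝ, 0 < C ∧ ∀ (X h R₂ : ℝ) (q m l : ℕ),
      1 ≤ h → 2 ≤ q → 1 ≤ l → l ≤ q - 1 → 1 ≤ m → ((m : ℝ) * q) ≤ X →
      X / ((m : ℝ) * q) < R₂ → R₂ ≤ 2 * (X / ((m : ℝ) * q)) →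
      ‖∑ r ∈ (Finset.range ⌈R₂⌉₊).filter
          (fun r => X / ((m : ℝ) * q) - (l : ℝ) / q ≤ (r : ℝ) ∧
            (r : ℝ) < R₂ - (l : ℝ) / q),
          e (h * ((m : ℝ) * q) ^ α * ((r : ℝ) + (l : ℝ) / q) ^ α)‖
        ≤ C * h ^ ((1 : ℝ) / (k * (k - 1))) * (X / ((m : ℝ) * q)) ^ δ *
          (X ^ (1 - ((k : ℝ) - α) / (k * (k - 1))) / ((m : ℝ) * q) ^ (1 - 1 / ((k : ℝ) - 1))
            + (X / ((m : ℝ) * q)) ^ (1 - 1 / ((k : ℝ) * (k - 1)))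
            + X ^ (1 - 2 * α / ((k : ℝ) ^ 2 * (k - 1))) / ((m : ℝ) * q)) := by
  have hk' : (3 : ℝ) ≤ k := by exact_mod_cast hk
  obtain ⟨C, hC, hmain⟩ := exists_norm_sum_rpow_le_of_one_le hαnonint hk hδ
  refine ⟨C, hC, fun X h R₂ q m l hh hq hl hlq hm hX hR₂ hR₂' => ?_⟩
  set Q : ℝ := (m : ℝ) * q
  set R : ℝ := X / Q with hRdef
  set ξ : ℝ := (l : ℝ) / q
  set p : ℝ := 1 / ((k : ℝ) * (k - 1)) with hp
  set u : ℝ := 2 / ((k : ℝ) ^ 2 * (k - 1)) with hu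
  have hk1 : (0 : ℝ) < k - 1 := by linarith
  have hp0 : 0 < p := by positivity
  have hu0 : 0 < u := by positivity
  have hq0 : (0 : ℝ) < q := by positivity
  have hQ0 : 0 < Q := by positivity
  have hX0 : 0 < X := hQ0.trans_le hX
  have hh0 : 0 < h := one_pos.trans_le hh
  have hR : 1 ≤ R := (one_le_div hQ0).2 hX
  have hR0 : 0 < R := one_pos.trans_le hR
  have hξ1 : ξ ≤ 1 := (div_le_one hq0).2 (by exact_mod_cast hlq.trans (Nat.sub_le q 1))
  have hξ0 : 0 ≤ ξ := by positivity
  have hXQR : X = Q * R := by rw [hRdef, mul_div_cancel₀ _ hQ0.ne']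
  have hX1 : 1 ≤ X := by
    have hq1 : (1 : ℝ) ≤ q := by exact_mod_cast (by omega : 1 ≤ q)
    have hm1 : (1 : ℝ) ≤ m := by exact_mod_cast hm
    exact (one_le_mul_of_one_le_of_one_le hm1 hq1).trans hX
  have hBR : h * Q ^ α * R ^ α = h * X ^ α := by
    rw [hXQR, Real.mul_rpow hQ0.le hR0.le, mul_assoc]
  have hab : ⌈R - ξ⌉₊ ≤ ⌈R₂ - ξ⌉₊ := Nat.ceil_mono (by linarith)
  have ha := Nat.le_ceil (R - ξ)
  have ha' := Nat.ceil_lt_add_one (a := R - ξ) (by linarith)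
  have hb' := Nat.ceil_lt_add_one (a := R₂ - ξ) (by linarith)
  have hlen : ((⌈R₂ - ξ⌉₊ - ⌈R - ξ⌉₊ : ℕ) : ℝ) = (⌈R₂ - ξ⌉₊ : ℝ) - ⌈R - ξ⌉₊ := Nat.cast_sub hab
  have hbound := hmain (h * Q ^ α) R (⌈R - ξ⌉₊ + ξ) (⌈R₂ - ξ⌉₊ - ⌈R - ξ⌉₊) (by positivity) hR
    (by rw [hBR]; exact one_le_mul_of_one_le_of_one_le hh (Real.one_le_rpow hX1 hα.le))
    (by linarith) (by linarith) (by linarith)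
  rw [filter_range_eq_map_Ico (by linarith), Finset.sum_map, Finset.sum_Ico_eq_sum_range]
  simp only [Nat.castEmbedding_apply, Nat.cast_add, add_right_comm _ _ ξ]
  refine hbound.trans ?_
  have hT1 : R * (h * Q ^ α * R ^ (α - k)) ^ p =
      h ^ p * (X ^ (1 - ((k : ℝ) - α) / (k * (k - 1))) / Q ^ (1 - 1 / ((k : ℝ) - 1))) := by
    have hbase : h * Q ^ α * R ^ (α - k) = h * (X ^ (α - k) * Q ^ (k : ℝ)) := by
      rw [hXQR, Real.mul_rpow hQ0.le hR0.le, mul_assoc h, mul_right_comm (Q ^ (α - k)),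
        ← Real.rpow_add hQ0, sub_add_cancel]
    have hexp : (k : ℝ) * p = 1 / ((k : ℝ) - 1) := by
      rw [hp]; field_simp
    have hexp' : (α - k) * p = -(((k : ℝ) - α) / (k * (k - 1))) := by
      rw [hp]; ring
    rw [hbase, Real.mul_rpow hh0.le (by positivity), Real.mul_rpow (by positivity) (by positivity),
      ← Real.rpow_mul hX0.le, ← Real.rpow_mul hQ0.le, hexp, hexp', hRdef, sub_eq_add_neg (1 : ℝ),
      Real.rpow_add hX0, Real.rpow_one, Real.rpow_sub hQ0, Real.rpow_one]
    field_simp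
  have hhp : 1 ≤ h ^ p := Real.one_le_rpow hh hp0.le
  have hT2 : R ^ (1 - p) ≤ h ^ p * R ^ (1 - p) := le_mul_of_one_le_left (by positivity) hhp
  have hT3 : R * (h * Q ^ α * R ^ α) ^ (-u) ≤
      h ^ p * (X ^ (1 - 2 * α / ((k : ℝ) ^ 2 * (k - 1))) / Q) := by
    have hexp : α * -u = -(2 * α / ((k : ℝ) ^ 2 * (k - 1))) := by
      rw [hu]; ring
    have hhu : h ^ (-u) ≤ h ^ p := Real.rpow_le_rpow_of_exponent_le hh (by linarith)
    rw [hBR, Real.mul_rpow hh0.le (by positivity), ← Real.rpow_mul hX0.le, hexp,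
      sub_eq_add_neg (1 : ℝ), Real.rpow_add hX0, Real.rpow_one, hRdef]
    calc _ = h ^ (-u) * (X * X ^ (-(2 * α / ((k : ℝ) ^ 2 * (k - 1)))) / Q) := by ring
      _ ≤ _ := by gcongr
  calc _ ≤ C * R ^ δ * (h ^ p * (X ^ (1 - ((k : ℝ) - α) / (k * (k - 1))) /
          Q ^ (1 - 1 / ((k : ℝ) - 1))) + h ^ p * R ^ (1 - p) +
          h ^ p * (X ^ (1 - 2 * α / ((k : ℝ) ^ 2 * (k - 1))) / Q)) := by
        rw [hT1]
        gcongr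
    _ = _ := by ring
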